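/- There exists 0 < G* < ∞ such that for every G > G* and every choice of forward behavior X⁺ and backward behavior Y⁻ among the four types below, there exists a globally defined solution r : ℝ → (0,∞) of the REI3BP exhibiting behavior X⁺ as t → +∞ and behavior Y⁻ as t → −∞. The four forward types are: hyperbolic (r(t) → ∞ and r'(t) → c for some constant c > 0 as t → +∞); parabolic (r(t) → ∞ and r'(t) → 0 as t → +∞); bounded (limsup_{t→+∞} r(t) < ∞); oscillatory (limsup_{t→+∞} r(t) = ∞ and liminf_{t→+∞} r(t) < ∞); the backward types are defined identically with t → −∞. In particular, the REI3BP possesses oscillatory orbits, i.e. solutions with limsup_{t→±∞} r(t) = ∞ and liminf_{t→±∞} r(t) < ∞. -/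

import Mathlib

/- STATEMENT 1: All sixteen past-future combinations of final motions
(hyperbolic, parabolic, bounded, oscillatory) occur in the REI3BP for
large angular momentum `G`; in particular oscillatory motions exist. -/

open Real Filter

/-- The inverse of Kepler's equation `u ↦ u - sin u`. -/
noncomputable def keplerE : ℝ → ℝ := Function.invFun (fun u : ℝ => u - Real.sin u)

/-- The regularized degenerate Keplerian collision orbit of the primaries. -/
noncomputable def primRho (t : ℝ) : ℝ := 1 - Real.cos (keplerE t)

/-- `r` is a solution of the REI3BP with angular momentum `G` on the set `s`. -/
def IsSolutionOn (G : ℝ) (r : ℝ → ℝ) (s : Set ℝ) : Prop :=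
  ∀ t ∈ s, 0 < r t ∧ ContDiffAt ℝ 2 r t ∧
    deriv (deriv r) t =
      G ^ 2 / r t ^ 3 - r t * (r t ^ 2 + primRho t ^ 2 / 4) ^ (-(3 : ℝ) / 2)

/-- The four possible types of final motion. -/
inductive FinalMotion where
  | hyperbolic | parabolic | bounded | oscillatory

/-- The behavior of a solution `r` along the filter `l` (`atTop` for forward final
motion as `t → +∞`, `atBot` for backward final motion as `t → −∞`). -/
def HasFinalMotion (l : Filter ℝ) (r : ℝ → ℝ) : FinalMotion → Prop
  | .hyperbolic => Tendsto r l atTop ∧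
      ∃ c : ℝ, 0 < c ∧ Tendsto (fun t => |deriv r t|) l (nhds c)
  | .parabolic => Tendsto r l atTop ∧ Tendsto (deriv r) l (nhds 0)
  | .bounded => ∃ M : ℝ, ∀ᶠ t in l, r t ≤ M
  | .oscillatory => (∀ M : ℝ, ∃ᶠ t in l, M < r t) ∧ (∃ M : ℝ, ∃ᶠ t in l, r t < M)

open Real Filter

noncomputable section

local notation "§" => (by linarith)
local notation "¶" => (by positivity)
local notation "£" => (by norm_num)
local notation "κ₇" => (-(7:ℝ)/6)
local notation "κ₃" => (-(3:ℝ)/2)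
local notation "Γ₀" => (10:ℝ)^40

def qq (t : ℝ) : ℝ := primRho t ^ 2 / 4

lemma kep_hasDeriv (u : ℝ) : HasDerivAt (fun u : ℝ => u - Real.sin u) (1 - Real.cos u) u :=
  (hasDerivAt_id u).sub (Real.hasDerivAt_sin u)

lemma kep_mono : StrictMono (fun u : ℝ => u - Real.sin u) := by
  intro x y h
  have h1 : |Real.sin ((y-x)/2)| < (y-x)/2 := by
    have := Real.abs_sin_lt_abs (x := (y-x)/2) §
    rwa [abs_of_pos (a := (y-x)/2) §] at this
  have h2 := Real.sin_sub_sin y x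
  have h3 := Real.abs_cos_le_one ((y+x)/2)
  have h4 : |Real.sin y - Real.sin x| < y - x := by
    rw [h2, abs_mul, abs_mul, abs_two]
    nlinarith [abs_nonneg (Real.sin ((y-x)/2)), abs_nonneg (Real.cos ((y+x)/2))]
  have := (abs_lt.1 h4).2
  simp only; linarith

lemma kep_surj : Function.Surjective (fun u : ℝ => u - Real.sin u) := by
  intro b
  have hc : Continuous (fun u : ℝ => u - Real.sin u) := by fun_prop
  have h1 : b ∈ Set.Icc ((fun u : ℝ => u - Real.sin u) (b-1)) ((fun u : ℝ => u - Real.sin u) (b+1)) := by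
    constructor <;> simp only
    · linarith [Real.neg_one_le_sin (b-1)]
    · linarith [Real.sin_le_one (b+1)]
  obtain ⟨x, -, hx⟩ := intermediate_value_Icc (by linarith : b-1 ≤ b+1) hc.continuousOn h1
  exact ⟨x, hx⟩

lemma keplerE_right (t : ℝ) : keplerE t - Real.sin (keplerE t) = t :=
  Function.invFun_eq (kep_surj t)

lemma keplerE_left (u : ℝ) : keplerE (u - Real.sin u) = u :=
  kep_mono.injective (keplerE_right _)

lemma keplerE_continuous : Continuous keplerE := by
  have hm : Monotone keplerE := by
    intro s t h
    by_contra! hh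
    have := kep_mono hh
    simp only [keplerE_right] at this
    linarith
  exact hm.continuous_of_surjective fun u => ⟨_, keplerE_left u⟩

lemma qq_cont : Continuous qq := by
  unfold qq primRho
  have := keplerE_continuous
  fun_prop

lemma qq_nonneg (t : ℝ) : 0 ≤ qq t := by unfold qq; positivity

lemma qq_le (t : ℝ) : qq t ≤ 1 := by
  unfold qq primRho
  have := Real.neg_one_le_cos (keplerE t)
  have := Real.cos_le_one (keplerE t)
  nlinarith

lemma qq_kep (u : ℝ) : qq (u - Real.sin u) = (1 - Real.cos u)^2/4 := by
  unfold qq primRho; rw [keplerE_left]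

lemma qq_even (t : ℝ) : qq (-t) = qq t := by
  obtain ⟨u, rfl⟩ := kep_surj t
  have h : -(u - Real.sin u) = (-u) - Real.sin (-u) := by rw [Real.sin_neg]; ring
  simp only
  rw [h, qq_kep, qq_kep, Real.cos_neg]

lemma qq_per (t : ℝ) : qq (t + 2*π) = qq t := by
  obtain ⟨u, rfl⟩ := kep_surj t
  have h : (u - Real.sin u) + 2*π = (u+2*π) - Real.sin (u+2*π) := by rw [Real.sin_add_two_pi]; ring
  simp only
  rw [h, qq_kep, qq_kep, Real.cos_add_two_pi]

lemma qq_periodic : Function.Periodic qq (2*π) := qq_per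

lemma kep_int_pos : 0 < ∫ u in (0:ℝ)..(2*π), 2 * (1 - Real.cos u) * Real.sin u * Real.sin (u - Real.sin u) := by
  have key : ∀ u ∈ Set.Icc 0 π, 0 ≤ Real.sin u ∧ 0 ≤ Real.sin (u - Real.sin u) := by
    intro u hu
    have h0 := Real.sin_nonneg_of_mem_Icc hu
    refine ⟨h0, Real.sin_nonneg_of_mem_Icc ⟨?_, by linarith [hu.2]⟩⟩
    linarith [Real.sin_le hu.1]
  apply intervalIntegral.integral_pos ¶ (by fun_prop)
  · intro u hu
    have h1 : 0 ≤ 1 - Real.cos u := by linarith [Real.cos_le_one u]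
    rcases le_total u π with h | h
    · have := key u ⟨hu.1.le, h⟩
      have := this.1; have := (key u ⟨hu.1.le, h⟩).2; positivity
    · have := key (2*π - u) ⟨by linarith [hu.2], by linarith⟩
      rw [Real.sin_two_pi_sub] at this
      have h2 : 2*π - u - -Real.sin u = 2*π - (u - Real.sin u) := by ring
      rw [h2, Real.sin_two_pi_sub] at this
      have := mul_nonneg this.1 this.2
      nlinarith
  · refine ⟨π/2, ⟨by positivity, by linarith [Real.pi_pos]⟩, ?_⟩
    rw [Real.cos_pi_div_two, Real.sin_pi_div_two]
    have := Real.sin_pos_of_mem_Ioo (x := π/2 - 1) ⟨by linarith [Real.pi_gt_three], by linarith [Real.pi_pos]⟩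
    linarith

lemma qq_fourier_cos : ∫ x in (0:ℝ)..(2*π), qq x * Real.cos x < 0 := by
  have h1 : ∫ u in (0:ℝ)..(2*π), ((fun x => qq x * Real.cos x) ∘ (fun u => u - Real.sin u)) u * (1 - Real.cos u)
      = ∫ x in (0 - Real.sin 0)..(2*π - Real.sin (2*π)), qq x * Real.cos x := by
    apply intervalIntegral.integral_comp_mul_deriv
    · intro x _; exact kep_hasDeriv x
    · fun_prop
    · have := qq_cont; fun_prop
  simp only [Real.sin_zero, Real.sin_two_pi, sub_zero, Function.comp] at h1
  rw [← h1]
  have h2 : ∫ u in (0:ℝ)..(2*π), (2 * (1 - Real.cos u) * Real.sin u * Real.sin (u - Real.sin u)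
      + (1 - Real.cos u)^3 * Real.cos (u - Real.sin u)) = 0 := by
    rw [intervalIntegral.integral_eq_sub_of_hasDerivAt (f := fun u => (1 - Real.cos u)^2 * Real.sin (u - Real.sin u))]
    · simp
    · intro u _
      have := ((((hasDerivAt_const u (1:ℝ)).sub (Real.hasDerivAt_cos u)).pow 2).mul ((kep_hasDeriv u).sin))
      exact this.congr_deriv (by simp; ring)
    · apply Continuous.intervalIntegrable; fun_prop
  rw [intervalIntegral.integral_add (by apply Continuous.intervalIntegrable; fun_prop) (by apply Continuous.intervalIntegrable; fun_prop)] at h2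
  have h3 := kep_int_pos
  have h4 : ∫ u in (0:ℝ)..(2*π), qq (u - Real.sin u) * Real.cos (u - Real.sin u) * (1 - Real.cos u)
     = (1/4) * ∫ u in (0:ℝ)..(2*π), (1 - Real.cos u)^3 * Real.cos (u - Real.sin u) := by
    rw [← intervalIntegral.integral_const_mul]
    congr 1; ext u; rw [qq_kep]; ring
  rw [h4]; linarith

lemma qq_fourier : ∫ x in (0:ℝ)..(2*π), (qq x : ℂ) * Complex.exp (-(Complex.I * x)) ≠ 0 := by
  intro h
  have h1 := congrArg Complex.re h
  have hc := qq_cont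
  have h2 : (∫ x in (0:ℝ)..(2*π), (qq x : ℂ) * Complex.exp (-(Complex.I * x))).re
     = ∫ x in (0:ℝ)..(2*π), ((qq x : ℂ) * Complex.exp (-(Complex.I * x))).re := by
    have := Complex.reCLM.intervalIntegral_comp_comm (μ := MeasureTheory.volume) (a := 0) (b := 2*π) (f := fun x : ℝ => (qq x : ℂ) * Complex.exp (-(Complex.I * x))) (by apply Continuous.intervalIntegrable; fun_prop)
    simpa using this.symm
  rw [h2] at h1
  have h3 : ∀ x : ℝ, ((qq x : ℂ) * Complex.exp (-(Complex.I * x))).re = qq x * Real.cos x := by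
    intro x
    rw [Complex.re_ofReal_mul, Complex.exp_re]; simp
  simp only [h3] at h1
  have := qq_fourier_cos
  simp at h1; linarith

open Real Filter

def cS (z : ℂ) : ℂ := (1 + z^2) ^ (1/2 : ℂ)
def cX (z : ℂ) : ℂ := Complex.log (z + cS z) / 3
def cP (z : ℂ) : ℂ := Complex.exp (cX z) - Complex.exp (-cX z)
def cC (z : ℂ) : ℂ := Complex.exp (cX z) + Complex.exp (-cX z)
def cR (z : ℂ) : ℂ := (1 + cP z ^ 2) / 2

lemma strip_re {z : ℂ} (hz : |z.im| < 1) : 0 < (1 + z^2).re := by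
  have : z.im^2 < 1 := by rw [← sq_abs]; nlinarith [abs_nonneg z.im]
  simp [pow_two]; nlinarith [mul_self_nonneg z.re]

lemma cS_sq (z : ℂ) : cS z ^ 2 = 1 + z^2 := by
  unfold cS
  rw [← Complex.cpow_nat_mul]; norm_num

lemma cS_re {z : ℂ} (hz : |z.im| < 1) : 0 < (cS z).re := by
  have h := strip_re hz
  have h0 : (1 + z^2) ≠ 0 := by intro h0; rw [h0] at h; simp at h
  unfold cS
  rw [Complex.cpow_def_of_ne_zero h0, Complex.exp_re]
  apply mul_pos (Real.exp_pos _)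
  apply Real.cos_pos_of_mem_Ioo
  have h1 := Complex.abs_arg_lt_pi_div_two_iff.2 (Or.inl h)
  have h2 : (Complex.log (1 + z^2) * (1/2)).im = (1 + z^2).arg / 2 := by
    rw [show (1/2:ℂ) = ((1/2 : ℝ) : ℂ) by push_cast; rfl, mul_comm, Complex.im_ofReal_mul, Complex.log_im]; ring
  rw [h2]
  rw [abs_lt] at h1
  constructor <;> linarith [Real.pi_pos]

lemma cY_mul (z : ℂ) : (z + cS z) * (cS z - z) = 1 := by
  have := cS_sq z; linear_combination this

lemma cY_ne (z : ℂ) : z + cS z ≠ 0 := by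
  intro h; have := cY_mul z; rw [h] at this; simp at this

lemma cY_inv (z : ℂ) : (z + cS z)⁻¹ = cS z - z := by
  rw [inv_eq_iff_eq_inv, eq_comm, inv_eq_of_mul_eq_one_left (cY_mul z)]

lemma cY_re {z : ℂ} (hz : |z.im| < 1) : 0 < (z + cS z).re := by
  have h1 : ((z + cS z) + (z + cS z)⁻¹).re = 2 * (cS z).re := by
    rw [cY_inv]; simp; ring
  rw [Complex.add_re, Complex.inv_re] at h1
  have h2 := cS_re hz
  have h3 : 0 < Complex.normSq (z + cS z) := Complex.normSq_pos.2 (cY_ne z)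
  by_contra! h4
  have : (z + cS z).re / Complex.normSq (z + cS z) ≤ 0 := div_nonpos_of_nonpos_of_nonneg h4 h3.le
  linarith

lemma cY_slit {z : ℂ} (hz : |z.im| < 1) : z + cS z ∈ Complex.slitPlane := Or.inl (cY_re hz)

lemma exp_cX (z : ℂ) : Complex.exp (cX z) ^ 3 = z + cS z := by
  rw [← Complex.exp_nat_mul]
  unfold cX
  rw [show ((3:ℕ):ℂ) * (Complex.log (z + cS z) / 3) = Complex.log (z + cS z) by push_cast; ring,
    Complex.exp_log (cY_ne z)]

lemma exp_ncX (z : ℂ) : Complex.exp (-cX z) ^ 3 = cS z - z := by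
  rw [Complex.exp_neg, inv_pow, exp_cX, cY_inv]

lemma exp_cX_mul (z : ℂ) : Complex.exp (cX z) * Complex.exp (-cX z) = 1 := by
  rw [← Complex.exp_add]; simp

lemma cP_cubic (z : ℂ) : cP z ^ 3 + 3 * cP z = 2 * z := by
  unfold cP
  linear_combination exp_cX z - exp_ncX z - 3 * (Complex.exp (cX z) - Complex.exp (-cX z)) * exp_cX_mul z

lemma cC_cubic (z : ℂ) : cC z ^ 3 - 3 * cC z = 2 * cS z := by
  unfold cC
  linear_combination exp_cX z + exp_ncX z + 3 * (Complex.exp (cX z) + Complex.exp (-cX z)) * exp_cX_mul z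

lemma cP_cC (z : ℂ) : cP z ^ 2 + 4 = cC z ^ 2 := by
  unfold cP cC
  linear_combination -4 * exp_cX_mul z

lemma cC_re {z : ℂ} (hz : |z.im| < 1) : √3 ≤ (cC z).re := by
  have h1 := Complex.abs_arg_lt_pi_div_two_iff.2 (Or.inl (cY_re hz))
  have h2 : (cX z).im = (z + cS z).arg / 3 := by
    unfold cX
    rw [show (3:ℂ) = ((3:ℝ):ℂ) by simp, Complex.div_ofReal_im, Complex.log_im]
  have h3 : |(cX z).im| ≤ π/6 := by
    rw [h2, abs_div]; norm_num; linarith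
  have h4 : √3/2 ≤ Real.cos ((cX z).im) := by
    rw [← Real.cos_abs, ← Real.cos_pi_div_six]
    exact Real.cos_le_cos_of_nonneg_of_le_pi (abs_nonneg _) (by linarith [Real.pi_pos]) h3
  unfold cC
  rw [Complex.add_re, Complex.exp_re, Complex.exp_re]
  simp only [Complex.neg_re, Complex.neg_im, Real.cos_neg]
  have h5 : 2 ≤ Real.exp (cX z).re + Real.exp (-(cX z).re) := by
    have := Real.one_le_cosh (cX z).re
    rw [Real.cosh_eq] at this; linarith
  nlinarith [Real.sqrt_nonneg 3]

lemma cC_ne {z : ℂ} (hz : |z.im| < 1) : cC z ≠ 0 := by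
  intro h; have h1 := cC_re hz; rw [h] at h1
  have h2 := Real.sqrt_pos.2 (by norm_num : (0:ℝ)<3)
  rw [Complex.zero_re] at h1; linarith

lemma cC_norm {z : ℂ} (hz : |z.im| < 1) : 3 ≤ ‖cC z‖^2 := by
  have h1 := (cC_re hz).trans ((le_abs_self _).trans (Complex.abs_re_le_norm _))
  have := Real.sq_sqrt (by norm_num : (0:ℝ) ≤ 3)
  nlinarith [Real.sqrt_nonneg 3]

lemma cR_eq {z : ℂ} (hz : |z.im| < 1) : cR z = cS z / cC z := by
  unfold cR
  rw [div_eq_div_iff £ (cC_ne hz)]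
  linear_combination cC_cubic z + cC z * cP_cC z

lemma cR_M (z : ℂ) : 1 + z^2 = cR z ^ 2 * (2 * cR z + 3) := by
  unfold cR
  linear_combination (-1/4) * (cP z ^ 3 + 3 * cP z + 2 * z) * cP_cubic z

lemma cR_lower {z : ℂ} : ‖1 + z^2‖ ≤ ‖cR z‖^2 * (2*‖cR z‖ + 3) := by
  rw [cR_M, norm_mul, norm_pow]
  gcongr
  refine (norm_add_le _ _).trans ?_
  simp

lemma cR_upper {z : ℂ} (hz : |z.im| < 1) : ‖cR z‖^2 * (2*‖cR z‖ + 3) ≤ 3 * ‖1 + z^2‖ := by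
  rw [cR_M, norm_mul, norm_pow]
  have h1 : 2 * cR z + 3 = cC z ^2 := by
    unfold cR; linear_combination cP_cC z
  have h2 : 3 ≤ ‖2 * cR z + 3‖ := by rw [h1, norm_pow]; exact cC_norm hz
  have h3 : 2*‖cR z‖ - 3 ≤ ‖2 * cR z + 3‖ := by
    have := norm_sub_le (2 * cR z + 3) 3
    simp only [add_sub_cancel_right, norm_mul, Complex.norm_ofNat] at this
    linarith
  have h4 : 2*‖cR z‖ + 3 ≤ 3 * ‖2 * cR z + 3‖ := by linarith
  nlinarith [sq_nonneg ‖cR z‖]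

lemma cR_ne {z : ℂ} (hz : |z.im| < 1) : cR z ≠ 0 := by
  intro h
  have h1 := cR_M z
  rw [h] at h1
  have := strip_re hz
  rw [h1] at this; simp at this

lemma cP_diff {z : ℂ} (hz : |z.im| < 1) : DifferentiableAt ℂ cP z := by
  have h1 : DifferentiableAt ℂ cS z := by
    unfold cS
    exact DifferentiableAt.cpow (by fun_prop) (by fun_prop) (Or.inl (strip_re hz))
  have h2 : DifferentiableAt ℂ cX z := by
    unfold cX
    exact ((differentiableAt_id.add h1).clog (cY_slit hz)).div_const 3
  unfold cP
  exact h2.cexp.sub h2.neg.cexp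

lemma cP_deriv {z : ℂ} (hz : |z.im| < 1) : HasDerivAt cP (1/(3*cR z)) z := by
  have h := (cP_diff hz).hasDerivAt
  have h1 := (h.pow 3).add (h.const_mul 3)
  have h2 : HasDerivAt (fun z : ℂ => 2 * z) 2 z := by simpa using (hasDerivAt_id z).const_mul 2
  have h3 : (cP ^ 3 + fun y => 3 * cP y) = fun z => 2 * z := by
    ext w; exact cP_cubic w
  rw [h3] at h1
  have h4 := h1.unique h2
  have h5 := cR_ne hz
  have : deriv cP z = 1/(3*cR z) := by
    rw [eq_div_iff (by simpa using h5)]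
    unfold cR
    push_cast at h4
    linear_combination (1/2) * h4
  rwa [this] at h

lemma cR_deriv {z : ℂ} (hz : |z.im| < 1) : HasDerivAt cR (cP z/(3*cR z)) z := by
  have h := (((cP_deriv hz).pow 2).const_add 1).div_const 2
  have h5 := cR_ne hz
  exact h.congr_deriv (by push_cast; field_simp)

lemma cP_odd {z : ℂ} (hz : |z.im| < 1) : cP (-z) = - cP z := by
  have h1 : cS (-z) = cS z := by unfold cS; simp
  have h2 : cX (-z) = - cX z := by
    unfold cX
    rw [h1, show -z + cS z = (z + cS z)⁻¹ by rw [cY_inv]; ring, Complex.log_inv, neg_div]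
    intro h
    have := cY_re hz
    have := Complex.arg_eq_pi_iff.1 h
    linarith [this.1]
  unfold cP; rw [h2]; simp

lemma cR_even {z : ℂ} (hz : |z.im| < 1) : cR (-z) = cR z := by
  unfold cR; rw [cP_odd hz]; ring

lemma cP_real (x : ℝ) : ∃ y : ℝ, cP x = y := by
  have h1 : cS x = ((1 + x^2 : ℝ)^(1/2:ℝ) : ℝ) := by
    unfold cS
    rw [Complex.ofReal_cpow ¶]; push_cast; rfl
  have h2 : cX x = ((Real.log (x + (1 + x^2 : ℝ)^(1/2:ℝ)) / 3 : ℝ) : ℂ) := by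
    have h3 := cY_re (z := x) (by simp)
    unfold cX
    rw [h1] at h3 ⊢
    rw [Complex.ofReal_div, Complex.ofReal_log]
    · push_cast; rfl
    · simp at h3; simp; exact h3.le
  rw [cP, h2]
  refine ⟨Real.exp (Real.log (x + (1 + x^2 : ℝ)^(1/2:ℝ)) / 3) - Real.exp (-(Real.log (x + (1 + x^2 : ℝ)^(1/2:ℝ)) / 3)), ?_⟩
  rw [← Complex.ofReal_neg, ← Complex.ofReal_exp, ← Complex.ofReal_exp, ← Complex.ofReal_sub]

lemma cP_cub (A : ℝ) : cP (((A^3 + 3*A)/2 : ℝ)) = A := by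
  obtain ⟨y, hy⟩ := cP_real ((A^3 + 3*A)/2)
  have h := cP_cubic (((A^3 + 3*A)/2 : ℝ))
  rw [hy] at h ⊢
  have h2 : y^3 + 3*y = A^3 + 3*A := by
    have : ((y^3 + 3*y : ℝ) : ℂ) = ((A^3 + 3*A : ℝ) : ℂ) := by
      push_cast at h ⊢; linear_combination h
    exact_mod_cast this
  have h3 : (y - A) * (y^2 + y*A + A^2 + 3) = 0 := by linear_combination h2
  rcases mul_eq_zero.1 h3 with h4 | h4
  · rw [sub_eq_zero.1 h4]
  · nlinarith [sq_nonneg (y + A), sq_nonneg y, sq_nonneg A]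

lemma cP_norm (z : ℂ) : ‖cP z‖^2 ≤ 1 + 2*‖cR z‖ := by
  have : cP z ^2 = 2 * cR z - 1 := by unfold cR; ring
  rw [← norm_pow, this]
  refine (norm_sub_le _ _).trans ?_
  simp; linarith

lemma cR_cmp {z w : ℂ} (hz : |z.im| < 1) (K : ℝ) (hK : 1 ≤ K) (h : 3 * ‖1 + z^2‖ ≤ K^2 * ‖1 + w^2‖) :
    ‖cR z‖ ≤ K * ‖cR w‖ := by
  by_contra! hh
  have h1 := cR_upper hz
  have h2 := cR_lower (z := w)
  have h3 : K^2 * ‖1 + w^2‖ ≤ K^2 * (‖cR w‖^2 * (2*‖cR w‖ + 3)) := by gcongr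
  set x := ‖cR w‖
  have hx : 0 ≤ x := norm_nonneg _
  have h5 : x ≤ K * x := by nlinarith
  have h4 : (K*x)^2 * (2*x + 3) < ‖cR z‖^2 * (2 * ‖cR z‖ + 3) := by
    have ha : (K*x)^2 < ‖cR z‖^2 := by apply pow_lt_pow_left₀ hh ¶ £
    have hb : 2*x+3 ≤ 2 * ‖cR z‖ + 3 := by linarith
    nlinarith [sq_nonneg (K*x)]
  nlinarith

open Real Filter

def aG (G : ℝ) : ℝ := G^3/3
def pG (G : ℝ) (w : ℂ) : ℂ := cP (w / aG G)
def rG (G : ℝ) (w : ℂ) : ℂ := G^2 * cR (w / aG G)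

lemma aG_pos {G : ℝ} (hG : 0 < G) : 0 < aG G := by unfold aG; positivity

lemma strip_div {G : ℝ} (hG : 0 < G) {w : ℂ} (hw : |w.im| < aG G) : |(w / aG G).im| < 1 := by
  rw [Complex.div_ofReal_im, abs_div, abs_of_pos (aG_pos hG), div_lt_one (aG_pos hG)]; exact hw

lemma rG_ne {G : ℝ} (hG : 0 < G) {w : ℂ} (hw : |w.im| < aG G) : rG G w ≠ 0 := by
  unfold rG
  exact mul_ne_zero (by simpa using hG.ne') (cR_ne (strip_div hG hw))

lemma pG_deriv {G : ℝ} (hG : 0 < G) {w : ℂ} (hw : |w.im| < aG G) :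
    HasDerivAt (pG G) (1/(G * rG G w)) w := by
  have h1 := (cP_deriv (strip_div hG hw)).comp w ((hasDerivAt_id w).div_const (aG G : ℂ))
  refine HasDerivAt.congr_deriv h1 ?_
  have := cR_ne (strip_div hG hw)
  have h2 : (G:ℂ) ≠ 0 := by simpa using hG.ne'
  unfold rG aG at *
  push_cast at *
  field_simp

lemma rG_deriv {G : ℝ} (hG : 0 < G) {w : ℂ} (hw : |w.im| < aG G) :
    HasDerivAt (rG G) (G * pG G w / rG G w) w := by
  have h1 := ((cR_deriv (strip_div hG hw)).comp w ((hasDerivAt_id w).div_const (aG G : ℂ))).const_mul ((G:ℂ)^2)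
  refine HasDerivAt.congr_deriv h1 ?_
  have := cR_ne (strip_div hG hw)
  have h2 : (G:ℂ) ≠ 0 := by simpa using hG.ne'
  unfold rG pG aG at *
  push_cast at *
  field_simp

lemma pG_odd {G : ℝ} (hG : 0 < G) {w : ℂ} (hw : |w.im| < aG G) : pG G (-w) = - pG G w := by
  unfold pG; rw [neg_div, cP_odd (strip_div hG hw)]

lemma rG_even {G : ℝ} (hG : 0 < G) {w : ℂ} (hw : |w.im| < aG G) : rG G (-w) = rG G w := by
  unfold rG; rw [neg_div, cR_even (strip_div hG hw)]

def Th (G A : ℝ) : ℝ := G^3/2 * (A + A^3/3)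

lemma pG_real {G : ℝ} (hG : 0 < G) (A : ℝ) : pG G (Th G A) = A := by
  unfold pG
  have : ((Th G A : ℝ) : ℂ) / (aG G : ℂ) = (((A^3 + 3*A)/2 : ℝ) : ℂ) := by
    rw [← Complex.ofReal_div]; congr 1; unfold Th aG; field_simp; ring
  rw [this, cP_cub]

lemma rG_real {G : ℝ} (hG : 0 < G) (A : ℝ) : rG G (Th G A) = ((G^2 * (1 + A^2)/2 : ℝ) : ℂ) := by
  have := pG_real hG A
  unfold pG at this
  unfold rG cR
  rw [this]; push_cast; ring

lemma pG_norm {G : ℝ} (hG : 0 < G) (w : ℂ) : G * ‖pG G w‖ ≤ G + 2 * √‖rG G w‖ := by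
  have h := cP_norm (w / aG G)
  have h2 : ‖rG G w‖ = G^2 * ‖cR (w / aG G)‖ := by
    unfold rG; rw [norm_mul, norm_pow, Complex.norm_real, Real.norm_eq_abs, sq_abs]
  have h3 := Real.sq_sqrt (norm_nonneg (rG G w))
  have h4 := Real.sqrt_nonneg ‖rG G w‖
  apply abs_le_of_sq_le_sq' _ ¶ |>.2
  unfold pG
  have h5 : G^2 * ‖cP (w / aG G)‖^2 ≤ G^2 * (1 + 2 * ‖cR (w / aG G)‖) := by gcongr
  nlinarith [mul_nonneg hG.le h4]

lemma M_eq {G : ℝ} (hG : 0 < G) (V : ℂ) :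
    ‖1 + (V / aG G)^2‖ = ‖V - aG G * Complex.I‖ * ‖V + aG G * Complex.I‖ / aG G ^ 2 := by
  have ha := aG_pos hG
  have h2 : (aG G:ℂ) ≠ 0 := by simpa using ha.ne'
  have : 1 + (V / aG G)^2 = (V - aG G * Complex.I) * (V + aG G * Complex.I) / (aG G : ℂ)^2 := by
    field_simp
    linear_combination (aG G : ℂ)^2 * Complex.I_sq
  rw [this, norm_div, norm_mul, norm_pow, Complex.norm_real, Real.norm_eq_abs, sq_abs]

lemma cR_lb {G : ℝ} (hG : 0 < G) {V : ℂ} (hV : |V.im| ≤ aG G - 1) {τ : ℝ} (hτ : 0 ≤ τ) (h : τ - 1 ≤ |V.re|) :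
    (1+τ)/aG G/20 ≤ ‖cR (V / aG G)‖^2 ∧ ((1+τ)/aG G)^2/400 ≤ ‖cR (V / aG G)‖^3 := by
  have ha := aG_pos hG
  set a := aG G with hadef
  have hV' := abs_le.1 hV
  have e1 : (V - a * Complex.I).im = V.im - a := by simp
  have e2 : (V + a * Complex.I).im = V.im + a := by simp
  have e3 : (V - a * Complex.I).re = V.re := by simp
  have e4 : (V + a * Complex.I).re = V.re := by simp
  have i1 := Complex.abs_im_le_norm (V - a * Complex.I)
  have i2 := Complex.abs_im_le_norm (V + a * Complex.I)
  have i3 := Complex.abs_re_le_norm (V - a * Complex.I)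
  have i4 := Complex.abs_re_le_norm (V + a * Complex.I)
  rw [e1, abs_of_neg §] at i1
  rw [e2, abs_of_pos §] at i2
  rw [e3] at i3
  rw [e4] at i4
  set N1 := ‖V - a * Complex.I‖
  set N2 := ‖V + a * Complex.I‖
  have hN1 : (1+τ)/4 ≤ N1 := by linarith
  have hN2 : (1+τ)/4 ≤ N2 := by linarith
  have hN : (1+τ)/4 * a ≤ N1 * N2 := by
    rcases le_total 0 V.im with h0 | h0
    · exact mul_le_mul hN1 § ha.le (norm_nonneg _)
    · rw [mul_comm N1]; exact mul_le_mul hN2 § ha.le (norm_nonneg _)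
  have hN' : (1+τ)/4 * ((1+τ)/4) ≤ N1 * N2 := mul_le_mul hN1 hN2 § (norm_nonneg _)
  have hM := M_eq hG V
  have hl := cR_lower (z := V / aG G)
  rw [← hadef] at hM hl
  set x := (1+τ)/a with hx
  have hx0 : 0 < x := by positivity
  have hM1 : x/4 ≤ ‖1 + (V/a)^2‖ := by
    rw [hM, hx, le_div_iff₀ ¶]; field_simp; field_simp at hN; linarith
  have hM2 : x^2/16 ≤ ‖1 + (V/a)^2‖ := by
    rw [hM, hx, le_div_iff₀ ¶]; field_simp; field_simp at hN'; nlinarith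
  set R := ‖cR (V/a)‖
  have hR : 0 ≤ R := norm_nonneg _
  rcases le_total R 1 with h1 | h1
  · have : x/20 ≤ R^2 := by nlinarith
    refine ⟨this, ?_⟩
    have h3 : x/20 ≤ R := by nlinarith
    have : x/20 * (x/20) ≤ R * R^2 := mul_le_mul h3 this ¶ hR
    nlinarith
  · have h3 : x^2/80 ≤ R^3 := by nlinarith [mul_nonneg (mul_nonneg hR hR) (sub_nonneg.2 h1)]
    refine ⟨?_, by nlinarith⟩
    by_contra! h4
    have h5 : R < x/20 := by
      have : R * 1 ≤ R * R := mul_le_mul_of_nonneg_left h1 hR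
      linarith [pow_two R]
    have h6 : R * R^2 < x/20 * (x/20) := mul_lt_mul h5 h4.le ¶ ¶
    have h7 : R * R^2 = R^3 := by ring
    have h8 : x/20 * (x/20) = x^2/400 := by ring
    linarith [sq_nonneg x]

lemma rG_norm {G : ℝ} (w : ℂ) : ‖rG G w‖ = G^2 * ‖cR (w / aG G)‖ := by
  unfold rG; rw [norm_mul, norm_pow, Complex.norm_real, Real.norm_eq_abs, sq_abs]

lemma rG_lb {G : ℝ} (hG : 0 < G) {V : ℂ} (hV : |V.im| ≤ aG G - 1) {τ : ℝ} (hτ : 0 ≤ τ) (h : τ - 1 ≤ |V.re|) :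
    3/20 * (G * (1+τ)) ≤ ‖rG G V‖^2 ∧ (1+τ)^2/45 ≤ ‖rG G V‖^3 := by
  obtain ⟨h1, h2⟩ := cR_lb hG hV hτ h
  rw [rG_norm]
  constructor
  · calc 3/20 * (G * (1+τ)) = (G^2)^2 * ((1+τ)/aG G/20) := by unfold aG; field_simp
      _ ≤ (G^2)^2 * ‖cR (V / aG G)‖^2 := by gcongr
      _ = _ := by ring
  · calc (1+τ)^2/45 ≤ (1+τ)^2 * (9/400) := by nlinarith [sq_nonneg (1+τ)]
      _ = (G^2)^3 * (((1+τ)/aG G)^2/400) := by unfold aG; field_simp; norm_num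
      _ ≤ (G^2)^3 * ‖cR (V / aG G)‖^3 := by gcongr
      _ = _ := by ring

lemma rG_cmp {G : ℝ} (hG : 0 < G) {V W : ℂ} (hV : |V.im| < aG G) (hW : |W.im| ≤ aG G - 1)
    (h1 : |V.re| ≤ |W.re| + 2) (h2 : |V.im - W.im| ≤ 1) : ‖rG G V‖ ≤ 9 * ‖rG G W‖ := by
  rw [rG_norm, rG_norm]
  have ha := aG_pos hG
  have h3 : ‖cR (V / aG G)‖ ≤ 9 * ‖cR (W / aG G)‖ := by
    apply cR_cmp (strip_div hG hV) 9 £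
    rw [M_eq hG, M_eq hG]
    set a := aG G
    have hW' := abs_le.1 hW
    have key : ∀ s : ℝ, (s = 1 ∨ s = -1) → ‖V + s * a * Complex.I‖ ≤ 5 * ‖W + s * a * Complex.I‖ := by
      intro s hs
      have i1 := Complex.abs_im_le_norm (W + s * a * Complex.I)
      have i2 := Complex.abs_re_le_norm (W + s * a * Complex.I)
      have i3 := Complex.norm_le_abs_re_add_abs_im (V + s * a * Complex.I)
      have e1 : (W + s * a * Complex.I).im = W.im + s * a := by simp
      have e2 : (W + s * a * Complex.I).re = W.re := by simp
      have e3 : (V + s * a * Complex.I).im = (V.im - W.im) + (W.im + s * a) := by simp; ring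
      have e4 : (V + s * a * Complex.I).re = V.re := by simp
      rw [e1] at i1
      rw [e2] at i2
      rw [e3, e4] at i3
      have := abs_add_le (V.im - W.im) (W.im + s * a)
      have h5 : 1 ≤ |W.im + s * a| := by
        rcases hs with rfl | rfl
        · rw [abs_of_pos] <;> linarith
        · rw [abs_of_neg] <;> linarith
      linarith
    have k1 := key 1 (Or.inl rfl)
    have k2 := key (-1) (Or.inr rfl)
    simp only [Complex.ofReal_one, one_mul, Complex.ofReal_neg, neg_mul, ← sub_eq_add_neg] at k1 k2
    have := mul_le_mul k2 k1 (norm_nonneg _) ¶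
    rw [← mul_div_assoc, ← mul_div_assoc]
    refine div_le_div_of_nonneg_right ?_ ¶
    nlinarith [mul_nonneg (norm_nonneg (W - a * Complex.I)) (norm_nonneg (W + a * Complex.I))]
  nlinarith [sq_nonneg G]

lemma cS_meas : Measurable cS := by unfold cS; fun_prop
lemma cP_meas : Measurable cP := by
  unfold cP cX
  have := cS_meas
  fun_prop
lemma pG_meas (G : ℝ) : Measurable (pG G) := by
  unfold pG
  exact cP_meas.comp (by fun_prop)
lemma rG_meas (G : ℝ) : Measurable (rG G) := by
  unfold rG cR
  have := (pG_meas G)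
  unfold pG at this
  fun_prop

open Real Filter Set
set_option linter.unusedSectionVars false

def fh (x : ℂ) : ℂ := 1 - (1 + x) ^ (((-(3:ℝ)/2 : ℝ)) : ℂ)

lemma fh_slit {x : ℂ} (hx : ‖x‖ ≤ 1/2) : 1 + x ∈ Complex.slitPlane := by
  left
  have := (abs_le.1 (Complex.abs_re_le_norm x)).1
  simp; linarith

lemma fh_hd {x : ℂ} (hx : ‖x‖ ≤ 1/2) :
    HasDerivAt fh (3/2 * (1 + x) ^ ((((-(3:ℝ)/2 : ℝ)) : ℂ) - 1)) x := by
  have h := ((((hasDerivAt_id x).const_add 1).cpow_const (c := (((-(3:ℝ)/2 : ℝ)) : ℂ)) (fh_slit hx)).const_sub 1)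
  refine HasDerivAt.congr_deriv h ?_
  push_cast; simp; ring

lemma fh_zero : fh 0 = 0 := by simp [fh]

lemma fh_bd0 {x : ℂ} (hx : ‖x‖ ≤ 1/2) : ‖fh x‖ ≤ 4 := by
  unfold fh
  refine (norm_sub_le _ _).trans ?_
  rw [Complex.norm_cpow_real, norm_one]
  have h1 : 1/2 ≤ ‖1 + x‖ := by
    have := norm_sub_le (1 + x) x
    simp at this; linarith
  have h2 : ‖1+x‖ ^ κ₃ ≤ (1/2:ℝ) ^ κ₃ :=
    Real.rpow_le_rpow_of_nonpos £ h1 £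
  have h3 : (1/2:ℝ) ^ κ₃ ≤ (1/2:ℝ)^(-(3/2+0.05:ℝ)) := by
    apply Real.rpow_le_rpow_of_exponent_ge <;> norm_num
  have h4 : (1/2:ℝ) ^ κ₃ ≤ 3 := by
    have e : ((1/2:ℝ) ^ κ₃)^2 = 8 := by
      rw [← Real.rpow_natCast, ← Real.rpow_mul £]; norm_num
    nlinarith [Real.rpow_nonneg (by norm_num : (0:ℝ) ≤ 1/2) κ₃]
  linarith

lemma fh_bd {x : ℂ} (hx : ‖x‖ < 1/2) : ‖fh x‖ ≤ 8 * ‖x‖ := by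
  have := Complex.dist_le_div_mul_dist_of_mapsTo_ball (f := fh) (c := 0) (z := x) (R₁ := 1/2) (R₂ := 4) ?_ ?_ (by simpa using hx)
  · rw [fh_zero, dist_zero_right, dist_zero_right] at this; linarith
  · intro y hy; exact (fh_hd (by simp at hy; norm_num; linarith)).differentiableAt.differentiableWithinAt
  · intro y hy; rw [fh_zero, mem_closedBall_zero_iff]; exact fh_bd0 (by simp at hy; norm_num; linarith)

lemma fh_bd2 {x : ℂ} (hx : ‖x‖ < 1/2) : ‖fh x - 3/2 * x‖ ≤ 40 * ‖x‖^2 := by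
  have := Complex.dist_le_mul_div_pow_of_mapsTo_ball_of_isLittleO (f := fun x => fh x - 3/2 * x) (c := 0) (z := x) (R₁ := 1/2) (R₂ := 5) (n := 1) ?_ ?_ ?_ (by simpa using hx)
  · rw [dist_eq_norm, dist_zero_right] at this
    simp only [fh_zero, mul_zero, sub_zero] at this
    refine this.trans ?_
    ring_nf; nlinarith [sq_nonneg ‖x‖]
  · intro y hy
    exact ((fh_hd (by simp at hy; norm_num; linarith)).differentiableAt.sub (by fun_prop)).differentiableWithinAt
  · intro y hy
    simp at hy
    rw [Metric.mem_closedBall, dist_eq_norm]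
    simp only [fh_zero, mul_zero, sub_zero]
    have h1 := fh_bd0 (x := y) (by norm_num; linarith)
    have := norm_sub_le (fh y) (3/2 * y)
    rw [norm_mul] at this
    norm_num at this
    linarith
  · have h := (fh_hd (x := 0) (by simp)).isLittleO
    simp only [fh_zero, sub_zero] at h ⊢
    simp only [add_zero, Complex.one_cpow, mul_one, smul_eq_mul] at h
    simp only [mul_zero, sub_zero, pow_one]
    refine (h.norm_right).congr_left ?_
    intro y; ring

def DD (W : ℂ) : Set (ℂ × ℂ) := {x | ‖x.1 - W‖ ≤ 1 ∧ ‖x.2‖ ≤ 1/10}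
def DD' (W : ℂ) : Set (ℂ × ℂ) := {x | ‖x.1 - W‖ ≤ 1/2 ∧ ‖x.2‖ ≤ 1/20}

lemma lip_gen {Ψ : ℂ × ℂ → ℂ} {W : ℂ} {B : ℝ} (hd : ∀ x ∈ DD W, DifferentiableAt ℂ Ψ x)
    (hB : ∀ x ∈ DD W, ‖Ψ x‖ ≤ B) {x y : ℂ × ℂ} (hx : x ∈ DD' W) (hy : y ∈ DD' W) :
    ‖Ψ x - Ψ y‖ ≤ 40 * B * ‖x - y‖ := by
  have hsub : ∀ z ∈ Metric.ball y (1/20), z ∈ DD W := by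
    intro z hz
    rw [Metric.mem_ball, dist_eq_norm, Prod.norm_def, max_lt_iff] at hz
    simp only [Prod.fst_sub, Prod.snd_sub] at hz
    constructor
    · have := norm_add_le (z.1 - y.1) (y.1 - W)
      rw [sub_add_sub_cancel] at this
      linarith [hy.1, hz.1]
    · have := norm_add_le (z.2 - y.2) y.2
      rw [sub_add_cancel] at this
      linarith [hy.2, hz.2]
  have hyD : y ∈ DD W := hsub y (by simp)
  have hxD : x ∈ DD W := ⟨by linarith [hx.1], by linarith [hx.2]⟩
  have hBy := hB y hyD
  have hB0 : 0 ≤ B := (norm_nonneg _).trans hBy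
  rcases lt_or_ge ‖x - y‖ (1/20) with h | h
  · have := Complex.dist_le_div_mul_dist_of_mapsTo_ball (f := Ψ) (c := y) (z := x) (R₁ := 1/20) (R₂ := 2 * B) ?_ ?_ (by rwa [Metric.mem_ball, dist_eq_norm])
    · rw [dist_eq_norm, dist_eq_norm] at this
      linarith
    · intro z hz; exact (hd z (hsub z hz)).differentiableWithinAt
    · intro z hz
      rw [Metric.mem_closedBall, dist_eq_norm]
      have := hB z (hsub z hz)
      linarith [norm_sub_le (Ψ z) (Ψ y)]
  · have := hB x hxD
    have h2 := norm_sub_le (Ψ x) (Ψ y)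
    nlinarith

def rr (G : ℝ) (x : ℂ × ℂ) : ℂ := rG G x.1 / (1 + x.2)
def ff (G s : ℝ) (x : ℂ × ℂ) : ℂ := fh (s / rr G x ^ 2)
def Phi (G s : ℝ) (x : ℂ × ℂ) : ℂ := G * pG G x.1 * ff G s x / rr G x ^ 3
def BB (G s : ℝ) (x : ℂ × ℂ) : ℂ := 3 * x.2 + ff G s x + 2 * x.2^2 + x.2 * ff G s x
def EE (G ρ : ℝ) : ℝ := (G + 6 * √ρ) / ρ ^ 5

def VV (G : ℝ) : Set ℂ := {v | |v.re| < 1/2 ∧ |v.im| < aG G - 2}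

section
variable {G : ℝ} (hG : 2000 ≤ G) {v : ℂ} (hv : v ∈ VV G) {τ : ℝ} (hτ : 0 ≤ τ)
include hG hv hτ

lemma base_im : |(v + τ).im| ≤ aG G - 2 := by simpa using hv.2.le
lemma base_re : τ - 1/2 ≤ |(v + τ).re| ∧ |(v + τ).re| ≤ τ + 1/2 := by
  have := abs_lt.1 hv.1
  simp only [Complex.add_re, Complex.ofReal_re]
  constructor
  · exact le_trans § (le_abs_self _)
  · rw [abs_le]; constructor <;> linarith

lemma base_lb : 3/20 * (G * (1+τ)) ≤ ‖rG G (v+τ)‖^2 ∧ (1+τ)^2/45 ≤ ‖rG G (v+τ)‖^3 :=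
  rG_lb § (by linarith [base_im hG hv hτ]) hτ (by linarith [(base_re hG hv hτ).1])

lemma base_300 : 300 ≤ ‖rG G (v+τ)‖^2 := by
  have := (base_lb hG hv hτ).1
  nlinarith

lemma base_pos : 0 < ‖rG G (v+τ)‖ := by
  have := (base_300 hG hv hτ)
  rw [norm_pos_iff]
  intro h
  rw [h] at this; norm_num at this

lemma D_im {x : ℂ × ℂ} (hx : x ∈ DD (v+τ)) : |x.1.im| ≤ aG G - 1 := by
  have h1 := (Complex.abs_im_le_norm (x.1 - (v+τ))).trans hx.1
  have h2 := base_im hG hv hτ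
  rw [Complex.sub_im] at h1
  have := abs_add_le (x.1.im - (v+τ).im) (v+τ).im
  rw [sub_add_cancel] at this; linarith

lemma D_r {x : ℂ × ℂ} (hx : x ∈ DD (v+τ)) :
    ‖rG G x.1‖ ≤ 9 * ‖rG G (v+τ)‖ ∧ ‖rG G (v+τ)‖ ≤ 9 * ‖rG G x.1‖ := by
  have h1 := (Complex.abs_im_le_norm (x.1 - (v+τ))).trans hx.1
  have h2 := (Complex.abs_re_le_norm (x.1 - (v+τ))).trans hx.1
  have h3 := base_im hG hv hτ
  have h4 := D_im hG hv hτ hx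
  rw [Complex.sub_im] at h1
  rw [Complex.sub_re] at h2
  have h5 := abs_abs_sub_abs_le_abs_sub x.1.re (v+τ).re
  have h6 := abs_le.1 (h5.trans h2)
  constructor
  · exact rG_cmp § § § § h1
  · exact rG_cmp § § § § (by rw [abs_sub_comm]; exact h1)

omit hG hv hτ in
lemma one_add_bd {k : ℂ} (hk : ‖k‖ ≤ 1/10) : 9/10 ≤ ‖1 + k‖ ∧ ‖1 + k‖ ≤ 11/10 := by
  have h1 := norm_add_le 1 k
  have h2 := norm_sub_le (1 + k) k
  simp at h1 h2
  constructor <;> linarith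

lemma D_rr {x : ℂ × ℂ} (hx : x ∈ DD (v+τ)) :
    ‖rr G x‖ ≤ 10 * ‖rG G (v+τ)‖ ∧ ‖rG G (v+τ)‖ ≤ 10 * ‖rr G x‖ := by
  obtain ⟨h1, h2⟩ := D_r hG hv hτ hx
  obtain ⟨h3, h4⟩ := one_add_bd hx.2
  unfold rr
  rw [norm_div]
  have h0 := norm_nonneg (rG G (v+τ))
  have h5 := norm_nonneg (rG G x.1)
  constructor
  · rw [div_le_iff₀ §]; nlinarith
  · rw [mul_div_assoc', le_div_iff₀ §]; nlinarith

lemma D_rr_ne {x : ℂ × ℂ} (hx : x ∈ DD (v+τ)) : rr G x ≠ 0 := by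
  have h := (D_rr hG hv hτ hx).2
  have h2 := base_pos hG hv hτ
  intro h0; rw [h0, norm_zero] at h; linarith

lemma D_x {x : ℂ × ℂ} (hx : x ∈ DD (v+τ)) {s : ℝ} (hs : s ∈ Icc (0:ℝ) 1) :
    ‖(s:ℂ) / rr G x ^ 2‖ ≤ 100 / ‖rG G (v+τ)‖^2 := by
  obtain ⟨h1, h2⟩ := D_rr hG hv hτ hx
  have h3 := base_pos hG hv hτ
  rw [norm_div, norm_pow, Complex.norm_real, Real.norm_eq_abs, abs_of_nonneg hs.1]
  have h4 : 0 < ‖rr G x‖ := by linarith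
  have h5 : ‖rG G (v+τ)‖^2 ≤ (10 * ‖rr G x‖)^2 := by gcongr
  rw [div_le_div_iff₀ ¶ ¶]
  nlinarith [hs.2, sq_nonneg ‖rG G (v+τ)‖, sq_nonneg ‖rr G x‖]

lemma D_x' {x : ℂ × ℂ} (hx : x ∈ DD (v+τ)) {s : ℝ} (hs : s ∈ Icc (0:ℝ) 1) :
    ‖(s:ℂ) / rr G x ^ 2‖ < 1/2 := by
  refine (D_x hG hv hτ hx hs).trans_lt ?_
  have := base_300 hG hv hτ
  rw [div_lt_iff₀ §]; linarith

lemma D_ff {x : ℂ × ℂ} (hx : x ∈ DD (v+τ)) {s : ℝ} (hs : s ∈ Icc (0:ℝ) 1) :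
    ‖ff G s x‖ ≤ 800 / ‖rG G (v+τ)‖^2 := by
  refine (fh_bd (D_x' hG hv hτ hx hs)).trans ?_
  have := D_x hG hv hτ hx hs
  calc _ ≤ 8 * (100 / ‖rG G (v+τ)‖^2) := by gcongr
    _ = _ := by ring

lemma D_p {x : ℂ × ℂ} (hx : x ∈ DD (v+τ)) : ‖(G:ℂ) * pG G x.1‖ ≤ G + 6 * √‖rG G (v+τ)‖ := by
  have hG0 : 0 < G := by linarith
  rw [norm_mul, Complex.norm_real, Real.norm_eq_abs, abs_of_pos hG0]
  refine (pG_norm hG0 x.1).trans ?_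
  have : √‖rG G x.1‖ ≤ 3 * √‖rG G (v+τ)‖ := by
    rw [show (3:ℝ) = √9 by rw [show (9:ℝ) = 3^2 by norm_num]; simp, ← Real.sqrt_mul £]
    exact Real.sqrt_le_sqrt (D_r hG hv hτ hx).1
  linarith

lemma D_Phi {x : ℂ × ℂ} (hx : x ∈ DD (v+τ)) {s : ℝ} (hs : s ∈ Icc (0:ℝ) 1) :
    ‖Phi G s x‖ ≤ 800000 * EE G ‖rG G (v+τ)‖ := by
  have h1 := D_p hG hv hτ hx
  have h2 := D_ff hG hv hτ hx hs
  have h3 := (D_rr hG hv hτ hx).2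
  have h4 := base_pos hG hv hτ
  unfold Phi EE
  rw [norm_div, norm_mul, norm_pow]
  set ρ := ‖rG G (v+τ)‖
  have h5 : ρ/10 ≤ ‖rr G x‖ := by linarith
  have h6 := norm_nonneg ((G:ℂ) * pG G x.1)
  calc _ ≤ (G + 6 * √ρ) * (800 / ρ^2) / (ρ/10)^3 := by gcongr
    _ = _ := by field_simp; norm_num

omit hτ in
lemma base_cmp (hτ : 0 ≤ τ) {σ : ℝ} (h : τ ≤ σ) : ‖rG G (v+τ)‖ ≤ 9 * ‖rG G (v+σ)‖ := by
  have h1 := base_re hG hv hτ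
  have h2 := base_re hG hv (hτ.trans h)
  have h3 := base_im hG hv (hτ.trans h)
  have h4 := base_im hG hv hτ
  exact rG_cmp § § § § (by simp)

lemma d_rr {x : ℂ × ℂ} (hx : x ∈ DD (v+τ)) : DifferentiableAt ℂ (rr G) x := by
  have h1 : DifferentiableAt ℂ (rG G) x.1 :=
    (rG_deriv § (by linarith [D_im hG hv hτ hx])).differentiableAt
  have h2 : 1 + x.2 ≠ 0 := by
    intro h; have := (one_add_bd hx.2).1; rw [h] at this; norm_num at this
  have h3 : DifferentiableAt ℂ (fun x : ℂ × ℂ => rG G x.1) x := h1.comp x differentiableAt_fst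
  unfold rr
  fun_prop (disch := exact h2)

lemma d_ff {x : ℂ × ℂ} (hx : x ∈ DD (v+τ)) {s : ℝ} (hs : s ∈ Icc (0:ℝ) 1) :
    DifferentiableAt ℂ (ff G s) x := by
  have h1 := d_rr hG hv hτ hx
  have h2 := D_rr_ne hG hv hτ hx
  have h3 : DifferentiableAt ℂ (fun x => (s:ℂ) / rr G x ^ 2) x := by
    fun_prop (disch := exact pow_ne_zero 2 h2)
  exact DifferentiableAt.comp x (fh_hd (D_x' hG hv hτ hx hs).le).differentiableAt h3

lemma d_Phi {x : ℂ × ℂ} (hx : x ∈ DD (v+τ)) {s : ℝ} (hs : s ∈ Icc (0:ℝ) 1) :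
    DifferentiableAt ℂ (Phi G s) x := by
  have h0 : DifferentiableAt ℂ (pG G) x.1 :=
    (pG_deriv § (by linarith [D_im hG hv hτ hx])).differentiableAt
  have h1 : DifferentiableAt ℂ (fun x : ℂ × ℂ => pG G x.1) x := h0.comp x differentiableAt_fst
  have h2 := d_ff hG hv hτ hx hs
  have h3 := d_rr hG hv hτ hx
  have h4 := D_rr_ne hG hv hτ hx
  unfold Phi
  fun_prop (disch := exact pow_ne_zero 3 h4)

lemma d_BB {x : ℂ × ℂ} (hx : x ∈ DD (v+τ)) {s : ℝ} (hs : s ∈ Icc (0:ℝ) 1) :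
    DifferentiableAt ℂ (BB G s) x := by
  have := d_ff hG hv hτ hx hs
  unfold BB
  fun_prop

end

open Real Filter Set MeasureTheory
set_option linter.unusedSectionVars false

lemma w_pos {τ : ℝ} (hτ : 0 ≤ τ) (a : ℝ) : 0 < (1+τ)^a := Real.rpow_pos_of_pos § _

lemma num1 {G n ρ : ℝ} (hG : 0 < G) (hn : 1 ≤ n) (hρ : 0 < ρ) (h1 : 3/20 * (G * n) ≤ ρ^2) :
    38/100 * (√G * n^(1/2:ℝ)) ≤ ρ := by
  apply abs_le_of_sq_le_sq' _ hρ.le |>.2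
  have e : (n^(1/2:ℝ))^2 = n := by
    rw [← Real.rpow_natCast, ← Real.rpow_mul §]; norm_num
  have : (38/100 * (√G * n^(1/2:ℝ)))^2 = (38/100)^2 * (G * n) := by
    rw [mul_pow, mul_pow, Real.sq_sqrt hG.le, e]
  rw [this]
  have : 0 < G * n := by positivity
  linarith

lemma num2 {n ρ : ℝ} (hn : 1 ≤ n) (hρ : 0 < ρ) (h2 : n^2/45 ≤ ρ^3) : n^(2/3:ℝ)/3.6 ≤ ρ := by
  have hn0 : 0 < n := by linarith
  have e : (n^(2/3:ℝ))^3 = n^2 := by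
    rw [← Real.rpow_natCast, ← Real.rpow_mul §]; norm_num
  apply le_of_pow_le_pow_left₀ (n := 3) £ hρ.le
  rw [div_pow, e]
  have : 0 < n^2 := by positivity
  norm_num; linarith

lemma num3 {G n ρ : ℝ} (hG : 0 < G) (hn : 1 ≤ n) (hρ : 0 < ρ) (h1 : 3/20 * (G * n) ≤ ρ^2)
    (h2 : n^2/45 ≤ ρ^3) : 1/ρ^2 ≤ 10/√G * n^κ₇ := by
  have hn0 : 0 < n := by linarith
  have a1 := num1 hG hn hρ h1
  have a2 := num2 hn hρ h2
  have hs := Real.sqrt_pos.2 hG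
  have e : n^(1/2:ℝ) * n^(2/3:ℝ) = n^((7:ℝ)/6) := by rw [← Real.rpow_add hn0]; norm_num
  have a3 := mul_le_mul a1 a2 ¶ hρ.le
  have a4 : 38/100 * (√G * n^(1/2:ℝ)) * (n^(2/3:ℝ)/3.6) = 38/360 * (√G * n^((7:ℝ)/6)) := by
    rw [← e]; ring
  rw [a4] at a3
  have h7 : 0 < n^((7:ℝ)/6) := by positivity
  rw [neg_div, Real.rpow_neg hn0.le, ← div_eq_mul_inv, div_div, div_le_div_iff₀ ¶ ¶]
  nlinarith [mul_pos hs h7]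

lemma num4 {n ρ : ℝ} (hn : 1 ≤ n) (hρ : 0 < ρ) (h2 : n^2/45 ≤ ρ^3) : √ρ/ρ^2 ≤ 6.71/n := by
  rw [div_le_div_iff₀ ¶ §]
  apply abs_le_of_sq_le_sq' _ ¶ |>.2
  rw [mul_pow, Real.sq_sqrt hρ.le]
  have : ρ * (n^2/45) ≤ ρ * ρ^3 := by gcongr
  nlinarith [pow_pos hρ 4]

lemma num5 {G n ρ : ℝ} (hG : 0 < G) (hn : 1 ≤ n) (hρ : 0 < ρ) (h1 : 3/20 * (G * n) ≤ ρ^2)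
    (h2 : n^2/45 ≤ ρ^3) : EE G ρ * ρ ≤ 470/√G * n^(-(13:ℝ)/6) := by
  have hn0 : 0 < n := by linarith
  have b1 := num3 hG hn hρ h1 h2
  have b2 := num4 hn hρ h2
  have b3 : G/ρ^2 ≤ (20/3)/n := by
    rw [div_le_div_iff₀ ¶ §]; linarith
  have e : n^(-(13:ℝ)/6) = n^κ₇ / n := by
    rw [← Real.rpow_sub_one hn0.ne']; norm_num
  have : EE G ρ * ρ = (G/ρ^2 + 6 * (√ρ/ρ^2)) * (1/ρ^2) := by unfold EE; field_simp
  rw [this, e]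
  calc _ ≤ (20/3/n + 6 * (6.71/n)) * (10/√G * n^κ₇) := by gcongr
    _ ≤ (47/n) * (10/√G * n^κ₇) := by
        gcongr
        rw [← mul_div_assoc, ← add_div]; gcongr; norm_num
    _ = _ := by ring

lemma num6 {G n ρ : ℝ} (hG : 0 < G) (hn : 1 ≤ n) (hρ : 0 < ρ) (h1 : 3/20 * (G * n) ≤ ρ^2)
    (h2 : n^2/45 ≤ ρ^3) : EE G ρ ≤ 1000/(G*√G) * n^(-(5:ℝ)/2) := by
  have hn0 : 0 < n := by linarith
  have a1 := num1 hG hn hρ h1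
  have b2 := num4 hn hρ h2
  have b3 : G/ρ^2 ≤ (20/3)/n := by
    rw [div_le_div_iff₀ ¶ §]; linarith
  have hs := Real.sqrt_pos.2 hG
  have e : n^(-(5:ℝ)/2) = 1/(n * (n^(1/2:ℝ))^3) := by
    rw [← Real.rpow_natCast, ← Real.rpow_mul hn0.le, neg_div, Real.rpow_neg hn0.le, one_div]
    congr 1
    rw [← Real.rpow_one_add' hn0.le £]; norm_num
  have e2 : G * √G = (√G)^3 := by rw [pow_succ, Real.sq_sqrt hG.le]
  have : EE G ρ = (G/ρ^2 + 6 * (√ρ/ρ^2)) * (1/ρ^3) := by unfold EE; field_simp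
  rw [this, e, e2]
  have hp : 0 < n^(1/2:ℝ) := by positivity
  calc _ ≤ (20/3/n + 6 * (6.71/n)) * (1/(38/100 * (√G * n^(1/2:ℝ)))^3) := by gcongr
    _ ≤ (47/n) * (1/(38/100 * (√G * n^(1/2:ℝ)))^3) := by
        gcongr
        rw [← mul_div_assoc, ← add_div]; gcongr; norm_num
    _ = 47 * (100/38)^3 * (1/ ((√G)^3 * (n * (n^(1/2:ℝ))^3))) := by field_simp
    _ ≤ 1000 * (1/ ((√G)^3 * (n * (n^(1/2:ℝ))^3))) := by gcongr; norm_num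
    _ = _ := by field_simp

lemma tail_int {a τ : ℝ} (ha : a < -1) (hτ : 0 ≤ τ) :
    IntegrableOn (fun σ : ℝ => (1+σ)^a) (Ioi τ) ∧ ∫ σ in Ioi τ, (1+σ)^a = -(1+τ)^(a+1)/(a+1) := by
  have h1 : IntegrableOn (fun σ : ℝ => (1+σ)^a) (Ioi τ) := by
    simpa [add_comm] using integrableOn_add_rpow_Ioi_of_lt (m := 1) ha (by linarith : -1 < τ)
  refine ⟨h1, ?_⟩
  have := integral_Ioi_of_hasDerivAt_of_tendsto (f := fun σ : ℝ => (1+σ)^(a+1)/(a+1)) (f' := fun σ : ℝ => (1+σ)^a) (a := τ) (m := 0) ?_ ?_ h1 ?_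
  · rw [this]; ring
  · apply ContinuousAt.continuousWithinAt
    apply ContinuousAt.div_const
    exact ContinuousAt.rpow_const (by fun_prop) (Or.inl §)
  · intro x hx
    have hx' : τ < x := hx
    have := ((((hasDerivAt_id x).const_add 1).rpow_const (p := a+1) (Or.inl (by simp only [id]; linarith))).div_const (a+1))
    refine HasDerivAt.congr_deriv this ?_
    have : a + 1 ≠ 0 := by linarith
    simp; field_simp
  · have h2 : Tendsto (fun σ : ℝ => (1+σ)^(-(-(a+1)))) atTop (nhds 0) :=
      (tendsto_rpow_neg_atTop §).comp (tendsto_atTop_add_const_left _ _ tendsto_id)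
    simpa using h2.div_const (a+1)

lemma tail13 {τ : ℝ} (hτ : 0 ≤ τ) : ∫ σ in Ioi τ, (1+σ)^(-(13:ℝ)/6) ≤ (1+τ)^κ₇ := by
  rw [(tail_int £ hτ).2]
  norm_num
  have := w_pos hτ (-(7/6))
  linarith

lemma tail7 : ∫ σ in Ioi (0:ℝ), (1+σ)^κ₇ = 6 := by
  rw [(tail_int £ le_rfl).2]; norm_num

lemma tail5 : ∫ σ in Ioi (0:ℝ), (1+σ)^(-(5:ℝ)/2) ≤ 1 := by
  rw [(tail_int £ le_rfl).2]; norm_num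

section
variable {G : ℝ} (hG : 2000 ≤ G) {v : ℂ} (hv : v ∈ VV G) {τ : ℝ} (hτ : 0 ≤ τ)
include hG hv hτ
lemma bd3 : 1/‖rG G (v+τ)‖^2 ≤ 10/√G * (1+τ)^κ₇ :=
  num3 § § (base_pos hG hv hτ) (base_lb hG hv hτ).1 (base_lb hG hv hτ).2
lemma bd5 : EE G ‖rG G (v+τ)‖ * ‖rG G (v+τ)‖ ≤ 470/√G * (1+τ)^(-(13:ℝ)/6) :=
  num5 § § (base_pos hG hv hτ) (base_lb hG hv hτ).1 (base_lb hG hv hτ).2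
lemma bd6 : EE G ‖rG G (v+τ)‖ ≤ 1000/(G*√G) * (1+τ)^(-(5:ℝ)/2) :=
  num6 § § (base_pos hG hv hτ) (base_lb hG hv hτ).1 (base_lb hG hv hτ).2
end

open Real Filter Set MeasureTheory
set_option linter.unusedSectionVars false

def xx (v : ℂ) (b k : ℝ → ℂ) (σ : ℝ) : ℂ × ℂ := (v + σ + b σ, k σ)
def Tb (G ξ : ℝ) (v : ℂ) (b k : ℝ → ℂ) (τ : ℝ) : ℂ :=
  ∫ σ in Ioc 0 τ, BB G (qq (ξ + σ)) (xx v b k σ)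
def Tk (G ξ : ℝ) (v : ℂ) (b k : ℝ → ℂ) (τ : ℝ) : ℂ :=
  if 0 ≤ τ then -(rr G (xx v b k τ)) * ∫ σ in Ioi τ, Phi G (qq (ξ + σ)) (xx v b k σ) else 0

structure Adm (b k : ℝ → ℂ) : Prop where
  mb : Measurable b
  mkk : Measurable k
  hb : ∀ τ, 0 ≤ τ → ‖b τ‖ ≤ 1/2
  hk : ∀ τ, 0 ≤ τ → ‖k τ‖ ≤ 1/100 * (1+τ)^κ₇

lemma w_le {τ : ℝ} (hτ : 0 ≤ τ) : (1+τ)^κ₇ ≤ 1 :=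
  Real.rpow_le_one_of_one_le_of_nonpos § £

lemma qq_mem (t : ℝ) : qq t ∈ Icc (0:ℝ) 1 := ⟨qq_nonneg t, qq_le t⟩

lemma Adm.mem {b k : ℝ → ℂ} (h : Adm b k) (v : ℂ) {τ : ℝ} (hτ : 0 ≤ τ) : xx v b k τ ∈ DD' (v + τ) := by
  have h1 := h.hb τ hτ
  have h2 := h.hk τ hτ
  have := w_le hτ
  constructor
  · simpa [xx] using h1
  · simp only [xx]; linarith

lemma DD_sub {W : ℂ} {x : ℂ × ℂ} (h : x ∈ DD' W) : x ∈ DD W := ⟨by linarith [h.1], by linarith [h.2]⟩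

lemma xx_meas {b k : ℝ → ℂ} (h : Adm b k) (v : ℂ) : Measurable (xx v b k) := by
  have := h.mb
  have := h.mkk
  unfold xx
  fun_prop

lemma rr_meas (G : ℝ) : Measurable (rr G) := by
  have := rG_meas G
  unfold rr
  fun_prop

lemma ff_meas (G ξ : ℝ) : Measurable (fun p : ℝ × ℂ × ℂ => ff G (qq (ξ + p.1)) p.2) := by
  have := rr_meas G
  have := qq_cont.measurable
  unfold ff fh
  fun_prop

lemma ff_meas' {b k : ℝ → ℂ} (h : Adm b k) (G ξ : ℝ) (v : ℂ) :
    Measurable (fun σ => ff G (qq (ξ + σ)) (xx v b k σ)) := by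
  have h1 := xx_meas h v
  have h2 : Measurable (fun σ : ℝ => (σ, xx v b k σ)) := measurable_id.prodMk h1
  have h3 := (ff_meas G ξ).comp h2
  simpa only [Function.comp_def] using h3

lemma Phi_meas {G ξ : ℝ} {v : ℂ} {b k : ℝ → ℂ} (h : Adm b k) :
    Measurable (fun σ => Phi G (qq (ξ + σ)) (xx v b k σ)) := by
  have h1 := xx_meas h v
  have h2 := ff_meas' h G ξ v
  have h3 : Measurable (fun σ => rr G (xx v b k σ)) := (rr_meas G).comp h1
  have h4 : Measurable (fun σ => pG G (xx v b k σ).1) := (pG_meas G).comp (measurable_fst.comp h1)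
  unfold Phi
  fun_prop

lemma BB_meas {G ξ : ℝ} {v : ℂ} {b k : ℝ → ℂ} (h : Adm b k) :
    Measurable (fun σ => BB G (qq (ξ + σ)) (xx v b k σ)) := by
  have h1 := xx_meas h v
  have h2 := ff_meas' h G ξ v
  have h3 : Measurable (fun σ => (xx v b k σ).2) := measurable_snd.comp h1
  unfold BB
  fun_prop

lemma meas_head {f : ℝ → ℂ} (hf : Measurable f) : Measurable (fun τ : ℝ => ∫ σ in Ioc 0 τ, f σ) := by
  have h1 : MeasurableSet {p : ℝ × ℝ | 0 < p.2 ∧ p.2 ≤ p.1} :=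
    (measurableSet_lt measurable_const measurable_snd).inter (measurableSet_le measurable_snd measurable_fst)
  have h2 : Measurable (fun p : ℝ × ℝ => ({p : ℝ × ℝ | 0 < p.2 ∧ p.2 ≤ p.1}).indicator (fun p => f p.2) p) :=
    (hf.comp measurable_snd).indicator h1
  have h3 := (h2.stronglyMeasurable.integral_prod_right' (ν := volume)).measurable
  convert h3 using 2 with τ
  rw [← integral_indicator measurableSet_Ioc]
  rfl

lemma meas_tail {f : ℝ → ℂ} (hf : Measurable f) : Measurable (fun τ : ℝ => ∫ σ in Ioi τ, f σ) := by
  have h1 : MeasurableSet {p : ℝ × ℝ | p.1 < p.2} := measurableSet_lt measurable_fst measurable_snd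
  have h2 : Measurable (fun p : ℝ × ℝ => ({p : ℝ × ℝ | p.1 < p.2}).indicator (fun p => f p.2) p) :=
    (hf.comp measurable_snd).indicator h1
  have h3 := (h2.stronglyMeasurable.integral_prod_right' (ν := volume)).measurable
  convert h3 using 2 with τ
  rw [← integral_indicator measurableSet_Ioi]
  rfl

lemma Tb_meas {G ξ : ℝ} {v : ℂ} {b k : ℝ → ℂ} (h : Adm b k) : Measurable (Tb G ξ v b k) :=
  meas_head (BB_meas h)

lemma Tk_meas {G ξ : ℝ} {v : ℂ} {b k : ℝ → ℂ} (h : Adm b k) : Measurable (Tk G ξ v b k) :=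
  Measurable.ite measurableSet_Ici (((rr_meas G).comp (xx_meas h v)).neg.mul (meas_tail (Phi_meas h))) measurable_const

lemma sqrtG {G : ℝ} (hG : Γ₀ ≤ G) : (10:ℝ)^20 ≤ √G := by
  apply Real.le_sqrt_of_sq_le; norm_num at *; linarith

lemma head_est {f : ℝ → ℂ} {c : ℝ} (τ : ℝ) (hc : 0 ≤ c) (hf : ∀ σ, 0 ≤ σ → ‖f σ‖ ≤ c * (1+σ)^κ₇) :
    ‖∫ σ in Ioc 0 τ, f σ‖ ≤ 6 * c := by
  have hi := (tail_int (a := -(7:ℝ)/6) £ le_rfl).1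
  have h1 : ‖∫ σ in Ioc 0 τ, f σ‖ ≤ ∫ σ in Ioc 0 τ, c * (1+σ)^κ₇ := by
    apply norm_integral_le_of_norm_le
    · exact (hi.mono_set Ioc_subset_Ioi_self).const_mul c
    · filter_upwards [ae_restrict_mem measurableSet_Ioc] with σ hσ
      exact hf σ hσ.1.le
  refine h1.trans ?_
  have h2 : ∫ σ in Ioc 0 τ, c * (1+σ)^κ₇ ≤ ∫ σ in Ioi 0, c * (1+σ)^κ₇ := by
    apply setIntegral_mono_set (hi.const_mul c)
    · filter_upwards [ae_restrict_mem measurableSet_Ioi] with σ hσ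
      exact mul_nonneg hc (w_pos (le_of_lt hσ) _).le
    · exact (Ioc_subset_Ioi_self).eventuallyLE
  have h3 : ∫ σ in Ioi (0:ℝ), c * (1+σ)^κ₇ = c * 6 := by rw [integral_const_mul, tail7]
  linarith

section
variable {G : ℝ} (hG : 2000 ≤ G) {v : ℂ} (hv : v ∈ VV G) {τ : ℝ} (hτ : 0 ≤ τ)
include hG hv hτ

lemma tail_est {f : ℝ → ℂ} {c : ℝ} (hc : 0 ≤ c) (hf : ∀ σ, 0 ≤ σ → ‖f σ‖ ≤ c * EE G ‖rG G (v+σ)‖) :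
    ‖rG G (v+τ)‖ * ‖∫ σ in Ioi τ, f σ‖ ≤ c * 4230/√G * (1+τ)^κ₇ := by
  have hi := (tail_int (a := -(13:ℝ)/6) £ hτ).1
  have h1 : ‖∫ σ in Ioi τ, (‖rG G (v+τ)‖:ℂ) * f σ‖ ≤ ∫ σ in Ioi τ, c * 4230/√G * (1+σ)^(-(13:ℝ)/6) := by
    apply norm_integral_le_of_norm_le
    · exact hi.const_mul _
    · filter_upwards [ae_restrict_mem measurableSet_Ioi] with σ hσ
      have hσ' : τ < σ := hσ
      have hσ0 : 0 ≤ σ := by linarith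
      rw [norm_mul, Complex.norm_real, norm_norm]
      have h2 := base_cmp hG hv hτ hσ'.le
      have h3 := bd5 hG hv hσ0
      have h4 := base_pos hG hv hσ0
      have h5 : 0 ≤ EE G ‖rG G (v+σ)‖ := by
        unfold EE
        have : 0 ≤ G := by linarith
        positivity
      calc _ ≤ (9 * ‖rG G (v+σ)‖) * (c * EE G ‖rG G (v+σ)‖) := by gcongr; exact hf σ hσ0
        _ = 9 * c * (EE G ‖rG G (v+σ)‖ * ‖rG G (v+σ)‖) := by ring
        _ ≤ 9 * c * (470/√G * (1+σ)^(-(13:ℝ)/6)) := by gcongr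
        _ = _ := by ring
  rw [integral_const_mul, integral_const_mul, norm_mul, Complex.norm_real, norm_norm] at h1
  refine h1.trans ?_
  have := tail13 hτ
  have : 0 ≤ c * 4230/√G := by positivity
  gcongr

omit hτ in
lemma Phi_int {ξ : ℝ} {b k : ℝ → ℂ} (h : Adm b k) :
    IntegrableOn (fun σ => Phi G (qq (ξ + σ)) (xx v b k σ)) (Ioi 0) := by
  have hi := (tail_int (a := -(5:ℝ)/2) £ le_rfl).1
  refine Integrable.mono' (hi.const_mul (800000 * (1000/(G*√G)))) (Phi_meas h).aestronglyMeasurable ?_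
  filter_upwards [ae_restrict_mem measurableSet_Ioi] with σ hσ
  have hσ0 : 0 ≤ σ := le_of_lt hσ
  refine (D_Phi hG hv hσ0 (DD_sub (h.mem v hσ0)) (qq_mem _)).trans ?_
  rw [mul_assoc]
  exact mul_le_mul_of_nonneg_left (bd6 hG hv hσ0) £

lemma Tk_bd {ξ : ℝ} {b k : ℝ → ℂ} (h : Adm b k) :
    ‖Tk G ξ v b k τ‖ ≤ 40000000000/√G * (1+τ)^κ₇ := by
  have h1 := tail_est hG hv hτ (f := fun σ => Phi G (qq (ξ + σ)) (xx v b k σ)) (c := 800000) £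
    (fun σ hσ => D_Phi hG hv hσ (DD_sub (h.mem v hσ)) (qq_mem _))
  have h2 := (D_rr hG hv hτ (DD_sub (h.mem v hτ))).1
  unfold Tk
  rw [if_pos hτ, norm_mul, norm_neg]
  set I := ‖∫ σ in Ioi τ, Phi G (qq (ξ + σ)) (xx v b k σ)‖
  have hI : 0 ≤ I := norm_nonneg _
  have hw := w_pos hτ κ₇
  calc _ ≤ 10 * ‖rG G (v+τ)‖ * I := by gcongr
    _ = 10 * (‖rG G (v+τ)‖ * I) := by ring
    _ ≤ 10 * (800000 * 4230/√G * (1+τ)^κ₇) := by gcongr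
    _ = (33840000000/√G * (1+τ)^κ₇) := by ring
    _ ≤ _ := by gcongr; norm_num

lemma Tk_lip {ξ : ℝ} {b₁ k₁ b₂ k₂ : ℝ → ℂ} (h₁ : Adm b₁ k₁) (h₂ : Adm b₂ k₂) {e : ℝ} (he : 0 ≤ e)
    (hxx : ∀ σ, 0 ≤ σ → ‖xx v b₁ k₁ σ - xx v b₂ k₂ σ‖ ≤ e) :
    ‖Tk G ξ v b₁ k₁ τ - Tk G ξ v b₂ k₂ τ‖ ≤ 3200000000000/√G * e * (1+τ)^κ₇ := by
  have a1 := tail_est hG hv hτ (f := fun σ => Phi G (qq (ξ + σ)) (xx v b₁ k₁ σ)) (c := 800000) £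
    (fun σ hσ => D_Phi hG hv hσ (DD_sub (h₁.mem v hσ)) (qq_mem _))
  have a2 := tail_est hG hv hτ (f := fun σ => Phi G (qq (ξ + σ)) (xx v b₁ k₁ σ) - Phi G (qq (ξ + σ)) (xx v b₂ k₂ σ))
    (c := 32000000 * e) ¶
    (fun σ hσ => by
      have := lip_gen (Ψ := Phi G (qq (ξ+σ))) (fun x hx => d_Phi hG hv hσ hx (qq_mem _))
        (fun x hx => D_Phi hG hv hσ hx (qq_mem _)) (h₁.mem v hσ) (h₂.mem v hσ)
      refine this.trans ?_
      have h5 : 0 ≤ EE G ‖rG G (v+σ)‖ := by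
        unfold EE
        have : 0 ≤ G := by linarith
        positivity
      have := hxx σ hσ
      calc _ ≤ 40 * (800000 * EE G ‖rG G (v+σ)‖) * e := by gcongr
        _ = _ := by ring)
  have a3 := lip_gen (Ψ := rr G) (fun x hx => d_rr hG hv hτ hx)
        (fun x hx => (D_rr hG hv hτ hx).1) (h₁.mem v hτ) (h₂.mem v hτ)
  have a4 := (D_rr hG hv hτ (DD_sub (h₂.mem v hτ))).1
  have i1 := (Phi_int hG hv (ξ := ξ) h₁).mono_set (Ioi_subset_Ioi hτ)
  have i2 := (Phi_int hG hv (ξ := ξ) h₂).mono_set (Ioi_subset_Ioi hτ)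
  rw [integral_sub i1 i2] at a2
  unfold Tk
  rw [if_pos hτ, if_pos hτ]
  set I1 := ∫ σ in Ioi τ, Phi G (qq (ξ + σ)) (xx v b₁ k₁ σ)
  set I2 := ∫ σ in Ioi τ, Phi G (qq (ξ + σ)) (xx v b₂ k₂ σ)
  set r1 := rr G (xx v b₁ k₁ τ)
  set r2 := rr G (xx v b₂ k₂ τ)
  have e1 : -r1 * I1 - -r2 * I2 = -((r1 - r2) * I1 + r2 * (I1 - I2)) := by ring
  rw [e1, norm_neg]
  refine (norm_add_le _ _).trans ?_
  rw [norm_mul, norm_mul]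
  have hw := w_pos hτ κ₇
  have hx0 := hxx τ hτ
  set ρ := ‖rG G (v+τ)‖
  have c1 : ‖r1 - r2‖ * ‖I1‖ ≤ 400 * e * (800000 * 4230/√G * (1+τ)^κ₇) := by
    calc _ ≤ (40 * (10 * ρ) * e) * ‖I1‖ := by
            gcongr
            exact a3.trans (by gcongr)
      _ = 400 * e * (ρ * ‖I1‖) := by ring
      _ ≤ _ := by gcongr
  have c2 : ‖r2‖ * ‖I1 - I2‖ ≤ 10 * (32000000 * e * 4230/√G * (1+τ)^κ₇) := by
    calc _ ≤ (10 * ρ) * ‖I1 - I2‖ := by gcongr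
      _ = 10 * (ρ * ‖I1 - I2‖) := by ring
      _ ≤ _ := by gcongr
  refine (add_le_add c1 c2).trans ?_
  have e2 : 400 * e * (800000 * 4230/√G * (1+τ)^κ₇) + 10 * (32000000 * e * 4230/√G * (1+τ)^κ₇)
     = 2707200000000/√G * e * (1+τ)^κ₇ := by ring
  rw [e2]; gcongr; norm_num

lemma ff_w {ξ : ℝ} {b k : ℝ → ℂ} (h : Adm b k) :
    ‖ff G (qq (ξ + τ)) (xx v b k τ)‖ ≤ 8000/√G * (1+τ)^κ₇ := by
  refine (D_ff hG hv hτ (DD_sub (h.mem v hτ)) (qq_mem _)).trans ?_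
  have := bd3 hG hv hτ
  calc _ = 800 * (1/‖rG G (v+τ)‖^2) := by ring
    _ ≤ 800 * (10/√G * (1+τ)^κ₇) := by gcongr
    _ = _ := by ring

omit hτ in
lemma Tb_bd (τ : ℝ) {ξ : ℝ} {b k : ℝ → ℂ} (h : Adm b k) {κ : ℝ} (hκ0 : 0 ≤ κ) (hκ1 : κ ≤ 1/100)
    (hκ : ∀ σ, 0 ≤ σ → ‖k σ‖ ≤ κ * (1+σ)^κ₇) :
    ‖Tb G ξ v b k τ‖ ≤ 6 * (4 * κ + 8080/√G) := by
  apply head_est τ ¶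
  intro σ hσ
  have h1 := hκ σ hσ
  have h2 := ff_w hG hv hσ (ξ := ξ) h
  have hw := w_le hσ
  have hw0 := w_pos hσ κ₇
  set w := (1+σ)^κ₇
  have h3 : ‖k σ‖ ≤ 1/100 := by nlinarith
  unfold BB
  simp only [xx] at h2 ⊢
  set f := ff G (qq (ξ + σ)) (v + σ + b σ, k σ)
  calc _ ≤ ‖3 * k σ‖ + ‖f‖ + ‖2 * k σ^2‖ + ‖k σ * f‖ := norm_add₄_le
    _ = 3 * ‖k σ‖ + ‖f‖ + 2 * (‖k σ‖ * ‖k σ‖) + ‖k σ‖ * ‖f‖ := by simp [pow_two]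
    _ ≤ 3 * (κ * w) + 8000/√G * w + 2 * (1/100 * (κ * w)) + 1/100 * (8000/√G * w) := by gcongr
    _ = (3.02 * κ + 8080/√G) * w := by ring
    _ ≤ _ := by gcongr; norm_num

omit hτ in
lemma BB_int {ξ : ℝ} {b k : ℝ → ℂ} (h : Adm b k) (τ : ℝ) :
    IntegrableOn (fun σ => BB G (qq (ξ + σ)) (xx v b k σ)) (Ioc 0 τ) := by
  refine Measure.integrableOn_of_bounded (M := 1 + 8080/√G) (by simp) (BB_meas h).aestronglyMeasurable ?_
  filter_upwards [ae_restrict_mem measurableSet_Ioc] with σ hσ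
  have hσ := hσ.1.le
  have h1 := h.hk σ hσ
  have h2 := ff_w hG hv hσ (ξ := ξ) h
  have hw := w_le hσ
  have hw0 := w_pos hσ κ₇
  set w := (1+σ)^κ₇
  have h3 : ‖k σ‖ ≤ 1/100 := by nlinarith
  have h4 : 8000/√G * w ≤ 8000/√G := mul_le_of_le_one_right ¶ hw
  have h5 := h2.trans h4
  unfold BB
  simp only [xx] at h5 ⊢
  set f := ff G (qq (ξ + σ)) (v + σ + b σ, k σ)
  calc _ ≤ ‖3 * k σ‖ + ‖f‖ + ‖2 * k σ^2‖ + ‖k σ * f‖ := norm_add₄_le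
    _ = 3 * ‖k σ‖ + ‖f‖ + 2 * (‖k σ‖ * ‖k σ‖) + ‖k σ‖ * ‖f‖ := by simp [pow_two]
    _ ≤ 3 * (1/100) + 8000/√G + 2 * (1/100 * (1/100)) + 1/100 * (8000/√G) := by gcongr
    _ ≤ _ := by ring_nf; gcongr; norm_num

omit hτ in
lemma Tb_lip (τ : ℝ) (hG' : 800000 ≤ √G) {ξ : ℝ} {b₁ k₁ b₂ k₂ : ℝ → ℂ} (h₁ : Adm b₁ k₁) (h₂ : Adm b₂ k₂) {e η : ℝ} (he : 0 ≤ e)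
    (hη : 0 ≤ η)
    (hxx : ∀ σ, 0 ≤ σ → ‖xx v b₁ k₁ σ - xx v b₂ k₂ σ‖ ≤ e)
    (hk : ∀ σ, 0 ≤ σ → ‖k₁ σ - k₂ σ‖ ≤ η * (1+σ)^κ₇) :
    ‖Tb G ξ v b₁ k₁ τ - Tb G ξ v b₂ k₂ τ‖ ≤ 6 * (3.05 * η + 330000/√G * e) := by
  unfold Tb
  rw [← integral_sub (BB_int hG hv h₁ τ) (BB_int hG hv h₂ τ)]
  apply head_est τ ¶
  intro σ hσ
  have l1 := lip_gen (Ψ := ff G (qq (ξ+σ))) (fun x hx => d_ff hG hv hσ hx (qq_mem _))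
        (fun x hx => D_ff hG hv hσ hx (qq_mem _)) (h₁.mem v hσ) (h₂.mem v hσ)
  have hw := w_le hσ
  have hw0 := w_pos hσ κ₇
  have f2 := ff_w hG hv hσ (ξ := ξ) h₂
  have hx0 := hxx σ hσ
  have b3 := bd3 hG hv hσ
  have k1 := h₁.hk σ hσ
  have k2 := h₂.hk σ hσ
  have dk := hk σ hσ
  set w := (1+σ)^κ₇
  have l2 : ‖ff G (qq (ξ+σ)) (xx v b₁ k₁ σ) - ff G (qq (ξ+σ)) (xx v b₂ k₂ σ)‖ ≤ 320000/√G * e * w := by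
    refine l1.trans ?_
    calc _ = 32000 * (1/‖rG G (v+σ)‖^2) * ‖xx v b₁ k₁ σ - xx v b₂ k₂ σ‖ := by ring
      _ ≤ 32000 * (10/√G * w) * e := by gcongr
      _ = _ := by ring
  have hf : 8000/√G * w ≤ 1/100 := by
    have : 8000/√G ≤ 1/100 := by rw [div_le_div_iff₀ § £]; linarith
    nlinarith
  unfold BB
  simp only [xx] at l2 f2 ⊢
  set f₁ := ff G (qq (ξ + σ)) (v + σ + b₁ σ, k₁ σ)
  set f₂ := ff G (qq (ξ + σ)) (v + σ + b₂ σ, k₂ σ)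
  have k1' : ‖k₁ σ‖ ≤ 1/100 := by nlinarith
  have k2' : ‖k₂ σ‖ ≤ 1/100 := by nlinarith
  have f2' : ‖f₂‖ ≤ 1/100 := f2.trans hf
  have e1 : 3 * k₁ σ + f₁ + 2 * k₁ σ ^2 + k₁ σ * f₁ - (3 * k₂ σ + f₂ + 2 * k₂ σ ^2 + k₂ σ * f₂)
    = (3 + 2 * (k₁ σ + k₂ σ) + f₂) * (k₁ σ - k₂ σ) + (1 + k₁ σ) * (f₁ - f₂) := by ring
  rw [e1]
  have n1 : ‖3 + 2 * (k₁ σ + k₂ σ) + f₂‖ ≤ 3.05 := by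
    have := norm_add₃_le (a := (3:ℂ)) (b := 2 * (k₁ σ + k₂ σ)) (c := f₂)
    have h5 := norm_add_le (k₁ σ) (k₂ σ)
    simp only [norm_mul, Complex.norm_ofNat] at this
    norm_num at *; linarith
  have n2 := (one_add_bd (k := k₁ σ) §).2
  have n3 : ‖1 + k₁ σ‖ ≤ 1.01 := by
    have := norm_add_le 1 (k₁ σ)
    rw [norm_one] at this; norm_num at *; linarith
  calc _ ≤ ‖3 + 2 * (k₁ σ + k₂ σ) + f₂‖ * ‖k₁ σ - k₂ σ‖ + ‖1 + k₁ σ‖ * ‖f₁ - f₂‖ := by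
        rw [← norm_mul, ← norm_mul]; exact norm_add_le _ _
    _ ≤ 3.05 * (η * w) + 1.01 * (320000/√G * e * w) := by gcongr
    _ = (3.05 * η + 323200/√G * e) * w := by ring
    _ ≤ _ := by gcongr; norm_num
end

open Real Filter Set MeasureTheory Topology

lemma holo_int {f : ℂ → ℝ → ℂ} {U : Set ℂ} (hU : IsOpen U) {S : Set ℝ} (hS : MeasurableSet S) {bound : ℝ → ℝ}
    (hm : ∀ v ∈ U, Measurable (f v)) (hb : ∀ v ∈ U, ∀ σ ∈ S, ‖f v σ‖ ≤ bound σ)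
    (hbi : IntegrableOn bound S) (hd : ∀ σ ∈ S, DifferentiableOn ℂ (fun v => f v σ) U) :
    DifferentiableOn ℂ (fun v => ∫ σ in S, f v σ) U := by
  intro v0 hv0
  obtain ⟨ε, hε, hball⟩ := Metric.isOpen_iff.1 hU v0 hv0
  have hda : ∀ σ ∈ S, ∀ x ∈ U, HasDerivAt (fun v => f v σ) (deriv (fun v => f v σ) x) x :=
    fun σ hσ x hx => ((hd σ hσ).differentiableAt (hU.mem_nhds hx)).hasDerivAt
  have key := hasDerivAt_integral_of_dominated_loc_of_deriv_le (μ := volume.restrict S) (F := f)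
    (F' := fun x σ => deriv (fun v => f v σ) x) (x₀ := v0) (s := Metric.ball v0 (ε/4))
    (bound := fun σ => bound σ / (ε/4)) (Metric.ball_mem_nhds _ §)
    (by filter_upwards [hU.mem_nhds hv0] with x hx using (hm x hx).aestronglyMeasurable)
    (Integrable.mono' hbi (hm v0 hv0).aestronglyMeasurable
      (by filter_upwards [ae_restrict_mem hS] with σ hσ using hb v0 hv0 σ hσ))
    (by
      have hx : ∀ n : ℕ, v0 + ((ε/2/((n:ℝ)+1):ℝ):ℂ) ∈ U := by
        intro n
        apply hball
        rw [Metric.mem_ball, dist_self_add_left, Complex.norm_real, Real.norm_eq_abs, abs_of_pos ¶]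
        have : ε/2/((n:ℝ)+1) ≤ ε/2 := div_le_self § (by linarith [(Nat.cast_nonneg n : (0:ℝ) ≤ n)])
        linarith
      have ht : Tendsto (fun n : ℕ => ((ε/2/((n:ℝ)+1):ℝ):ℂ)) atTop (𝓝[≠] 0) := by
        apply tendsto_nhdsWithin_of_tendsto_nhds_of_eventually_within
        · have := (tendsto_one_div_add_atTop_nhds_zero_nat (𝕜 := ℝ)).const_mul (ε/2)
          rw [mul_zero] at this
          rw [← Complex.ofReal_zero]
          refine (Complex.continuous_ofReal.tendsto 0).comp (this.congr ?_)
          intro n; ring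
        · filter_upwards with n
          simp only [mem_compl_iff, mem_singleton_iff, Complex.ofReal_eq_zero]
          positivity
      refine aestronglyMeasurable_of_tendsto_ae atTop
        (f := fun (n:ℕ) σ => ((ε/2/((n:ℝ)+1):ℝ):ℂ)⁻¹ • (f (v0 + ((ε/2/((n:ℝ)+1):ℝ):ℂ)) σ - f v0 σ)) ?_ ?_
      · intro n
        exact (Measurable.const_smul (M := ℂ) ((hm _ (hx n)).sub (hm _ hv0)) _).aestronglyMeasurable
      · filter_upwards [ae_restrict_mem hS] with σ hσ
        exact ((hda σ hσ v0 hv0).tendsto_slope_zero).comp ht)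
    (by
      filter_upwards [ae_restrict_mem hS] with σ hσ x hx
      have hsub : Metric.closedBall x (ε/4) ⊆ U := by
        intro y hy
        apply hball
        rw [Metric.mem_ball] at hx ⊢
        rw [Metric.mem_closedBall] at hy
        linarith [dist_triangle y x v0]
      apply Complex.norm_deriv_le_of_forall_mem_sphere_norm_le §
      · apply DifferentiableOn.diffContOnCl
        exact ((hd σ hσ).mono hsub).mono Metric.closure_ball_subset_closedBall
      · intro z hz
        exact hb z (hsub (Metric.sphere_subset_closedBall hz)) σ hσ)
    (hbi.div_const _)
    (by
      filter_upwards [ae_restrict_mem hS] with σ hσ x hx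
      exact hda σ hσ x (hball (Metric.ball_subset_ball § hx)))
  exact key.2.differentiableAt.differentiableWithinAt

def PI (G ξ : ℝ) (v : ℂ) : ℕ → (ℝ → ℂ) × (ℝ → ℂ)
  | 0 => (fun _ => 0, fun _ => 0)
  | n+1 => (Tb G ξ v (PI G ξ v n).1 (PI G ξ v n).2, Tk G ξ v (PI G ξ v n).1 (PI G ξ v n).2)

def bS (G ξ : ℝ) (v : ℂ) (τ : ℝ) : ℂ := limUnder atTop (fun n => (PI G ξ v n).1 τ)
def kS (G ξ : ℝ) (v : ℂ) (τ : ℝ) : ℂ := limUnder atTop (fun n => (PI G ξ v n).2 τ)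
def ES (G ξ : ℝ) (v : ℂ) : ℂ := -∫ σ in Ioi 0, Phi G (qq (ξ + σ)) (xx v (bS G ξ v) (kS G ξ v) σ)

def Cl (η : ℝ) (b₁ k₁ b₂ k₂ : ℝ → ℂ) : Prop :=
  ∀ τ, 0 ≤ τ → ‖b₁ τ - b₂ τ‖ ≤ 100 * η ∧ ‖k₁ τ - k₂ τ‖ ≤ η * (1+τ)^κ₇

lemma Tb_neg {G ξ : ℝ} {v : ℂ} {b k : ℝ → ℂ} {τ : ℝ} (hτ : τ ≤ 0) : Tb G ξ v b k τ = 0 := by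
  unfold Tb; rw [Ioc_eq_empty §]; simp
lemma Tk_neg {G ξ : ℝ} {v : ℂ} {b k : ℝ → ℂ} {τ : ℝ} (hτ : τ < 0) : Tk G ξ v b k τ = 0 := by
  unfold Tk; rw [if_neg §]

lemma Adm0 : Adm (fun _ => 0) (fun _ => 0) :=
  ⟨measurable_const, measurable_const, fun τ _ => by simp,
    fun τ hτ => by have := w_pos hτ κ₇; rw [norm_zero]; positivity⟩

section
variable {G : ℝ} (hG : Γ₀ ≤ G) {v : ℂ} (hv : v ∈ VV G) {ξ : ℝ}
include hG

lemma G2000 : 2000 ≤ G := by norm_num at hG; linarith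

lemma sqd {c d : ℝ} (hd : 0 ≤ d) (h : c ≤ d * 10^20) : c / √G ≤ d := by
  have := sqrtG hG
  rw [div_le_iff₀ (by linarith [show (0:ℝ) < 10^20 by norm_num])]
  exact h.trans (by gcongr)

include hv
lemma T_adm {b k : ℝ → ℂ} (h : Adm b k) : Adm (Tb G ξ v b k) (Tk G ξ v b k) := by
  refine ⟨Tb_meas h, Tk_meas h, ?_, ?_⟩
  · intro τ hτ
    have := Tb_bd (G2000 hG) hv τ (ξ := ξ) h £ le_rfl h.hk
    have h2 := sqd hG (c := 8080) (d := 1/100) £ £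
    linarith
  · intro τ hτ
    have := Tk_bd (G2000 hG) hv hτ (ξ := ξ) h
    have h2 := sqd hG (c := 40000000000) (d := 1/100) £ £
    have := w_pos hτ κ₇
    refine (Tk_bd (G2000 hG) hv hτ (ξ := ξ) h).trans ?_
    gcongr

lemma contr {b₁ k₁ b₂ k₂ : ℝ → ℂ} (h₁ : Adm b₁ k₁) (h₂ : Adm b₂ k₂) {η : ℝ} (hη : 0 ≤ η)
    (h : Cl η b₁ k₁ b₂ k₂) :
    Cl (η/2) (Tb G ξ v b₁ k₁) (Tk G ξ v b₁ k₁) (Tb G ξ v b₂ k₂) (Tk G ξ v b₂ k₂) := by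
  have hxx : ∀ σ, 0 ≤ σ → ‖xx v b₁ k₁ σ - xx v b₂ k₂ σ‖ ≤ 100 * η := by
    intro σ hσ
    obtain ⟨h3, h4⟩ := h σ hσ
    rw [Prod.norm_def]
    apply max_le
    · simpa [xx] using h3
    · refine h4.trans ?_
      have := w_le hσ
      nlinarith
  have hs := sqrtG hG
  intro τ hτ
  constructor
  · have := Tb_lip (G2000 hG) hv τ (by norm_num at hs; linarith) (ξ := ξ) h₁ h₂ ¶ hη hxx (fun σ hσ => (h σ hσ).2)
    have h2 := sqd hG (c := 330000) (d := 1/100) £ £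
    have h3 : 330000/√G * (100 * η) ≤ 1/100 * (100 * η) := by gcongr
    linarith
  · have := Tk_lip (G2000 hG) hv hτ (ξ := ξ) h₁ h₂ ¶ hxx
    have h2 := sqd hG (c := 3200000000000) (d := 1/1000) £ £
    have hw := w_pos hτ κ₇
    refine this.trans ?_
    have h3 : 3200000000000/√G * (100 * η) ≤ 1/1000 * (100 * η) := by gcongr
    gcongr
    linarith

lemma PI_adm (n : ℕ) : Adm (PI G ξ v n).1 (PI G ξ v n).2 := by
  induction n with
  | zero => exact Adm0
  | succ n ih => exact T_adm hG hv ih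

lemma PI_cl (n : ℕ) : Cl (1/2^n) (PI G ξ v n).1 (PI G ξ v n).2 (PI G ξ v (n+1)).1 (PI G ξ v (n+1)).2 := by
  induction n with
  | zero =>
    intro τ hτ
    have h := PI_adm hG hv (ξ := ξ) 1
    have h1 := h.hb τ hτ
    have h2 := h.hk τ hτ
    have hw := w_pos hτ κ₇
    simp only [zero_add]
    constructor
    · simp only [PI, zero_sub, norm_neg] at h1 ⊢; linarith
    · simp only [PI, zero_sub, norm_neg] at h2 ⊢; refine h2.trans ?_; gcongr; norm_num
  | succ n ih =>
    have := contr hG hv (ξ := ξ) (PI_adm hG hv n) (PI_adm hG hv (n+1)) ¶ ih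
    rw [pow_succ, ← div_div]
    exact this

lemma PI_lim (τ : ℝ) : Tendsto (fun n => (PI G ξ v n).1 τ) atTop (𝓝 (bS G ξ v τ)) ∧
    Tendsto (fun n => (PI G ξ v n).2 τ) atTop (𝓝 (kS G ξ v τ)) := by
  rcases lt_or_ge τ 0 with hτ | hτ
  · have h : ∀ n, (PI G ξ v n).1 τ = 0 ∧ (PI G ξ v n).2 τ = 0 := by
      intro n
      cases n with
      | zero => exact ⟨rfl, rfl⟩
      | succ n => exact ⟨Tb_neg hτ.le, Tk_neg hτ⟩
    have h1 : (fun n => (PI G ξ v n).1 τ) = fun _ => 0 := funext fun n => (h n).1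
    have h2 : (fun n => (PI G ξ v n).2 τ) = fun _ => 0 := funext fun n => (h n).2
    exact ⟨tendsto_nhds_limUnder ⟨0, by rw [h1]; exact tendsto_const_nhds⟩,
      tendsto_nhds_limUnder ⟨0, by rw [h2]; exact tendsto_const_nhds⟩⟩
  · have c1 : CauchySeq (fun n => (PI G ξ v n).1 τ) := by
      apply cauchySeq_of_le_geometric_two (C := 200)
      intro n
      rw [dist_eq_norm]
      exact ((PI_cl hG hv n τ hτ).1).trans (le_of_eq (by ring))
    have c2 : CauchySeq (fun n => (PI G ξ v n).2 τ) := by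
      apply cauchySeq_of_le_geometric_two (C := 2)
      intro n
      rw [dist_eq_norm]
      refine ((PI_cl hG hv n τ hτ).2).trans ?_
      have := w_le hτ
      calc _ ≤ 1/2^n * (1:ℝ) := by gcongr
        _ = _ := by ring
    exact ⟨tendsto_nhds_limUnder (cauchySeq_tendsto_of_complete c1),
      tendsto_nhds_limUnder (cauchySeq_tendsto_of_complete c2)⟩

lemma PI_cl_lim (n : ℕ) : Cl (2/2^n) (PI G ξ v n).1 (PI G ξ v n).2 (bS G ξ v) (kS G ξ v) := by
  intro τ hτ
  constructor
  · have := dist_le_of_le_geometric_two_of_tendsto (f := fun n => (PI G ξ v n).1 τ) (C := 200) (fun n => by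
      rw [dist_eq_norm]
      exact ((PI_cl hG hv n τ hτ).1).trans (le_of_eq (by ring))) (PI_lim hG hv τ).1 n
    rw [dist_eq_norm] at this
    exact this.trans (le_of_eq (by ring))
  · have := dist_le_of_le_geometric_two_of_tendsto (f := fun n => (PI G ξ v n).2 τ) (C := 2 * (1+τ)^κ₇) (fun n => by
      rw [dist_eq_norm]
      exact ((PI_cl hG hv n τ hτ).2).trans (le_of_eq (by ring))) (PI_lim hG hv τ).2 n
    rw [dist_eq_norm] at this
    exact this.trans (le_of_eq (by ring))

lemma S_adm : Adm (bS G ξ v) (kS G ξ v) := by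
  refine ⟨?_, ?_, ?_, ?_⟩
  · exact measurable_of_tendsto_metrizable (fun n => (PI_adm hG hv n).mb)
      (tendsto_pi_nhds.2 fun τ => (PI_lim hG hv (ξ := ξ) τ).1)
  · exact measurable_of_tendsto_metrizable (fun n => (PI_adm hG hv n).mkk)
      (tendsto_pi_nhds.2 fun τ => (PI_lim hG hv (ξ := ξ) τ).2)
  · intro τ hτ
    exact le_of_tendsto (PI_lim hG hv τ).1.norm (Eventually.of_forall fun n => (PI_adm hG hv n).hb τ hτ)
  · intro τ hτ
    exact le_of_tendsto (PI_lim hG hv τ).2.norm (Eventually.of_forall fun n => (PI_adm hG hv n).hk τ hτ)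

omit hG hv in
lemma pow_zero_lim (c : ℝ) : Tendsto (fun n : ℕ => c * (2/2^n : ℝ)) atTop (𝓝 0) := by
  have := (tendsto_pow_atTop_nhds_zero_of_lt_one (r := (1/2:ℝ)) £ £).const_mul (2 * c)
  rw [mul_zero] at this
  refine this.congr fun n => ?_
  rw [one_div, inv_pow]; ring

lemma S_fix {τ : ℝ} (hτ : 0 ≤ τ) : bS G ξ v τ = Tb G ξ v (bS G ξ v) (kS G ξ v) τ ∧
    kS G ξ v τ = Tk G ξ v (bS G ξ v) (kS G ξ v) τ := by
  have h := fun n => contr hG hv (ξ := ξ) (PI_adm hG hv (ξ := ξ) n) (S_adm hG hv) ¶ (PI_cl_lim hG hv n) τ hτ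
  constructor
  · refine tendsto_nhds_unique ((PI_lim hG hv τ).1.comp (tendsto_add_atTop_nat 1)) ?_
    rw [tendsto_iff_norm_sub_tendsto_zero]
    refine squeeze_zero (fun _ => norm_nonneg _) (fun n => ((h n).1).trans ?_) (pow_zero_lim 100)
    have : (0:ℝ) ≤ 2/2^n := by positivity
    linarith
  · refine tendsto_nhds_unique ((PI_lim hG hv τ).2.comp (tendsto_add_atTop_nat 1)) ?_
    rw [tendsto_iff_norm_sub_tendsto_zero]
    refine squeeze_zero (fun _ => norm_nonneg _) (fun n => ((h n).2).trans ?_) (pow_zero_lim 1)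
    have : (0:ℝ) ≤ 2/2^n := by positivity
    have := w_le hτ
    have := w_pos hτ κ₇
    nlinarith

lemma S_uniq {b k : ℝ → ℂ} (h : Adm b k) (hb : ∀ τ, 0 ≤ τ → b τ = Tb G ξ v b k τ)
    (hk : ∀ τ, 0 ≤ τ → k τ = Tk G ξ v b k τ) {τ : ℝ} (hτ : 0 ≤ τ) : b τ = bS G ξ v τ ∧ k τ = kS G ξ v τ := by
  have h0 : ∀ n : ℕ, Cl (2/2^n) b k (bS G ξ v) (kS G ξ v) := by
    intro n
    induction n with
    | zero =>
      intro τ hτ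
      have h1 := h.hb τ hτ
      have h2 := h.hk τ hτ
      have h3 := (S_adm hG hv (ξ := ξ)).hb τ hτ
      have h4 := (S_adm hG hv (ξ := ξ)).hk τ hτ
      have := w_pos hτ κ₇
      constructor
      · refine (norm_sub_le _ _).trans ?_; norm_num; linarith
      · refine (norm_sub_le _ _).trans ?_; norm_num at *; linarith
    | succ n ih =>
      intro τ hτ
      rw [hb τ hτ, hk τ hτ, (S_fix hG hv hτ).1, (S_fix hG hv hτ).2, pow_succ, ← div_div]
      exact contr hG hv h (S_adm hG hv) ¶ ih τ hτ
  have e1 : ‖b τ - bS G ξ v τ‖ ≤ 0 := ge_of_tendsto (pow_zero_lim 100) (Eventually.of_forall fun n => (h0 n τ hτ).1)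
  have e2 : ‖k τ - kS G ξ v τ‖ ≤ 0 := ge_of_tendsto (pow_zero_lim 1) (Eventually.of_forall fun n => by
    refine ((h0 n τ hτ).2).trans ?_
    have : (0:ℝ) ≤ 2/2^n := by positivity
    have := w_le hτ
    nlinarith)
  exact ⟨sub_eq_zero.1 (norm_le_zero_iff.1 e1), sub_eq_zero.1 (norm_le_zero_iff.1 e2)⟩
end

open Real Filter Set MeasureTheory Topology

lemma VV_open (G : ℝ) : IsOpen (VV G) := by
  have h1 : IsOpen {v : ℂ | |v.re| < 1/2} := isOpen_lt (by fun_prop) (by fun_prop)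
  have h2 : IsOpen {v : ℂ | |v.im| < aG G - 2} := isOpen_lt (by fun_prop) (by fun_prop)
  exact h1.inter h2

section
variable {G : ℝ} (hG : Γ₀ ≤ G) {ξ : ℝ}
include hG

lemma xx_diff {b k : ℂ → ℝ → ℂ} {σ : ℝ} (hb : DifferentiableOn ℂ (fun v => b v σ) (VV G))
    (hk : DifferentiableOn ℂ (fun v => k v σ) (VV G)) :
    DifferentiableOn ℂ (fun v => xx v (b v) (k v) σ) (VV G) := by
  unfold xx
  fun_prop

lemma Phi_holo {b k : ℂ → ℝ → ℂ} (ha : ∀ v ∈ VV G, Adm (b v) (k v))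
    (hb : ∀ σ, DifferentiableOn ℂ (fun v => b v σ) (VV G))
    (hk : ∀ σ, DifferentiableOn ℂ (fun v => k v σ) (VV G)) {τ : ℝ} (hτ : 0 ≤ τ) :
    DifferentiableOn ℂ (fun v => ∫ σ in Ioi τ, Phi G (qq (ξ + σ)) (xx v (b v) (k v) σ)) (VV G) := by
  have hi := (tail_int (a := -(5:ℝ)/2) £ hτ).1
  refine holo_int (VV_open G) measurableSet_Ioi (bound := fun σ => 800000 * (1000/(G*√G)) * (1+σ)^(-(5:ℝ)/2))
    (fun v hv => Phi_meas (ha v hv)) ?_ (hi.const_mul _) ?_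
  · intro v hv σ hσ
    have hσ0 : 0 ≤ σ := hτ.trans (le_of_lt hσ)
    refine (D_Phi (G2000 hG) hv hσ0 (DD_sub ((ha v hv).mem v hσ0)) (qq_mem _)).trans ?_
    rw [mul_assoc]
    exact mul_le_mul_of_nonneg_left (bd6 (G2000 hG) hv hσ0) £
  · intro σ hσ v hv
    have hσ0 : 0 ≤ σ := hτ.trans (le_of_lt hσ)
    exact (d_Phi (G2000 hG) hv hσ0 (DD_sub ((ha v hv).mem v hσ0)) (qq_mem _)).comp_differentiableWithinAt v
      (xx_diff hG (hb σ) (hk σ) v hv)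

lemma BB_holo {b k : ℂ → ℝ → ℂ} (ha : ∀ v ∈ VV G, Adm (b v) (k v))
    (hb : ∀ σ, DifferentiableOn ℂ (fun v => b v σ) (VV G))
    (hk : ∀ σ, DifferentiableOn ℂ (fun v => k v σ) (VV G)) (τ : ℝ) :
    DifferentiableOn ℂ (fun v => Tb G ξ v (b v) (k v) τ) (VV G) := by
  refine holo_int (VV_open G) measurableSet_Ioc (bound := fun σ => 1 + 8080/√G)
    (fun v hv => BB_meas (ha v hv)) ?_ (integrableOn_const (by simp)) ?_
  · intro v hv σ hσ
    have hσ := hσ.1.le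
    have h := ha v hv
    have h1 := h.hk σ hσ
    have h2 := ff_w (G2000 hG) hv hσ (ξ := ξ) h
    have hw := w_le hσ
    have hw0 := w_pos hσ κ₇
    set w := (1+σ)^κ₇
    have h3 : ‖k v σ‖ ≤ 1/100 := by nlinarith
    have h4 : 8000/√G * w ≤ 8000/√G := mul_le_of_le_one_right ¶ hw
    have h5 := h2.trans h4
    unfold BB
    simp only [xx] at h5 ⊢
    set f := ff G (qq (ξ + σ)) (v + σ + b v σ, k v σ)
    calc _ ≤ ‖3 * k v σ‖ + ‖f‖ + ‖2 * k v σ^2‖ + ‖k v σ * f‖ := norm_add₄_le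
      _ = 3 * ‖k v σ‖ + ‖f‖ + 2 * (‖k v σ‖ * ‖k v σ‖) + ‖k v σ‖ * ‖f‖ := by simp [pow_two]
      _ ≤ 3 * (1/100) + 8000/√G + 2 * (1/100 * (1/100)) + 1/100 * (8000/√G) := by gcongr
      _ ≤ _ := by ring_nf; gcongr; norm_num
  · intro σ hσ v hv
    have hσ0 : 0 ≤ σ := hσ.1.le
    exact (d_BB (G2000 hG) hv hσ0 (DD_sub ((ha v hv).mem v hσ0)) (qq_mem _)).comp_differentiableWithinAt v
      (xx_diff hG (hb σ) (hk σ) v hv)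

lemma Tk_holo {b k : ℂ → ℝ → ℂ} (ha : ∀ v ∈ VV G, Adm (b v) (k v))
    (hb : ∀ σ, DifferentiableOn ℂ (fun v => b v σ) (VV G))
    (hk : ∀ σ, DifferentiableOn ℂ (fun v => k v σ) (VV G)) (τ : ℝ) :
    DifferentiableOn ℂ (fun v => Tk G ξ v (b v) (k v) τ) (VV G) := by
  rcases lt_or_ge τ 0 with hτ | hτ
  · simp only [Tk_neg hτ]; exact differentiableOn_const _
  · simp only [Tk, if_pos hτ]
    refine DifferentiableOn.mul (DifferentiableOn.neg ?_) (Phi_holo hG ha hb hk hτ)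
    intro v hv
    exact (d_rr (G2000 hG) hv hτ (DD_sub ((ha v hv).mem v hτ))).comp_differentiableWithinAt v
      (xx_diff hG (hb τ) (hk τ) v hv)

lemma PI_holo (n : ℕ) : (∀ σ, DifferentiableOn ℂ (fun v => (PI G ξ v n).1 σ) (VV G)) ∧
    (∀ σ, DifferentiableOn ℂ (fun v => (PI G ξ v n).2 σ) (VV G)) := by
  induction n with
  | zero => exact ⟨fun σ => differentiableOn_const _, fun σ => differentiableOn_const _⟩
  | succ n ih =>
    have ha : ∀ v ∈ VV G, Adm (PI G ξ v n).1 (PI G ξ v n).2 := fun v hv => PI_adm hG hv n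
    exact ⟨BB_holo hG (b := fun v => (PI G ξ v n).1) (k := fun v => (PI G ξ v n).2) ha ih.1 ih.2,
      Tk_holo hG (b := fun v => (PI G ξ v n).1) (k := fun v => (PI G ξ v n).2) ha ih.1 ih.2⟩

lemma S_holo {σ : ℝ} (hσ : 0 ≤ σ) : DifferentiableOn ℂ (fun v => bS G ξ v σ) (VV G) ∧
    DifferentiableOn ℂ (fun v => kS G ξ v σ) (VV G) := by
  constructor
  · refine TendstoLocallyUniformlyOn.differentiableOn (φ := atTop) (F := fun n v => (PI G ξ v n).1 σ) ?_
      (Eventually.of_forall fun n => (PI_holo hG n).1 σ) (VV_open G)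
    apply TendstoUniformlyOn.tendstoLocallyUniformlyOn
    rw [Metric.tendstoUniformlyOn_iff]
    intro ε hε
    filter_upwards [(pow_zero_lim 100).eventually (gt_mem_nhds hε)] with n hn v hv
    rw [dist_comm, dist_eq_norm]
    exact ((PI_cl_lim hG hv n σ hσ).1).trans_lt hn
  · refine TendstoLocallyUniformlyOn.differentiableOn (φ := atTop) (F := fun n v => (PI G ξ v n).2 σ) ?_
      (Eventually.of_forall fun n => (PI_holo hG n).2 σ) (VV_open G)
    apply TendstoUniformlyOn.tendstoLocallyUniformlyOn
    rw [Metric.tendstoUniformlyOn_iff]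
    intro ε hε
    filter_upwards [(pow_zero_lim 1).eventually (gt_mem_nhds hε)] with n hn v hv
    rw [dist_comm, dist_eq_norm]
    refine ((PI_cl_lim hG hv n σ hσ).2).trans_lt ?_
    have := w_le hσ
    have h2 : (0:ℝ) ≤ 2/2^n := by positivity
    nlinarith

lemma S_zero {v : ℂ} (hv : v ∈ VV G) {σ : ℝ} (hσ : σ < 0) : bS G ξ v σ = 0 ∧ kS G ξ v σ = 0 := by
  have h : ∀ n, (PI G ξ v n).1 σ = 0 ∧ (PI G ξ v n).2 σ = 0 := by
    intro n
    cases n with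
    | zero => exact ⟨rfl, rfl⟩
    | succ n => exact ⟨Tb_neg hσ.le, Tk_neg hσ⟩
  have := PI_lim hG hv (ξ := ξ) σ
  simp only [h] at this
  exact ⟨(tendsto_nhds_unique this.1 tendsto_const_nhds), (tendsto_nhds_unique this.2 tendsto_const_nhds)⟩

lemma S_holo' (σ : ℝ) : DifferentiableOn ℂ (fun v => bS G ξ v σ) (VV G) ∧
    DifferentiableOn ℂ (fun v => kS G ξ v σ) (VV G) := by
  rcases lt_or_ge σ 0 with h | h
  · exact ⟨(differentiableOn_const (c := (0:ℂ))).congr fun v hv => (S_zero hG hv h).1,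
      (differentiableOn_const (c := (0:ℂ))).congr fun v hv => (S_zero hG hv h).2⟩
  · exact S_holo hG h

lemma ES_holo : DifferentiableOn ℂ (ES G ξ) (VV G) :=
  (Phi_holo hG (b := bS G ξ) (k := kS G ξ) (fun v hv => S_adm hG hv) (fun σ => (S_holo' hG σ).1)
    (fun σ => (S_holo' hG σ).2) le_rfl).neg

variable {v : ℂ} (hv : v ∈ VV G)
include hv

lemma ES_k : kS G ξ v 0 * (1 + kS G ξ v 0) = rG G v * ES G ξ v := by
  have h := (S_fix hG hv (ξ := ξ) le_rfl)
  rw [Tb_neg le_rfl] at h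
  have hm := ((S_adm hG hv (ξ := ξ)).mem v le_rfl)
  have h2 := one_add_bd (DD_sub hm).2
  have h3 : 1 + kS G ξ v 0 ≠ 0 := by
    intro h; simp only [xx, h] at h2; norm_num at h2
  have h4 := h.2
  rw [Tk, if_pos le_rfl, rr] at h4
  have h5 : kS G ξ v 0 = rG G v / (1 + kS G ξ v 0) * ES G ξ v := by
    conv_lhs => rw [h4]
    simp only [xx, ES, h.1]
    simp
  field_simp at h5
  exact h5

lemma S_small {σ : ℝ} (hσ : 0 ≤ σ) : ‖bS G ξ v σ‖ ≤ 1000000000000/√G ∧ ‖kS G ξ v σ‖ ≤ 1000000000000/√G := by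
  have hs := sqrtG hG
  have hs0 : 0 < √G := by norm_num at hs; linarith
  have h1 : ∀ σ, 0 ≤ σ → ‖kS G ξ v σ‖ ≤ 40000000000/√G * (1+σ)^κ₇ := by
    intro σ hσ
    rw [(S_fix hG hv hσ).2]
    exact Tk_bd (G2000 hG) hv hσ (S_adm hG hv)
  constructor
  · rw [(S_fix hG hv hσ).1]
    refine (Tb_bd (G2000 hG) hv σ (S_adm hG hv) ¶ ?_ h1).trans ?_
    · exact sqd hG £ £
    · have : 6 * (4 * (40000000000/√G) + 8080/√G) = 960000048480/√G := by ring
      rw [this]; gcongr; norm_num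
  · refine (h1 σ hσ).trans ?_
    have := w_le hσ
    calc _ ≤ 40000000000/√G * 1 := by gcongr
      _ ≤ _ := by rw [mul_one]; gcongr; norm_num

lemma Phi_err {σ : ℝ} (hσ : 0 ≤ σ) :
    ‖Phi G (qq (ξ + σ)) (xx v (bS G ξ v) (kS G ξ v) σ) - 3/2 * qq (ξ+σ) * (G * pG G (v+σ) / rG G (v+σ)^5)‖ ≤
      10^23/G^2 * (1+σ)^(-(5:ℝ)/2) := by
  have hs := sqrtG hG
  have hs0 : 0 < √G := by norm_num at hs; linarith
  have hG0 : 0 < G := by linarith [G2000 hG]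
  have hρ := base_pos (G2000 hG) hv hσ
  have hm0 : ((v + σ, 0) : ℂ × ℂ) ∈ DD' (v+σ) := by constructor <;> norm_num
  have hm := ((S_adm hG hv (ξ := ξ)).mem v hσ)
  have l := lip_gen (Ψ := Phi G (qq (ξ+σ))) (fun x hx => d_Phi (G2000 hG) hv hσ hx (qq_mem _))
        (fun x hx => D_Phi (G2000 hG) hv hσ hx (qq_mem _)) hm hm0
  have hx : ‖xx v (bS G ξ v) (kS G ξ v) σ - (v + σ, 0)‖ ≤ 1000000000000/√G := by
    rw [Prod.norm_def]
    obtain ⟨h1, h2⟩ := S_small hG hv (ξ := ξ) hσ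
    apply max_le
    · simpa [xx] using h1
    · simpa [xx] using h2
  have hE : 0 ≤ EE G ‖rG G (v+σ)‖ := by unfold EE; positivity
  have e1 : ‖Phi G (qq (ξ+σ)) (v+σ,0) - 3/2 * qq (ξ+σ) * (G * pG G (v+σ) / rG G (v+σ)^5)‖ ≤
      40 * EE G ‖rG G (v+σ)‖ * (10/√G) := by
    have hd := fh_bd2 (D_x' (G2000 hG) hv hσ (DD_sub hm0) (qq_mem (ξ+σ)))
    have hp := D_p (G2000 hG) hv hσ (DD_sub hm0)
    simp only [rr, add_zero, div_one] at hd hp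
    have hr0 : rG G (v+σ) ≠ 0 := norm_pos_iff.1 hρ
    have : Phi G (qq (ξ+σ)) (v+σ,0) - 3/2 * qq (ξ+σ) * (G * pG G (v+σ) / rG G (v+σ)^5)
      = G * pG G (v+σ) * (fh (qq (ξ+σ) / rG G (v+σ)^2) - 3/2 * (qq (ξ+σ) / rG G (v+σ)^2)) / rG G (v+σ)^3 := by
      simp only [Phi, ff, rr, add_zero, div_one]
      field_simp
    rw [this, norm_div, norm_mul, norm_pow]
    have hq : ‖(qq (ξ+σ) : ℂ) / rG G (v+σ)^2‖ ≤ 1/‖rG G (v+σ)‖^2 := by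
      rw [norm_div, norm_pow, Complex.norm_real, Real.norm_eq_abs, abs_of_nonneg (qq_nonneg _)]
      gcongr; exact qq_le _
    have hb := bd3 (G2000 hG) hv hσ
    have hw := w_le hσ
    have hb' : 1/‖rG G (v+σ)‖^2 ≤ 10/√G := hb.trans (mul_le_of_le_one_right ¶ hw)
    set ρ := ‖rG G (v+σ)‖
    calc _ ≤ (G + 6 * √ρ) * (40 * (1/ρ^2)^2) / ρ^3 := by
          gcongr
          refine hd.trans ?_
          gcongr
      _ = 40 * EE G ρ * (1/ρ^2) := by unfold EE; field_simp
      _ ≤ _ := by gcongr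
  have e2 : ‖Phi G (qq (ξ+σ)) (xx v (bS G ξ v) (kS G ξ v) σ) - Phi G (qq (ξ+σ)) (v+σ,0)‖ ≤
      40 * (800000 * EE G ‖rG G (v+σ)‖) * (1000000000000/√G) := l.trans (by gcongr)
  have h6 := bd6 (G2000 hG) hv hσ
  have hw0 := w_pos hσ (-(5:ℝ)/2)
  calc _ ≤ 40 * (800000 * EE G ‖rG G (v+σ)‖) * (1000000000000/√G) + 40 * EE G ‖rG G (v+σ)‖ * (10/√G) := by
        refine le_trans ?_ (add_le_add e2 e1)
        refine le_trans (le_of_eq ?_) (norm_add_le _ _)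
        congr 1; ring
    _ = 32000000000000000400 / √G * EE G ‖rG G (v+σ)‖ := by ring
    _ ≤ 100000000000000000000 / √G * (1000/(G*√G) * (1+σ)^(-(5:ℝ)/2)) := by gcongr; norm_num
    _ = 10^23/(G * (√G*√G)) * (1+σ)^(-(5:ℝ)/2) := by field_simp; norm_num
    _ = _ := by rw [Real.mul_self_sqrt hG0.le]; ring_nf

lemma ES_err :
    IntegrableOn (fun σ : ℝ => 3/2 * (qq (ξ+σ) : ℂ) * (G * pG G (v+σ) / rG G (v+σ)^5)) (Ioi 0) ∧ 
    ‖ES G ξ v + ∫ σ in Ioi (0:ℝ), 3/2 * (qq (ξ+σ) : ℂ) * (G * pG G (v+σ) / rG G (v+σ)^5)‖ ≤ 10^23/G^2 := by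
  have i1 := Phi_int (G2000 hG) hv (ξ := ξ) (S_adm hG hv (ξ := ξ))
  have hi := (tail_int (a := -(5:ℝ)/2) £ (le_refl 0)).1
  have mm : Measurable (fun σ : ℝ => 3/2 * (qq (ξ+σ) : ℂ) * (G * pG G (v+σ) / rG G (v+σ)^5)) := by
    have := qq_cont.measurable
    have := pG_meas G
    have := rG_meas G
    fun_prop
  have hdi : IntegrableOn (fun σ => Phi G (qq (ξ + σ)) (xx v (bS G ξ v) (kS G ξ v) σ) - 3/2 * qq (ξ+σ) * (G * pG G (v+σ) / rG G (v+σ)^5)) (Ioi 0) := by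
    refine Integrable.mono' (hi.const_mul (10^23/G^2)) ((Phi_meas (S_adm hG hv)).sub mm).aestronglyMeasurable ?_
    filter_upwards [ae_restrict_mem measurableSet_Ioi] with σ hσ
    exact Phi_err hG hv (le_of_lt hσ)
  have i2 : IntegrableOn (fun σ : ℝ => 3/2 * (qq (ξ+σ) : ℂ) * (G * pG G (v+σ) / rG G (v+σ)^5)) (Ioi 0) := by
    refine (i1.sub hdi).congr ?_
    filter_upwards with σ
    simp
  refine ⟨i2, ?_⟩
  rw [ES, neg_add_eq_sub, norm_sub_rev, ← integral_sub i1 i2]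
  have hG0 : 0 < G := by linarith [G2000 hG]
  calc _ ≤ ∫ σ in Ioi 0, 10^23/G^2 * (1+σ)^(-(5:ℝ)/2) := by
        apply norm_integral_le_of_norm_le (hi.const_mul _)
        filter_upwards [ae_restrict_mem measurableSet_Ioi] with σ hσ
        exact Phi_err hG hv (le_of_lt hσ)
    _ = 10^23/G^2 * ∫ σ in Ioi (0:ℝ), (1+σ)^(-(5:ℝ)/2) := by rw [integral_const_mul]
    _ ≤ 10^23/G^2 * 1 := by gcongr; exact tail5
    _ = _ := mul_one _
end

open Real Filter Set MeasureTheory Topology FourierTransform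

lemma cpow_scale {c : ℝ} (hc : 0 < c) {z : ℂ} (hz : z ≠ 0) (s : ℂ) : ((c:ℂ) * z)^s = (c:ℂ)^s * z^s := by
  have hc' : (c:ℂ) ≠ 0 := by exact_mod_cast hc.ne'
  rw [Complex.cpow_def_of_ne_zero (mul_ne_zero hc' hz), Complex.cpow_def_of_ne_zero hc',
    Complex.cpow_def_of_ne_zero hz, Complex.log_ofReal_mul hc hz, add_mul, Complex.exp_add, Complex.ofReal_log hc.le]

lemma gam_int : IntegrableOn (fun t : ℝ => Real.exp (-t) * t^((3:ℝ)/2)) (Ioi 0) := by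
  have := Real.GammaIntegral_convergent (s := 5/2) £
  norm_num at this
  exact this

lemma gam_holo : DifferentiableOn ℂ (fun r : ℂ => ∫ t in Ioi (0:ℝ), ((t^((3:ℝ)/2) : ℝ) : ℂ) * Complex.exp (-(r * t))) {r | 1 < r.re} := by
  refine holo_int (isOpen_lt continuous_const Complex.continuous_re) measurableSet_Ioi
    (bound := fun t : ℝ => Real.exp (-t) * t^((3:ℝ)/2)) ?_ ?_ gam_int ?_
  · intro v _; fun_prop
  · intro v hv t ht
    have ht : 0 < t := ht
    have hv : 1 < v.re := hv
    rw [norm_mul, Complex.norm_exp, Complex.norm_real, Real.norm_eq_abs, abs_of_nonneg ¶, mul_comm]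
    gcongr
    simp; nlinarith
  · intro t ht; fun_prop

lemma gam_eq {r : ℂ} (hr : 1 < r.re) :
    ∫ t in Ioi (0:ℝ), ((t^((3:ℝ)/2) : ℝ) : ℂ) * Complex.exp (-(r * t)) = (1/r)^(5/2:ℂ) * Complex.Gamma (5/2) := by
  have hopen : IsOpen {r : ℂ | 1 < r.re} := isOpen_lt continuous_const Complex.continuous_re
  have hf : AnalyticOnNhd ℂ (fun r : ℂ => ∫ t in Ioi (0:ℝ), ((t^((3:ℝ)/2) : ℝ) : ℂ) * Complex.exp (-(r * t))) {r | 1 < r.re} :=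
    gam_holo.analyticOnNhd hopen
  have hg : AnalyticOnNhd ℂ (fun r : ℂ => (1/r)^(5/2:ℂ) * Complex.Gamma (5/2)) {r | 1 < r.re} := by
    refine DifferentiableOn.analyticOnNhd ?_ hopen
    intro r hr
    have hr : 1 < r.re := hr
    have h0 : r ≠ 0 := by rintro rfl; norm_num at hr
    have : 1/r ∈ Complex.slitPlane := by
      left
      rw [one_div, Complex.inv_re]
      exact div_pos § (Complex.normSq_pos.2 h0)
    refine DifferentiableAt.differentiableWithinAt ?_
    fun_prop (disch := first | exact h0 | exact this)
  have hpc : IsPreconnected {r : ℂ | 1 < r.re} := (convex_halfSpace_re_gt 1).isPreconnected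
  refine hf.eqOn_of_preconnected_of_frequently_eq hg hpc (z₀ := 2) £ ?_ hr
  have ht : Tendsto (fun n : ℕ => ((2 + 1/((n:ℝ)+1):ℝ):ℂ)) atTop (𝓝[≠] 2) := by
    apply tendsto_nhdsWithin_of_tendsto_nhds_of_eventually_within
    · have := (tendsto_one_div_add_atTop_nhds_zero_nat (𝕜 := ℝ)).const_add 2
      rw [add_zero] at this
      have h2 := (Complex.continuous_ofReal.tendsto 2).comp this
      simpa [Function.comp_def] using h2
    · filter_upwards with n
      have : (0:ℝ) < 1/((n:ℝ)+1) := by positivity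
      rw [mem_compl_singleton_iff]
      intro h
      rw [show (2:ℂ) = ((2:ℝ):ℂ) by simp, Complex.ofReal_inj] at h
      linarith
  refine ht.frequently (Frequently.of_forall fun n => ?_)
  have hpos : (0:ℝ) < 2 + 1/((n:ℝ)+1) := by positivity
  have h := Complex.integral_cpow_mul_exp_neg_mul_Ioi (a := 5/2) £ hpos
  rw [← h]
  refine setIntegral_congr_fun measurableSet_Ioi fun t ht => ?_
  have ht : 0 < t := ht
  rw [Complex.ofReal_cpow ht.le]
  norm_num

def fF (x : ℝ) : ℂ := (((max x 0)^((3:ℝ)/2) * Real.exp (-3*x) : ℝ) : ℂ)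

lemma fF_cont : Continuous fF := by
  unfold fF
  refine Complex.continuous_ofReal.comp (Continuous.mul ?_ (by fun_prop))
  exact (continuous_id.max continuous_const).rpow_const (fun x => Or.inr £)

lemma fF_neg {x : ℝ} (hx : x ∉ Ioi (0:ℝ)) : fF x = 0 := by
  have : x ≤ 0 := not_lt.1 hx
  unfold fF; rw [max_eq_right this, Real.zero_rpow £]; simp

lemma fF_int : Integrable fF := by
  have h : IntegrableOn fF (Ioi 0) := by
    refine Integrable.mono' gam_int fF_cont.aestronglyMeasurable ?_
    filter_upwards [ae_restrict_mem measurableSet_Ioi] with x hx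
    have hx : 0 < x := hx
    unfold fF
    rw [Complex.norm_real, Real.norm_eq_abs, abs_of_nonneg ¶, max_eq_left hx.le, mul_comm]
    gcongr
    linarith
  rw [← integrableOn_univ]
  have := h.of_forall_sdiff_eq_zero (t := univ) MeasurableSet.univ (fun x hx => fF_neg hx.2)
  exact this

lemma fF_four (w : ℝ) : 𝓕 fF w = (1/(3 + 2*π*w*Complex.I))^(5/2:ℂ) * Complex.Gamma (5/2) := by
  rw [Real.fourier_real_eq_integral_exp_smul, ← gam_eq (by simp)]
  rw [← setIntegral_eq_integral_of_forall_compl_eq_zero (s := Ioi (0:ℝ)) (fun x hx => by rw [fF_neg hx, smul_zero])]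
  refine setIntegral_congr_fun measurableSet_Ioi fun t ht => ?_
  have ht : 0 < t := ht
  simp only [fF, smul_eq_mul]
  rw [max_eq_left ht.le]
  push_cast
  rw [mul_left_comm, ← Complex.exp_add]
  congr 2
  ring

lemma den_bd (σ : ℝ) : (1+|σ|)/2 ≤ ‖(3 + σ*Complex.I : ℂ)‖ := by
  have h1 := Complex.abs_re_le_norm (3 + σ*Complex.I : ℂ)
  have h2 := Complex.abs_im_le_norm (3 + σ*Complex.I : ℂ)
  simp at h1 h2
  linarith

lemma hf_int : Integrable (fun σ : ℝ => (1/(3 + σ*Complex.I))^(5/2:ℂ)) := by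
  have hm : Measurable (fun σ : ℝ => (1/(3 + σ*Complex.I))^(5/2:ℂ)) := by fun_prop
  have h0 := integrable_one_add_norm (E := ℝ) (μ := volume) (r := 5/2) £
  refine Integrable.mono' (h0.const_mul (2^(5/2:ℝ))) hm.aestronglyMeasurable ?_
  filter_upwards with σ
  have hd := den_bd σ
  have hp : 0 < 1 + |σ| := by positivity
  rw [show (5/2:ℂ) = ((5/2:ℝ):ℂ) by push_cast; ring, Complex.norm_cpow_real, norm_div, norm_one, Real.norm_eq_abs]
  calc _ ≤ (1/((1+|σ|)/2))^(5/2:ℝ) := by gcongr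
    _ = (2 * (1+|σ|)⁻¹)^(5/2:ℝ) := by congr 1; field_simp
    _ = _ := by rw [Real.mul_rpow £ ¶, Real.inv_rpow hp.le, Real.rpow_neg hp.le]

lemma J_ne : ∫ σ : ℝ, (1/(3 + σ*Complex.I))^(5/2:ℂ) * Complex.exp (Complex.I * σ) ≠ 0 := by
  have h2pi : (2*π) ≠ 0 := by positivity
  have hi : Integrable (𝓕 fF) := by
    have : 𝓕 fF = fun w => (1/(3 + ((2*π*w:ℝ):ℂ)*Complex.I))^(5/2:ℂ) * Complex.Gamma (5/2) := by
      funext w; rw [fF_four]; push_cast; rfl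
    rw [this]
    exact (hf_int.comp_mul_left' h2pi).mul_const _
  have h := fF_int.fourierInv_fourier_eq hi (v := 1) fF_cont.continuousAt
  have h1 : fF 1 ≠ 0 := by unfold fF; simp
  rw [← h, Real.fourierInv_eq'] at h1
  intro hJ
  apply h1
  have e : ∀ w : ℝ, Complex.exp (((2 * π * inner ℝ w (1:ℝ) : ℝ):ℂ) * Complex.I) • 𝓕 fF w
    = Complex.Gamma (5/2) * ((fun σ : ℝ => (1/(3 + σ*Complex.I))^(5/2:ℂ) * Complex.exp (Complex.I * σ)) (2*π*w)) := by
    intro w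
    rw [fF_four]
    simp only [smul_eq_mul]
    push_cast
    simp
    ring_nf
  rw [integral_congr_ae (Eventually.of_forall e), integral_const_mul,
    Measure.integral_comp_mul_left (fun σ : ℝ => (1/(3 + σ*Complex.I))^(5/2:ℂ) * Complex.exp (Complex.I * σ)), hJ]
  simp

open Real Filter Set MeasureTheory Topology

def v1 (G : ℝ) : ℂ := Complex.I * ((aG G - 3 : ℝ) : ℂ)
def mI (G σ : ℝ) : ℂ := G * pG G (v1 G + σ) / rG G (v1 G + σ)^5

lemma aG_big {G : ℝ} (hG : Γ₀ ≤ G) : 10 ≤ aG G := by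
  have := G2000 hG
  unfold aG
  nlinarith [pow_le_pow_left₀ £ this 3]

lemma v1_mem {G : ℝ} (hG : Γ₀ ≤ G) : v1 G ∈ VV G ∧ -v1 G ∈ VV G := by
  have h := aG_big hG
  have : |aG G - 3| < aG G - 2 := by rw [abs_of_nonneg §]; linarith
  unfold v1 VV
  constructor
  · constructor
    · simp
    · simpa using this
  · constructor
    · simp
    · simp only [Complex.neg_im, abs_neg]; simpa using this

lemma mI_neg {G σ : ℝ} (hG : Γ₀ ≤ G) : mI G (-σ) = -(G * pG G (-v1 G + σ) / rG G (-v1 G + σ)^5) := by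
  have h := aG_big hG
  have hG0 : 0 < G := by linarith [G2000 hG]
  have him : |(v1 G + (-σ:ℝ)).im| < aG G := by
    simp [v1]; rw [abs_of_nonneg §]; linarith
  unfold mI
  have e : -v1 G + σ = -(v1 G + (-σ:ℝ)) := by push_cast; ring
  rw [e, pG_odd hG0 him, rG_even hG0 him]
  ring

lemma mI_bd {G : ℝ} (hG : Γ₀ ≤ G) (σ : ℝ) : ‖mI G σ‖ ≤ 1000/(G*√G) * (1+|σ|)^(-(5:ℝ)/2) := by
  have hG0 : 0 < G := by linarith [G2000 hG]
  have key : ∀ v ∈ VV G, ∀ σ : ℝ, 0 ≤ σ → ‖(G * pG G (v + σ) / rG G (v + σ)^5 : ℂ)‖ ≤ 1000/(G*√G) * (1+σ)^(-(5:ℝ)/2) := by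
    intro v hv σ hσ
    refine le_trans ?_ (bd6 (G2000 hG) hv hσ)
    have hp := D_p (G2000 hG) hv hσ (x := (v+σ, 0)) (by constructor <;> norm_num)
    rw [norm_div, norm_pow]
    unfold EE
    gcongr
  rcases le_total 0 σ with h | h
  · rw [abs_of_nonneg h]; exact key _ (v1_mem hG).1 σ h
  · rw [abs_of_nonpos h]
    have := key _ (v1_mem hG).2 (-σ) §
    rwa [← norm_neg, ← mI_neg hG, neg_neg] at this

lemma mI_meas (G : ℝ) : Measurable (mI G) := by
  have := pG_meas G
  have := rG_meas G
  unfold mI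
  fun_prop

lemma w5_int : Integrable (fun σ : ℝ => (1+|σ|)^(-(5:ℝ)/2)) := by
  have h0 := integrable_one_add_norm (E := ℝ) (μ := volume) (r := 5/2) £
  simpa [neg_div] using h0

lemma aG_top : Tendsto aG atTop atTop := by
  unfold aG
  exact (tendsto_pow_atTop £).atTop_div_const £

def c0 : ℂ := (Complex.exp (π/2*Complex.I/3) - Complex.exp (-(π/2*Complex.I/3))) *
  (Complex.exp (π/2*Complex.I/3) + Complex.exp (-(π/2*Complex.I/3)))^5 / ((6:ℝ):ℂ)^(5/2:ℂ)

lemma c0_ne : c0 ≠ 0 := by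
  have e1 : Complex.exp (π/2*Complex.I/3) = ((√3/2:ℝ):ℂ) + ((1/2:ℝ):ℂ) * Complex.I := by
    rw [show (π/2*Complex.I/3:ℂ) = ((π/6:ℝ):ℂ) * Complex.I by push_cast; ring, Complex.exp_mul_I,
      ← Complex.ofReal_cos, ← Complex.ofReal_sin, Real.cos_pi_div_six, Real.sin_pi_div_six]
  have e2 : Complex.exp (-(π/2*Complex.I/3)) = ((√3/2:ℝ):ℂ) - ((1/2:ℝ):ℂ) * Complex.I := by
    rw [show (-(π/2*Complex.I/3):ℂ) = ((-(π/6):ℝ):ℂ) * Complex.I by push_cast; ring, Complex.exp_mul_I,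
      ← Complex.ofReal_cos, ← Complex.ofReal_sin, Real.cos_neg, Real.sin_neg, Real.cos_pi_div_six, Real.sin_pi_div_six]
    push_cast; ring
  unfold c0
  rw [e1, e2]
  apply div_ne_zero
  · apply mul_ne_zero
    · intro h
      have := congrArg Complex.im h
      norm_num at this
    · apply pow_ne_zero
      intro h
      have := congrArg Complex.re h
      norm_num at this
  · rw [Complex.cpow_ne_zero_iff]; left; norm_num

lemma z_lim (σ : ℝ) : Tendsto (fun G : ℝ => (v1 G + σ)/(aG G:ℂ)) atTop (𝓝 Complex.I) ∧
    Tendsto (fun G : ℝ => ((G^3:ℝ):ℂ) * (1 + ((v1 G + σ)/(aG G:ℂ))^2)) atTop (𝓝 (6 * (3 + σ * Complex.I))) := by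
  have hinv : Tendsto (fun G : ℝ => ((aG G:ℝ):ℂ)⁻¹) atTop (𝓝 0) := by
    have := (Complex.continuous_ofReal.tendsto 0).comp (tendsto_inv_atTop_zero.comp aG_top)
    simpa [Function.comp_def] using this
  have hev : ∀ᶠ G in atTop, aG G ≠ 0 := (aG_top.eventually_gt_atTop 0).mono fun G h => h.ne'
  constructor
  · have h : Tendsto (fun G : ℝ => Complex.I + (σ - 3*Complex.I) * ((aG G:ℝ):ℂ)⁻¹) atTop (𝓝 (Complex.I + (σ - 3*Complex.I) * 0)) :=
      (hinv.const_mul _).const_add _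
    rw [mul_zero, add_zero] at h
    refine h.congr' ?_
    filter_upwards [hev] with G hg
    have : (aG G:ℂ) ≠ 0 := by exact_mod_cast hg
    unfold v1
    push_cast
    field_simp
    ring
  · have h : Tendsto (fun G : ℝ => 6 * (3 + σ * Complex.I) + 3 * (σ - 3*Complex.I)^2 * ((aG G:ℝ):ℂ)⁻¹) atTop (𝓝 (6 * (3 + σ * Complex.I) + 3 * (σ - 3*Complex.I)^2 * 0)) :=
      (hinv.const_mul _).const_add _
    rw [mul_zero, add_zero] at h
    refine h.congr' ?_
    filter_upwards [hev] with G hg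
    have : (aG G:ℂ) ≠ 0 := by exact_mod_cast hg
    have e : ((G^3:ℝ):ℂ) = 3 * aG G := by unfold aG; push_cast; ring
    rw [e]
    unfold v1
    push_cast
    field_simp
    ring_nf
    simp only [Complex.I_sq]
    ring

lemma mI_lim (σ : ℝ) : Tendsto (fun G : ℝ => ((G*√G:ℝ):ℂ) * mI G σ) atTop (𝓝 (c0 * (1/(3 + σ*Complex.I))^(5/2:ℂ))) := by
  obtain ⟨hz, hD⟩ := z_lim σ
  have hre : 0 < (3 + σ * Complex.I : ℂ).re := by simp
  have hne : (3 + σ * Complex.I : ℂ) ≠ 0 := by intro h; rw [h] at hre; simp at hre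
  have hS : Tendsto (fun G : ℝ => cS ((v1 G + σ)/(aG G:ℂ))) atTop (𝓝 0) := by
    rw [tendsto_zero_iff_norm_tendsto_zero]
    have h1 : Tendsto (fun G : ℝ => √‖1 + ((v1 G + σ)/(aG G:ℂ))^2‖) atTop (𝓝 0) := by
      have := ((hz.pow 2).const_add 1).norm.sqrt
      simpa using this
    refine h1.congr fun G => ?_
    rw [← cS_sq, norm_pow, Real.sqrt_sq (norm_nonneg _)]
  have hX : Tendsto (fun G : ℝ => cX ((v1 G + σ)/(aG G:ℂ))) atTop (𝓝 (π/2*Complex.I/3)) := by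
    unfold cX
    rw [← Complex.log_I]
    refine Tendsto.div_const (Tendsto.clog ?_ (by simp [Complex.mem_slitPlane_iff])) _
    simpa using hz.add hS
  have hE := (Complex.continuous_exp.tendsto _).comp hX
  have hE' := (Complex.continuous_exp.tendsto _).comp hX.neg
  have hP : Tendsto (fun G : ℝ => cP ((v1 G + σ)/(aG G:ℂ))) atTop (𝓝 (Complex.exp (π/2*Complex.I/3) - Complex.exp (-(π/2*Complex.I/3)))) := hE.sub hE'
  have hC : Tendsto (fun G : ℝ => cC ((v1 G + σ)/(aG G:ℂ))) atTop (𝓝 (Complex.exp (π/2*Complex.I/3) + Complex.exp (-(π/2*Complex.I/3)))) := hE.add hE'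
  have hD2 : Tendsto (fun G : ℝ => (((G^3:ℝ):ℂ) * (1 + ((v1 G + σ)/(aG G:ℂ))^2))^(1/2:ℂ)) atTop (𝓝 ((6 * (3 + σ * Complex.I))^(1/2:ℂ))) := by
    refine (continuousAt_cpow_const (Or.inl ?_)).tendsto.comp hD
    simp
  have hlim := (hP.mul (hC.pow 5)).div (hD2.pow 5) (by
    apply pow_ne_zero
    rw [Complex.cpow_ne_zero_iff]; left
    exact mul_ne_zero £ hne)
  have hval : (Complex.exp (π/2*Complex.I/3) - Complex.exp (-(π/2*Complex.I/3))) * (Complex.exp (π/2*Complex.I/3) + Complex.exp (-(π/2*Complex.I/3)))^5 / ((6 * (3 + σ * Complex.I))^(1/2:ℂ))^5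
     = c0 * (1/(3 + σ*Complex.I))^(5/2:ℂ) := by
    unfold c0
    rw [← Complex.cpow_nat_mul, show ((5:ℕ):ℂ) * (1/2) = 5/2 by push_cast; ring,
      show (6:ℂ) = ((6:ℝ):ℂ) by simp, cpow_scale £ hne, one_div, Complex.inv_cpow]
    · rw [← div_eq_mul_inv, div_div]
    · intro h
      have := Complex.arg_eq_pi_iff.1 h
      linarith [this.1]
  rw [hval] at hlim
  refine hlim.congr' ?_
  filter_upwards [eventually_ge_atTop (Γ₀)] with G hG
  have ha := aG_big hG
  have hG0 : 0 < G := by linarith [G2000 hG]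
  have him : |((v1 G + σ)/(aG G:ℂ)).im| < 1 := by
    rw [Complex.div_ofReal_im, abs_div, abs_of_pos (by linarith : (0:ℝ) < aG G), div_lt_one §]
    simp [v1]; rw [abs_of_nonneg §]; linarith
  have hsre := strip_re him
  have hs0 : 1 + ((v1 G + σ)/(aG G:ℂ))^2 ≠ 0 := by intro h; rw [h] at hsre; simp at hsre
  unfold mI pG rG
  rw [cR_eq him]
  simp only [Pi.div_apply]
  rw [cpow_scale ¶ hs0]
  have e1 : (((G^3:ℝ):ℂ))^(1/2:ℂ) = ((G*√G:ℝ):ℂ) := by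
    rw [show (1/2:ℂ) = ((1/2:ℝ):ℂ) by push_cast; ring, ← Complex.ofReal_cpow ¶, ← Real.sqrt_eq_rpow]
    congr 1
    rw [show G^3 = G^2*G by ring, Real.sqrt_mul ¶, Real.sqrt_sq hG0.le]
  rw [e1]
  have hSS : (1 + ((v1 G + σ)/(aG G:ℂ))^2)^(1/2:ℂ) = cS ((v1 G + σ)/(aG G:ℂ)) := rfl
  rw [hSS]
  have hs : cS ((v1 G + σ)/(aG G:ℂ)) ≠ 0 := by
    intro h; have := cS_re him; rw [h] at this; simp at this
  have hc := cC_ne him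
  have hq : ((√G:ℝ):ℂ)^2 = G := by rw [← Complex.ofReal_pow, Real.sq_sqrt hG0.le]
  have hq0 : ((√G:ℝ):ℂ) ≠ 0 := by exact_mod_cast (Real.sqrt_pos.2 hG0).ne'
  have hG' : (G:ℂ) ≠ 0 := by exact_mod_cast hG0.ne'
  push_cast
  rw [← hq]
  field_simp

open Real Filter Set MeasureTheory Topology

def LL (G : ℝ) : ℂ := ∫ σ : ℝ, mI G σ * Complex.exp (Complex.I * σ)

lemma nexp (σ : ℝ) : ‖Complex.exp (Complex.I * σ)‖ = 1 := by rw [mul_comm]; exact Complex.norm_exp_ofReal_mul_I σ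

lemma LL_lim : Tendsto (fun G : ℝ => ((G*√G:ℝ):ℂ) * LL G) atTop
    (𝓝 (c0 * ∫ σ : ℝ, (1/(3 + σ*Complex.I))^(5/2:ℂ) * Complex.exp (Complex.I * σ))) := by
  unfold LL
  simp only [← integral_const_mul]
  refine tendsto_integral_filter_of_dominated_convergence (fun σ => 1000 * (1+|σ|)^(-(5:ℝ)/2)) ?_ ?_ (w5_int.const_mul _) ?_
  · filter_upwards with G
    have := mI_meas G
    fun_prop
  · filter_upwards [eventually_ge_atTop (Γ₀)] with G hG
    filter_upwards with σ
    have hG0 : 0 < G := by linarith [G2000 hG]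
    have hs : 0 < √G := Real.sqrt_pos.2 hG0
    rw [norm_mul, norm_mul, nexp, mul_one, Complex.norm_real, Real.norm_eq_abs, abs_of_pos ¶]
    calc _ ≤ (G*√G) * (1000/(G*√G) * (1+|σ|)^(-(5:ℝ)/2)) := by gcongr; exact mI_bd hG σ
      _ = _ := by field_simp
  · filter_upwards with σ
    have := (mI_lim σ).mul_const (Complex.exp (Complex.I * σ))
    simpa only [mul_assoc] using this

lemma mI_int {G : ℝ} (hG : Γ₀ ≤ G) : Integrable (mI G) :=
  Integrable.mono' (w5_int.const_mul _) (mI_meas G).aestronglyMeasurable (Eventually.of_forall (mI_bd hG))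

lemma mIq_int {G : ℝ} (hG : Γ₀ ≤ G) (ξ : ℝ) : Integrable (fun σ => (qq (ξ+σ):ℂ) * mI G σ) := by
  refine Integrable.mono' (mI_int hG).norm ?_ (Eventually.of_forall fun σ => ?_)
  · have := mI_meas G
    have := qq_cont.measurable
    fun_prop
  · rw [norm_mul, Complex.norm_real, Real.norm_eq_abs, abs_of_nonneg (qq_nonneg _)]
    exact mul_le_of_le_one_left (norm_nonneg _) (qq_le _)

lemma sym_small {G : ℝ} (hG : Γ₀ ≤ G) {ξ : ℝ} (h : ES G ξ (v1 G) = ES G (-ξ) (-v1 G)) :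
    ‖∫ σ : ℝ, (qq (ξ+σ):ℂ) * mI G σ‖ ≤ 2 * 10^23/G^2 := by
  obtain ⟨m1, m2⟩ := v1_mem hG
  have a := (ES_err hG m1 (ξ := ξ)).2
  have b := (ES_err hG m2 (ξ := -ξ)).2
  have e1 : ∫ σ in Ioi (0:ℝ), 3/2 * (qq (ξ+σ) : ℂ) * (G * pG G (v1 G+σ) / rG G (v1 G+σ)^5)
      = 3/2 * ∫ σ in Ioi (0:ℝ), (qq (ξ+σ):ℂ) * mI G σ := by
    rw [← integral_const_mul]; simp only [mI, mul_assoc]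
  have e2 : ∫ σ in Ioi (0:ℝ), 3/2 * (qq (-ξ+σ) : ℂ) * (G * pG G (-v1 G+σ) / rG G (-v1 G+σ)^5)
      = -(3/2 * ∫ σ in Iic (0:ℝ), (qq (ξ+σ):ℂ) * mI G σ) := by
    rw [← integral_const_mul, ← integral_neg, ← neg_zero, ← integral_comp_neg_Ioi, neg_zero]
    congr 1
    funext σ
    rw [mI_neg hG, show ξ + -σ = -(-ξ+σ) by ring, qq_even]
    ring
  rw [e1] at a
  rw [e2, ← h] at b
  have i := mIq_int hG ξ
  have hsplit := integral_add_compl (measurableSet_Iic (a := (0:ℝ))) i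
  rw [compl_Iic] at hsplit
  rw [← hsplit]
  set A := ∫ σ in Ioi (0:ℝ), (qq (ξ+σ):ℂ) * mI G σ
  set B := ∫ σ in Iic (0:ℝ), (qq (ξ+σ):ℂ) * mI G σ
  have : 3/2 * (B + A) = (ES G ξ (v1 G) + 3/2 * A) - (ES G ξ (v1 G) + -(3/2 * B)) := by ring
  have h3 := norm_sub_le (ES G ξ (v1 G) + 3/2 * A) (ES G ξ (v1 G) + -(3/2 * B))
  rw [← this, norm_mul] at h3
  have hG0 : 0 < G := by linarith [G2000 hG]
  have e3 : ‖(3/2:ℂ)‖ = 3/2 := by norm_num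
  rw [e3] at h3
  have h4 : (0:ℝ) ≤ 10^23/G^2 := by positivity
  rw [mul_div_assoc]
  linarith [norm_nonneg (B+A)]

lemma four_shift (σ : ℝ) : ∫ ξ in (0:ℝ)..2*π, (qq (ξ+σ):ℂ) * Complex.exp (-(Complex.I*ξ)) =
    (∫ x in (0:ℝ)..2*π, (qq x:ℂ) * Complex.exp (-(Complex.I*x))) * Complex.exp (Complex.I * σ) := by
  have hper : Function.Periodic (fun x : ℝ => (qq x:ℂ) * Complex.exp (-(Complex.I*x))) (2*π) := by
    intro x
    simp only
    rw [qq_per]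
    congr 1
    rw [Complex.exp_eq_exp_iff_exists_int]
    exact ⟨-1, by push_cast; ring⟩
  have h1 : ∀ ξ : ℝ, (qq (ξ+σ):ℂ) * Complex.exp (-(Complex.I*ξ)) =
     ((fun x : ℝ => (qq x:ℂ) * Complex.exp (-(Complex.I*x))) (ξ+σ)) * Complex.exp (Complex.I * σ) := by
    intro ξ
    simp only
    rw [mul_assoc, ← Complex.exp_add]
    congr 2
    push_cast; ring
  simp only [h1]
  rw [intervalIntegral.integral_mul_const, intervalIntegral.integral_comp_add_right (fun x : ℝ => (qq x:ℂ) * Complex.exp (-(Complex.I*x)))]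
  congr 1
  rw [zero_add, add_comm, hper.intervalIntegral_add_eq σ 0, zero_add]

lemma LL_small {G : ℝ} (hG : Γ₀ ≤ G) (h : ∀ ξ, ES G ξ (v1 G) = ES G (-ξ) (-v1 G)) :
    ‖∫ x in (0:ℝ)..2*π, (qq x:ℂ) * Complex.exp (-(Complex.I*x))‖ * ‖LL G‖ ≤ 4 * π * 10^23/G^2 := by
  have e : (∫ x in (0:ℝ)..2*π, (qq x:ℂ) * Complex.exp (-(Complex.I*x))) * LL G =
    ∫ ξ in (0:ℝ)..2*π, (∫ σ : ℝ, (qq (ξ+σ):ℂ) * mI G σ * Complex.exp (-(Complex.I*ξ))) := by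
    rw [intervalIntegral_integral_swap]
    · unfold LL
      rw [← integral_const_mul]
      congr 1; funext σ
      rw [show (∫ x in (0:ℝ)..2*π, (qq x:ℂ) * Complex.exp (-(Complex.I*x))) * (mI G σ * Complex.exp (Complex.I * σ))
        = mI G σ * ((∫ x in (0:ℝ)..2*π, (qq x:ℂ) * Complex.exp (-(Complex.I*x))) * Complex.exp (Complex.I * σ)) by ring,
        ← four_shift, ← intervalIntegral.integral_const_mul]
      congr 1; funext ξ; ring
    · have hfin : IsFiniteMeasure (volume.restrict (uIoc (0:ℝ) (2*π))) := ⟨by simp [uIoc]⟩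
      have hc : Integrable (fun p : ℝ × ℝ => (1:ℝ) * ‖mI G p.2‖) ((volume.restrict (uIoc (0:ℝ) (2*π))).prod volume) :=
        Integrable.mul_prod (integrable_const 1) (mI_int hG).norm
      refine Integrable.mono' hc ?_ (Eventually.of_forall fun p => ?_)
      · have := mI_meas G
        have := qq_cont.measurable
        simp only [Function.uncurry_def]
        fun_prop
      · have hn : ‖Complex.exp (-(Complex.I * p.1))‖ = 1 := by rw [← mul_neg, ← Complex.ofReal_neg]; exact nexp _
        simp only [Function.uncurry]
        rw [norm_mul, norm_mul, hn, Complex.norm_real, Real.norm_eq_abs, abs_of_nonneg (qq_nonneg _), mul_one]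
        gcongr
        exact qq_le _
  rw [← norm_mul, e]
  have := intervalIntegral.norm_integral_le_of_norm_le_const (a := (0:ℝ)) (b := 2*π) (C := 2 * 10^23/G^2)
    (f := fun ξ : ℝ => ∫ σ : ℝ, (qq (ξ+σ):ℂ) * mI G σ * Complex.exp (-(Complex.I*ξ))) (fun ξ _ => by
      have hn : ‖Complex.exp (-(Complex.I * ξ))‖ = 1 := by rw [← mul_neg, ← Complex.ofReal_neg]; exact nexp _
      rw [integral_mul_const, norm_mul, hn, mul_one]
      exact sym_small hG (h ξ))
  refine this.trans (le_of_eq ?_)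
  rw [sub_zero, abs_of_pos ¶]
  ring

lemma ES_asym : ∃ G1 : ℝ, Γ₀ ≤ G1 ∧ ∀ G ≥ G1, ∃ ξ, ES G ξ (v1 G) ≠ ES G (-ξ) (-v1 G) := by
  set Q := ∫ x in (0:ℝ)..2*π, (qq x:ℂ) * Complex.exp (-(Complex.I*x)) with hQ
  set L := c0 * ∫ σ : ℝ, (1/(3 + σ*Complex.I))^(5/2:ℂ) * Complex.exp (Complex.I * σ) with hL
  have hQ0 : 0 < ‖Q‖ := norm_pos_iff.2 qq_fourier
  have hL0 : 0 < ‖L‖ := norm_pos_iff.2 (mul_ne_zero c0_ne J_ne)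
  have l1 : ∀ᶠ G in atTop, ‖L‖/2 < ‖((G*√G:ℝ):ℂ) * LL G‖ :=
    LL_lim.norm.eventually (lt_mem_nhds §)
  have l2 : ∀ᶠ G in atTop, (4 * π * 10^23) / (‖Q‖ * (‖L‖/2)) < √G :=
    Real.tendsto_sqrt_atTop.eventually_gt_atTop _
  obtain ⟨G2, hG2⟩ := eventually_atTop.1 (l1.and l2)
  refine ⟨max G2 (10^40), le_max_right _ _, fun G hG => ?_⟩
  have hG40 : Γ₀ ≤ G := (le_max_right _ _).trans hG
  obtain ⟨h1, h2⟩ := hG2 G ((le_max_left _ _).trans hG)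
  by_contra! hcon
  have h3 := LL_small hG40 hcon
  rw [← hQ] at h3
  have hG0 : 0 < G := by linarith [G2000 hG40]
  have hs : 0 < √G := Real.sqrt_pos.2 hG0
  have e : ‖((G*√G:ℝ):ℂ) * LL G‖ = G*√G*‖LL G‖ := by
    rw [norm_mul, Complex.norm_real, Real.norm_eq_abs, abs_of_pos ¶]
  rw [e] at h1
  rw [div_lt_iff₀ ¶] at h2
  have h4 : ‖Q‖ * (‖L‖/2) ≤ (G*√G) * (4 * π * 10^23/G^2) := by
    calc _ ≤ ‖Q‖ * (G*√G * ‖LL G‖) := by gcongr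
      _ = (G*√G) * (‖Q‖ * ‖LL G‖) := by ring
      _ ≤ _ := by gcongr
  have h5 : √G * ((G*√G) * (4 * π * 10^23/G^2)) = 4 * π * 10^23 := by
    rw [show √G * ((G*√G) * (4 * π * 10^23/G^2)) = (√G*√G) * G * (4 * π * 10^23/G^2) by ring, Real.mul_self_sqrt hG0.le]
    field_simp
  have h6 := mul_le_mul_of_nonneg_left h4 hs.le
  linarith

lemma ES_asym_real : ∃ G1 : ℝ, Γ₀ ≤ G1 ∧ ∀ G ≥ G1, ∃ ξ : ℝ, ∃ v : ℝ, 0 < v ∧ v < 1/2 ∧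
    ES G ξ v ≠ ES G (-ξ) (-v) := by
  obtain ⟨G1, h1, h2⟩ := ES_asym
  refine ⟨G1, h1, fun G hG => ?_⟩
  obtain ⟨ξ, hξ⟩ := h2 G hG
  have hG40 := h1.trans hG
  refine ⟨ξ, ?_⟩
  by_contra! hcon
  apply hξ
  have hconv : Convex ℝ (VV G) := by
    have e : VV G = ({v | -(1/2) < v.re} ∩ {v | v.re < 1/2}) ∩ ({v | -(aG G-2) < v.im} ∩ {v | v.im < aG G - 2}) := by
      ext v; simp only [VV, mem_setOf_eq, mem_inter_iff, abs_lt]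
    rw [e]
    exact ((convex_halfSpace_re_gt _).inter (convex_halfSpace_re_lt _)).inter
      ((convex_halfSpace_im_gt _).inter (convex_halfSpace_im_lt _))
  have hf : AnalyticOnNhd ℂ (ES G ξ) (VV G) := (ES_holo hG40).analyticOnNhd (VV_open G)
  have hneg : ∀ v ∈ VV G, -v ∈ VV G := fun v hv => ⟨by simpa using hv.1, by simpa using hv.2⟩
  have hg : AnalyticOnNhd ℂ (fun v => ES G (-ξ) (-v)) (VV G) :=
    DifferentiableOn.analyticOnNhd ((ES_holo hG40 (ξ := -ξ)).comp (differentiableOn_neg _) hneg) (VV_open G)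
  have ha := aG_big hG40
  refine hf.eqOn_of_preconnected_of_frequently_eq hg hconv.isPreconnected (z₀ := ((1/4:ℝ):ℂ)) ?_ ?_ (v1_mem hG40).1
  · constructor
    · rw [Complex.ofReal_re, abs_of_pos £]; norm_num
    · rw [Complex.ofReal_im]; simp; linarith
  · have ht : Tendsto (fun n : ℕ => ((1/4 + 1/8 * (1/((n:ℝ)+1)):ℝ):ℂ)) atTop (𝓝[≠] ((1/4:ℝ):ℂ)) := by
      apply tendsto_nhdsWithin_of_tendsto_nhds_of_eventually_within
      · have := ((tendsto_one_div_add_atTop_nhds_zero_nat (𝕜 := ℝ)).const_mul (1/8)).const_add (1/4)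
        rw [mul_zero, add_zero] at this
        exact (Complex.continuous_ofReal.tendsto (1/4)).comp this
      · filter_upwards with n
        have : (0:ℝ) < 1/((n:ℝ)+1) := by positivity
        rw [mem_compl_singleton_iff]
        intro h
        rw [Complex.ofReal_inj] at h
        linarith
    refine ht.frequently (Frequently.of_forall fun n => ?_)
    have hp : (0:ℝ) < 1/((n:ℝ)+1) := by positivity
    have hle : 1/((n:ℝ)+1) ≤ 1 := by rw [div_le_one ¶]; linarith [(Nat.cast_nonneg n : (0:ℝ) ≤ n)]
    exact hcon _ § §

open Real Filter Set MeasureTheory Topology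

def cl (G r : ℝ) : ℝ := max r (G^2/4)
def F1 (G q m : ℝ) : ℝ := G^2/m^3 - m*(m^2+q)^κ₃
def FF (G t r : ℝ) : ℝ := F1 G (qq t) (cl G r)
def vf (G t : ℝ) (x : ℝ × ℝ) : ℝ × ℝ := (x.2, FF G t x.1)

lemma cl_lb (G r : ℝ) : G^2/4 ≤ cl G r := le_max_right _ _
lemma cl_pos {G : ℝ} (hG : 0 < G) (r : ℝ) : 0 < cl G r := lt_of_lt_of_le ¶ (cl_lb G r)
lemma cl_cont (G : ℝ) : Continuous (cl G) := by unfold cl; fun_prop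

lemma F1_deriv {G q m : ℝ} (hm : 0 < m) (hq : 0 ≤ q) : HasDerivAt (F1 G q)
    (-(3*G^2/m^4) - ((m^2+q)^κ₃ + m * (2*m*κ₃*(m^2+q)^(-(3:ℝ)/2-1)))) m := by
  have hp : 0 < m^2+q := by positivity
  have h1 : HasDerivAt (fun m : ℝ => m^2+q) (2*m) m := by
    simpa using (hasDerivAt_pow 2 m).add_const q
  have h2 := h1.rpow_const (p := -(3:ℝ)/2) (Or.inl hp.ne')
  have h3 := (hasDerivAt_id m).mul h2
  have h4 := (hasDerivAt_pow 3 m).inv ¶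
  have h5 := (h4.const_mul (G^2)).sub h3
  refine (h5.congr_deriv ?_).congr_of_eventuallyEq (Eventually.of_forall fun x => ?_)
  · simp only [id]
    push_cast
    field_simp
  · simp [F1, div_eq_mul_inv]

lemma rpow_up {m q c s : ℝ} (hc : 0 < c) (hm : c ≤ m) (hq : 0 ≤ q) (hs : s ≤ 0) :
    (m^2+q)^s ≤ (c^2)^s := by
  apply Real.rpow_le_rpow_of_nonpos ¶ _ hs
  nlinarith

lemma F1_lip {G : ℝ} (hG : 0 < G) : ∃ K : NNReal, 1 ≤ K ∧ ∀ q, 0 ≤ q → LipschitzOnWith K (F1 G q) (Ici (G^2/4)) := by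
  set c := G^2/4 with hc
  have hc0 : 0 < c := by positivity
  refine ⟨Real.toNNReal (1 + 3*G^2/c^4 + (c^2)^κ₃ + 3*(c^2)^κ₃), ?_, fun q hq => ?_⟩
  · rw [Real.one_le_toNNReal]
    have : 0 ≤ 3*G^2/c^4 + (c^2)^κ₃ + 3*(c^2)^κ₃ := by positivity
    linarith
  apply Convex.lipschitzOnWith_of_nnnorm_hasDerivWithin_le (convex_Ici c)
    (fun m hm => (F1_deriv (lt_of_lt_of_le hc0 hm) hq).hasDerivWithinAt)
  intro m hm
  rw [mem_Ici] at hm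
  have hm0 : 0 < m := lt_of_lt_of_le hc0 hm
  rw [← norm_toNNReal]
  apply Real.toNNReal_le_toNNReal
  have hp : 0 < m^2+q := by positivity
  have a1 : 3*G^2/m^4 ≤ 3*G^2/c^4 := by gcongr
  have a0 : 0 ≤ 3*G^2/m^4 := by positivity
  have b1 := rpow_up (s := -(3:ℝ)/2) hc0 hm hq £
  have b0 : 0 ≤ (m^2+q)^κ₃ := by positivity
  have d1 : m * (2*m*κ₃*(m^2+q)^(-(3:ℝ)/2-1)) = -3 * ((m^2/(m^2+q)) * (m^2+q)^κ₃) := by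
    rw [Real.rpow_sub_one hp.ne']; field_simp
  have d2 : m^2/(m^2+q) ≤ 1 := by rw [div_le_one hp]; linarith
  have d3 : (m^2/(m^2+q)) * (m^2+q)^κ₃ ≤ (m^2+q)^κ₃ := by
    nlinarith
  have d4 : 0 ≤ (m^2/(m^2+q)) * (m^2+q)^κ₃ := by positivity
  rw [d1, Real.norm_eq_abs, abs_le]
  constructor <;> linarith

lemma cl_lip (G : ℝ) : LipschitzWith 1 (cl G) := by
  exact (LipschitzWith.id).max_const (G^2/4)

lemma FF_lip {G : ℝ} (hG : 0 < G) : ∃ K : NNReal, ∀ t, LipschitzWith K (vf G t) := by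
  obtain ⟨K, h1, hK⟩ := F1_lip hG
  refine ⟨K, fun t => ?_⟩
  have h2 : LipschitzWith K (FF G t) := by
    have := (hK (qq t) (qq_nonneg t)).comp ((cl_lip G).lipschitzOnWith (s := univ)) (fun x _ => cl_lb G x)
    rw [mul_one, lipschitzOnWith_univ] at this
    exact this
  have h3 : LipschitzWith K (fun x : ℝ × ℝ => FF G t x.1) := by
    have := h2.comp (LipschitzWith.prod_fst (α := ℝ) (β := ℝ))
    rwa [mul_one] at this
  have h4 : LipschitzWith K (fun x : ℝ × ℝ => x.2) := LipschitzWith.prod_snd.weaken h1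
  have := h4.prodMk h3
  rwa [max_self] at this

lemma FF_bd {G : ℝ} (hG : 0 < G) : ∃ C : ℝ, 0 < C ∧ ∀ t r, |FF G t r| ≤ C := by
  set c := G^2/4 with hc
  have hc0 : 0 < c := by positivity
  refine ⟨1 + G^2/c^3 + 1/c^2, by positivity, fun t r => ?_⟩
  have hm := cl_lb G r
  rw [← hc] at hm
  unfold FF F1
  generalize cl G r = m at *
  have hm0 : 0 < m := lt_of_lt_of_le hc0 hm
  have a1 : G^2/m^3 ≤ G^2/c^3 := by gcongr
  have a0 : 0 ≤ G^2/m^3 := by positivity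
  have b1 : (m^2+qq t)^κ₃ ≤ (m^2)^κ₃ := rpow_up hm0 le_rfl (qq_nonneg t) £
  have b2 : (m^2)^κ₃ = 1/m^3 := by
    rw [← Real.rpow_natCast m 2, ← Real.rpow_mul hm0.le, ← Real.rpow_natCast m 3, one_div, ← Real.rpow_neg hm0.le]
    norm_num
  have b3 : m*(m^2+qq t)^κ₃ ≤ 1/c^2 := by
    calc _ ≤ m*(1/m^3) := by rw [← b2]; gcongr
      _ = 1/m^2 := by field_simp
      _ ≤ _ := by gcongr
  have b0 : 0 ≤ m*(m^2+qq t)^κ₃ := by have := qq_nonneg t; positivity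
  rw [abs_le]; constructor <;> linarith [show 0 < 1/c^2 by positivity, show 0 < G^2/c^3 by positivity]

lemma FF_cont {G : ℝ} (hG : 0 < G) : Continuous (fun p : ℝ × ℝ => FF G p.1 p.2) := by
  have h1 := cl_cont G
  have h2 := qq_cont
  have h3 : ∀ p : ℝ × ℝ, cl G p.2 ≠ 0 := fun p => (cl_pos hG _).ne'
  have h4 : ∀ p : ℝ × ℝ, (cl G p.2)^2 + qq p.1 ≠ 0 := fun p => by
    have := cl_pos hG p.2; have := qq_nonneg p.1; positivity
  unfold FF F1
  refine Continuous.sub (Continuous.div (by fun_prop) (by fun_prop) (fun p => pow_ne_zero _ (h3 p))) ?_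
  exact Continuous.mul (by fun_prop) (Continuous.rpow_const (by fun_prop) (fun p => Or.inl (h4 p)))

lemma vf_cont {G : ℝ} (hG : 0 < G) (x : ℝ × ℝ) : Continuous (fun t => vf G t x) := by
  have h : Continuous (fun t : ℝ => (t, x.1)) := by fun_prop
  have := (FF_cont hG).comp h
  exact continuous_const.prodMk this

lemma vf_unique {G : ℝ} (hG : 0 < G) {a b t₀ : ℝ} {f g : ℝ → ℝ × ℝ} (ht : t₀ ∈ Ioo a b)
    (hf : ∀ t ∈ Ioo a b, HasDerivAt f (vf G t (f t)) t) (hg : ∀ t ∈ Ioo a b, HasDerivAt g (vf G t (g t)) t)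
    (h : f t₀ = g t₀) : EqOn f g (Ioo a b) := by
  obtain ⟨K, hK⟩ := FF_lip hG
  exact ODE_solution_unique_of_mem_Ioo (s := fun _ => univ) (fun t _ => (hK t).lipschitzOnWith) ht
    (fun t h => ⟨hf t h, mem_univ _⟩) (fun t h => ⟨hg t h, mem_univ _⟩) h

lemma flow_loc {G : ℝ} (hG : 0 < G) (r₀ t₀ : ℝ) (n : ℕ) : ∃ α : ℝ → ℝ × ℝ, α t₀ = (r₀, 0) ∧
    ∀ t ∈ Ioo (t₀ - n) (t₀ + n), HasDerivAt α (vf G t (α t)) t := by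
  obtain ⟨C, hC0, hC⟩ := FF_bd hG
  obtain ⟨K, hK⟩ := FF_lip hG
  set Y : ℝ := C * n + 1 with hY
  have hY0 : 0 < Y := by positivity
  set f : ℝ → ℝ × ℝ → ℝ × ℝ := fun t x => vf G t (x.1, max (-Y) (min Y x.2)) with hf
  have hf1 : ∀ t x, ‖f t x‖ ≤ max Y C := by
    intro t x
    rw [Prod.norm_def]
    apply max_le_max
    · simp only [hf, vf, Real.norm_eq_abs, abs_le]
      exact ⟨le_max_left _ _, max_le § (min_le_left _ _)⟩
    · exact hC _ _
  have hclip : LipschitzWith 1 (fun x : ℝ × ℝ => (x.1, max (-Y) (min Y x.2))) := by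
    have h1 : LipschitzWith 1 (fun x : ℝ × ℝ => max (-Y) (min Y x.2)) :=
      ((LipschitzWith.prod_snd).const_min Y).const_max (-Y)
    have := LipschitzWith.prod_fst.prodMk h1
    rwa [max_self] at this
  have hP : IsPicardLindelof f (tmin := t₀ - n) (tmax := t₀ + n) ⟨t₀, by constructor <;> simp⟩ (r₀, (0:ℝ))
      (Real.toNNReal (max Y C * n)) 0 (Real.toNNReal (max Y C)) K := by
    have hM : 0 ≤ max Y C := hC0.le.trans (le_max_right _ _)
    refine ⟨fun t _ => ?_, fun x _ => ?_, fun t _ x _ => ?_, ?_⟩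
    · have := (hK t).comp hclip
      rw [mul_one] at this
      exact this.lipschitzOnWith
    · exact (vf_cont hG _).continuousOn
    · rw [Real.coe_toNNReal (max Y C) hM]; exact hf1 t x
    · rw [Real.coe_toNNReal _ hM, Real.coe_toNNReal _ (mul_nonneg hM (Nat.cast_nonneg n)), NNReal.coe_zero, sub_zero]
      apply le_of_eq
      rw [show t₀ + (n:ℝ) - t₀ = n by ring, show t₀ - (t₀ - (n:ℝ)) = n by ring, max_self]
  obtain ⟨α, h0, h1⟩ := hP.exists_eq_forall_mem_Icc_hasDerivWithinAt₀
  refine ⟨α, h0, fun t ht => ?_⟩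
  have hI : Icc (t₀ - n) (t₀ + n) ∈ 𝓝 t := Icc_mem_nhds ht.1 ht.2
  have h2 := (h1 t (Ioo_subset_Icc_self ht)).hasDerivAt hI
  have hy : |(α t).2| ≤ C * |t - t₀| := by
    have := (convex_Icc (t₀ - n) (t₀ + (n:ℝ))).norm_image_sub_le_of_norm_hasDerivWithin_le
      (f := fun t => (α t).2) (f' := fun t => FF G t (α t).1) (C := C) (x := t₀) (y := t)
      (fun s hs => (h1 s hs).snd) (fun s hs => hC _ _) (by constructor <;> simp) (Ioo_subset_Icc_self ht)
    simp only [h0, sub_zero] at this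
    exact this
  have hy2 : |(α t).2| ≤ Y := by
    refine hy.trans ?_
    have : |t - t₀| ≤ n := by rw [abs_le]; constructor <;> linarith [ht.1, ht.2]
    nlinarith
  rw [abs_le] at hy2
  have e : f t (α t) = vf G t (α t) := by
    simp only [hf]; rw [min_eq_right hy2.2, max_eq_right hy2.1]
  rw [← e]; exact h2

lemma flow_glob {G : ℝ} (hG : 0 < G) (p : ℝ × ℝ) : ∃ α : ℝ → ℝ × ℝ, α p.2 = (p.1, 0) ∧
    ∀ t, HasDerivAt α (vf G t (α t)) t := by
  obtain ⟨r₀, t₀⟩ := p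
  choose α h0 h1 using flow_loc hG r₀ t₀
  have key : ∀ (m n : ℕ) (t : ℝ), |t - t₀| < m → |t - t₀| < n → α m t = α n t := by
    intro m n t hm hn
    wlog hmn : m ≤ n generalizing m n
    · exact (this n m hn hm (le_of_not_ge hmn)).symm
    have hc : (m:ℝ) ≤ n := by exact_mod_cast hmn
    have hm0 : (0:ℝ) < m := (abs_nonneg _).trans_lt hm
    rw [abs_lt] at hm
    refine vf_unique hG (a := t₀ - m) (b := t₀ + m) (t₀ := t₀) ⟨by linarith, by linarith⟩ (h1 m) (fun s hs => h1 n s ⟨by linarith [hs.1], by linarith [hs.2]⟩) (by rw [h0, h0]) ⟨by linarith, by linarith⟩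
  have hN : ∀ t : ℝ, |t - t₀| < ((⌊|t - t₀|⌋₊ + 1 : ℕ) : ℝ) := fun t => by
    push_cast; exact Nat.lt_floor_add_one _
  refine ⟨fun t => α (⌊|t - t₀|⌋₊ + 1) t, h0 _, fun t => ?_⟩
  set m := ⌊|t - t₀|⌋₊ + 1 with hm
  have ht := hN t
  rw [← hm] at ht
  have h2 : HasDerivAt (α m) (vf G t (α m t)) t := h1 m t (by rw [abs_lt] at ht; constructor <;> linarith)
  refine h2.congr_of_eventuallyEq ?_
  have : ∀ᶠ s in 𝓝 t, |s - t₀| < m := (by fun_prop : Continuous fun s : ℝ => |s - t₀|).continuousAt.eventually (gt_mem_nhds ht)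
  filter_upwards [this] with s hs
  exact key _ _ _ (hN s) hs

open Real Filter Set MeasureTheory Topology

open Classical in
def fl (G : ℝ) (p : ℝ × ℝ) : ℝ → ℝ × ℝ :=
  if h : 0 < G then Classical.choose (flow_glob h p) else 0
def RR (G : ℝ) (p : ℝ × ℝ) (t : ℝ) : ℝ := (fl G p t).1
def YY (G : ℝ) (p : ℝ × ℝ) (t : ℝ) : ℝ := (fl G p t).2
def Sol (G : ℝ) (r y : ℝ → ℝ) : Prop := ∀ t, HasDerivAt r (y t) t ∧ HasDerivAt y (FF G t (r t)) t

section
variable {G : ℝ}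

lemma fl_spec (hG : 0 < G) (p : ℝ × ℝ) : fl G p p.2 = (p.1, 0) ∧ ∀ t, HasDerivAt (fl G p) (vf G t (fl G p t)) t := by
  have := Classical.choose_spec (flow_glob hG p)
  rw [fl, dif_pos hG]; exact this

lemma RR_sol (hG : 0 < G) (p : ℝ × ℝ) : Sol G (RR G p) (YY G p) := fun t =>
  ⟨((fl_spec hG p).2 t).fst, ((fl_spec hG p).2 t).snd⟩
lemma RR_init (hG : 0 < G) (p : ℝ × ℝ) : RR G p p.2 = p.1 := by rw [RR, (fl_spec hG p).1]
lemma YY_init (hG : 0 < G) (p : ℝ × ℝ) : YY G p p.2 = 0 := by rw [YY, (fl_spec hG p).1]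

lemma Sol.uniq (hG : 0 < G) {r y r' y' : ℝ → ℝ} (h : Sol G r y) (h' : Sol G r' y') {t₀ : ℝ} (hr : r t₀ = r' t₀)
    (hy : y t₀ = y' t₀) : r = r' ∧ y = y' := by
  have key : ∀ t, (r t, y t) = (r' t, y' t) := by
    intro t
    have := vf_unique hG (a := min t t₀ - 1) (b := max t t₀ + 1) (t₀ := t₀)
      (f := fun t => (r t, y t)) (g := fun t => (r' t, y' t))
      ⟨by linarith [min_le_right t t₀], by linarith [le_max_right t t₀]⟩
      (fun s _ => (h s).1.prodMk (h s).2) (fun s _ => (h' s).1.prodMk (h' s).2) (by simp [hr, hy])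
    exact this ⟨by linarith [min_le_left t t₀], by linarith [le_max_left t t₀]⟩
  constructor <;> ext t
  · exact congrArg Prod.fst (key t)
  · exact congrArg Prod.snd (key t)

lemma Sol.eq_RR (hG : 0 < G) {r y : ℝ → ℝ} (h : Sol G r y) {t₀ : ℝ} (hy : y t₀ = 0) :
    r = RR G (r t₀, t₀) ∧ y = YY G (r t₀, t₀) :=
  h.uniq hG (RR_sol hG _) (RR_init hG (r t₀, t₀)).symm (by rw [hy]; exact (YY_init hG (r t₀, t₀)).symm)

lemma Sol.neg {r y : ℝ → ℝ} (h : Sol G r y) : Sol G (fun t => r (-t)) (fun t => -y (-t)) := fun t => by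
  have h1 := (h (-t)).1.comp t (hasDerivAt_neg t)
  have h2 := ((h (-t)).2.comp t (hasDerivAt_neg t)).neg
  refine ⟨h1.congr_deriv (by ring), h2.congr_deriv ?_⟩
  simp only [FF, qq_even]; ring

lemma qq_int (n : ℤ) (t : ℝ) : qq (t + n * (2*π)) = qq t := qq_periodic.int_mul n t

lemma Sol.shift {r y : ℝ → ℝ} (h : Sol G r y) (n : ℤ) :
    Sol G (fun t => r (t + n * (2*π))) (fun t => y (t + n * (2*π))) := fun t => by
  have h0 : HasDerivAt (fun t : ℝ => t + n * (2*π)) 1 t := (hasDerivAt_id t).add_const _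
  have h1 := (h (t + n * (2*π))).1.comp t h0
  have h2 := (h (t + n * (2*π))).2.comp t h0
  refine ⟨h1.congr_deriv (by ring), h2.congr_deriv ?_⟩
  simp only [FF, qq_int]; ring

lemma RR_neg (hG : 0 < G) (a b t : ℝ) : RR G (a, -b) t = RR G (a, b) (-t) ∧ YY G (a, -b) t = - YY G (a, b) (-t) := by
  have h := (RR_sol hG (a, b)).neg.uniq hG (RR_sol hG (a, -b)) (t₀ := -b)
    (by rw [neg_neg]; exact (RR_init hG (a,b)).trans (RR_init hG (a,-b)).symm)
    (by rw [neg_neg, show YY G (a,b) b = 0 from YY_init hG (a,b), show YY G (a,-b) (-b) = 0 from YY_init hG (a,-b), neg_zero])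
  exact ⟨(congrFun h.1 t).symm, (congrFun h.2 t).symm⟩

lemma RR_shift (hG : 0 < G) (a b : ℝ) (n : ℤ) (t : ℝ) : RR G (a, b + n * (2*π)) (t + n * (2*π)) = RR G (a, b) t ∧
    YY G (a, b + n * (2*π)) (t + n * (2*π)) = YY G (a, b) t := by
  have h := (RR_sol hG (a, b + n*(2*π))).shift n |>.uniq hG (RR_sol hG (a, b)) (t₀ := b)
    ((RR_init hG (a,b + n * (2*π))).trans (RR_init hG (a,b)).symm)
    ((YY_init hG (a,b + n * (2*π))).trans (YY_init hG (a,b)).symm)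
  exact ⟨congrFun h.1 t, congrFun h.2 t⟩

lemma RR_re (hG : 0 < G) (p : ℝ × ℝ) {t : ℝ} (h : YY G p t = 0) : RR G (RR G p t, t) = RR G p ∧ YY G (RR G p t, t) = YY G p :=
  ⟨((RR_sol hG p).eq_RR hG h).1.symm, ((RR_sol hG p).eq_RR hG h).2.symm⟩

lemma gron (hG : 0 < G) : ∃ K : ℝ, ∀ (f g : ℝ → ℝ × ℝ), (∀ t, HasDerivAt f (vf G t (f t)) t) → (∀ t, HasDerivAt g (vf G t (g t)) t) →
    ∀ a t, dist (f t) (g t) ≤ dist (f a) (g a) * Real.exp (K * |t - a|) := by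
  obtain ⟨K, hK⟩ := FF_lip hG
  refine ⟨K, fun f g hf hg a t => ?_⟩
  rcases le_total a t with h | h
  · rw [abs_of_nonneg §]
    exact dist_le_of_trajectories_ODE hK (HasDerivAt.continuousOn fun t _ => hf t) (fun t _ => (hf t).hasDerivWithinAt)
      (HasDerivAt.continuousOn fun t _ => hg t) (fun t _ => (hg t).hasDerivWithinAt) le_rfl t ⟨h, le_rfl⟩
  · rw [abs_of_nonpos §]
    have key : ∀ f : ℝ → ℝ × ℝ, (∀ t, HasDerivAt f (vf G t (f t)) t) → ∀ t, HasDerivAt (fun t => f (-t)) (-vf G (-t) (f (-t))) t := by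
      intro f hf t
      have := (hf (-t)).scomp t (hasDerivAt_neg t)
      exact this.congr_deriv (by rw [neg_one_smul])
    have := dist_le_of_trajectories_ODE (v := fun t x => -vf G (-t) x) (fun t => (hK (-t)).neg)
      (HasDerivAt.continuousOn fun t _ => key f hf t) (fun t _ => (key f hf t).hasDerivWithinAt)
      (HasDerivAt.continuousOn fun t _ => key g hg t) (fun t _ => (key g hg t).hasDerivWithinAt) (a := -a) (b := -t) le_rfl (-t) ⟨by linarith, le_rfl⟩
    simp only [neg_neg] at this
    convert this using 3
    ring

lemma fl_cont (hG : 0 < G) : Continuous (fun z : (ℝ × ℝ) × ℝ => fl G z.1 z.2) := by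
  obtain ⟨K, hK⟩ := gron hG
  rw [continuous_iff_continuousAt]
  rintro ⟨p₀, s₀⟩
  have hc : Continuous (fl G p₀) := continuous_iff_continuousAt.2 fun t => ((fl_spec hG p₀).2 t).continuousAt
  rw [ContinuousAt, tendsto_iff_dist_tendsto_zero]
  have hb : ∀ z : (ℝ × ℝ) × ℝ, dist (fl G z.1 z.2) (fl G p₀ s₀) ≤
      dist ((z.1.1, (0:ℝ))) (fl G p₀ z.1.2) * Real.exp (K * |z.2 - z.1.2|) + dist (fl G p₀ z.2) (fl G p₀ s₀) := by
    intro z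
    refine (dist_triangle _ (fl G p₀ z.2) _).trans (add_le_add_left ?_ _)
    have := hK _ _ (fl_spec hG z.1).2 (fl_spec hG p₀).2 z.1.2 z.2
    rwa [(fl_spec hG z.1).1] at this
  refine squeeze_zero (fun _ => dist_nonneg) hb ?_
  have h1 : Continuous (fun z : (ℝ × ℝ) × ℝ => dist ((z.1.1, (0:ℝ))) (fl G p₀ z.1.2) * Real.exp (K * |z.2 - z.1.2|) + dist (fl G p₀ z.2) (fl G p₀ s₀)) := by
    have h2 : Continuous (fun z : (ℝ × ℝ) × ℝ => fl G p₀ z.1.2) := hc.comp (by fun_prop)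
    have h3 : Continuous (fun z : (ℝ × ℝ) × ℝ => fl G p₀ z.2) := hc.comp (by fun_prop)
    fun_prop
  have := h1.tendsto (p₀, s₀)
  simpa [(fl_spec hG p₀).1] using this

lemma RR_cont (hG : 0 < G) : Continuous (fun z : (ℝ × ℝ) × ℝ => RR G z.1 z.2) := continuous_fst.comp (fl_cont hG)
lemma YY_cont (hG : 0 < G) : Continuous (fun z : (ℝ × ℝ) × ℝ => YY G z.1 z.2) := continuous_snd.comp (fl_cont hG)
lemma Sol.cr {r y : ℝ → ℝ} (h : Sol G r y) : Continuous r := continuous_iff_continuousAt.2 fun t => (h t).1.continuousAt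
lemma Sol.cy {r y : ℝ → ℝ} (h : Sol G r y) : Continuous y := continuous_iff_continuousAt.2 fun t => (h t).2.continuousAt
end

open Real Filter Set MeasureTheory Topology

lemma fz {f : ℝ → ℝ} (hf : Continuous f) {a b : ℝ} (hab : a ≤ b) (ha : 0 < f a) (hb : f b ≤ 0) :
    ∃ c, a < c ∧ c ≤ b ∧ f c = 0 ∧ ∀ s, a ≤ s → s < c → 0 < f s := by
  have hK : IsCompact (Icc a b ∩ {s | f s ≤ 0}) := isCompact_Icc.inter_right (isClosed_le hf continuous_const)
  obtain ⟨c, ⟨⟨h1, h2⟩, h3⟩, h4⟩ := hK.exists_isLeast ⟨b, ⟨hab, le_rfl⟩, hb⟩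
  have h5 : ∀ s, a ≤ s → s < c → 0 < f s := fun s hs hc => by
    by_contra! hcon
    exact absurd (h4 ⟨⟨hs, hc.le.trans h2⟩, hcon⟩) (not_le.2 hc)
  have hac : a < c := by
    rcases h1.lt_or_eq with h | h
    · exact h
    · subst h; exact absurd ha (not_lt.2 h3)
  refine ⟨c, hac, h2, le_antisymm h3 ?_, h5⟩
  by_contra! hcon
  have := intermediate_value_Icc' hac.le hf.continuousOn
  obtain ⟨s, hs, hs'⟩ := this (show (f c + 0)/2 ∈ Icc (f c) (f a) from ⟨by linarith, by linarith⟩)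
  rcases hs.2.lt_or_eq with h | h
  · linarith [h5 s hs.1 h]
  · subst h; linarith

lemma lz {f : ℝ → ℝ} (hf : Continuous f) {a b : ℝ} (hab : a ≤ b) (ha : 0 ≤ f a) (hb : f b < 0) :
    ∃ c, a ≤ c ∧ c < b ∧ f c = 0 ∧ ∀ s, c < s → s ≤ b → f s < 0 := by
  obtain ⟨c, h1, h2, h3, h4⟩ := fz (f := fun s => -f (-s)) (by fun_prop) (neg_le_neg hab) (by simpa using hb) (by simpa using ha)
  refine ⟨-c, by linarith, by linarith, by linarith, fun s hs hs' => ?_⟩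
  have := h4 (-s) § §
  rw [neg_neg] at this; linarith

lemma dsign {f : ℝ → ℝ} {d c : ℝ} (hf : HasDerivAt f d c) (h0 : f c = 0) (hd : 0 < d) :
    ∃ ε > 0, (∀ s, c < s → s < c + ε → 0 < f s) ∧ (∀ s, c - ε < s → s < c → f s < 0) := by
  have := eventually_nhdsWithin_sign_eq_of_deriv_pos (f := f) (x₀ := c) (by rwa [hf.deriv]) h0
  obtain ⟨ε, hε, h⟩ := Metric.eventually_nhds_iff.1 this
  refine ⟨ε, hε, fun s h1 h2 => ?_, fun s h1 h2 => ?_⟩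
  · have := h (y := s) (by rw [Real.dist_eq, abs_of_pos §]; linarith)
    rwa [sign_pos (sub_pos.2 h1), sign_eq_one_iff] at this
  · have := h (y := s) (by rw [Real.dist_eq, abs_of_neg §]; linarith)
    rwa [sign_neg (sub_neg.2 h2), sign_eq_neg_one_iff] at this

lemma dsign' {f : ℝ → ℝ} {d c : ℝ} (hf : HasDerivAt f d c) (h0 : f c = 0) (hd : d < 0) :
    ∃ ε > 0, (∀ s, c < s → s < c + ε → f s < 0) ∧ (∀ s, c - ε < s → s < c → 0 < f s) := by
  obtain ⟨ε, h1, h2, h3⟩ := dsign hf.neg (by simp [h0]) (neg_pos.2 hd)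
  exact ⟨ε, h1, fun s a b => by simpa using h2 s a b, fun s a b => by simpa using h3 s a b⟩

lemma mono_of {f f' : ℝ → ℝ} {a b : ℝ} (hab : a ≤ b) (h : ∀ s ∈ Icc a b, HasDerivAt f (f' s) s) (h' : ∀ s ∈ Icc a b, 0 ≤ f' s) :
    f a ≤ f b := by
  have := monotoneOn_of_deriv_nonneg (convex_Icc a b) (f := f) (HasDerivAt.continuousOn h)
    (fun s hs => ((h s (interior_subset hs)).differentiableAt).differentiableWithinAt)
    (fun s hs => by rw [(h s (interior_subset hs)).deriv]; exact h' s (interior_subset hs))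
  exact this ⟨le_rfl, hab⟩ ⟨hab, le_rfl⟩ hab

lemma anti_of {f f' : ℝ → ℝ} {a b : ℝ} (hab : a ≤ b) (h : ∀ s ∈ Icc a b, HasDerivAt f (f' s) s) (h' : ∀ s ∈ Icc a b, f' s ≤ 0) :
    f b ≤ f a := by
  have := mono_of hab (f := fun s => -f s) (f' := fun s => -f' s) (fun s hs => (h s hs).neg) (fun s hs => by linarith [h' s hs])
  linarith

lemma grow {f f' : ℝ → ℝ} {T ε : ℝ} (hε : 0 < ε) (h : ∀ t ≥ T, HasDerivAt f (f' t) t) (h' : ∀ t ≥ T, ε ≤ f' t) :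
    Tendsto f atTop atTop := by
  have key : ∀ t ≥ T, f T + ε * (t - T) ≤ f t := by
    intro t ht
    have := mono_of (f := fun s => f s - ε * (s - T)) (f' := fun s => f' s - ε) ht
      (fun s hs => by
        have h1 : HasDerivAt (fun s => ε * (s - T)) ε s := by
          simpa using ((hasDerivAt_id s).sub_const T).const_mul ε
        exact (h s hs.1).sub h1)
      (fun s hs => by linarith [h' s hs.1])
    simp only [sub_self, mul_zero, sub_zero] at this
    linarith
  refine tendsto_atTop_mono' _ (eventually_atTop.2 ⟨T, key⟩) ?_
  exact tendsto_atTop_add_const_left _ _ ((tendsto_atTop_add_const_right _ _ tendsto_id).const_mul_atTop hε)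

def eh (q m : ℝ) : ℝ := 1/m^2 - m*(m^2+q)^κ₃

lemma sq_rpow {m : ℝ} (hm : 0 < m) : (m^2)^κ₃ = 1/m^3 := by
  rw [← Real.rpow_natCast m 2, ← Real.rpow_mul hm.le, ← Real.rpow_natCast m 3, one_div, ← Real.rpow_neg hm.le]
  norm_num

lemma eh_eq {q m : ℝ} (hm : 0 < m) (hq : 0 ≤ q) : eh q m = (1 - (1 + q/m^2)^κ₃)/m^2 := by
  have : m^2 + q = m^2 * (1 + q/m^2) := by field_simp
  rw [eh, this, Real.mul_rpow ¶ ¶, sq_rpow hm]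
  field_simp

lemma eh_bd {q m : ℝ} (hm : 0 < m) (hq : 0 ≤ q) (hq1 : q ≤ 1) : 0 ≤ eh q m ∧ eh q m ≤ 3/2/m^4 := by
  rw [eh_eq hm hq]
  have hx : 0 ≤ q/m^2 := by positivity
  have h1 : (1 + q/m^2)^κ₃ ≤ 1 := Real.rpow_le_one_of_one_le_of_nonpos § £
  have h2 : 1 + κ₃ * (q/m^2) ≤ (1 + q/m^2)^κ₃ := by
    have e1 : (Real.exp (q/m^2))^κ₃ ≤ (1 + q/m^2)^κ₃ :=
      Real.rpow_le_rpow_of_nonpos § (by linarith [Real.add_one_le_exp (q/m^2)]) £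
    rw [← Real.exp_mul] at e1
    linarith [Real.add_one_le_exp (q/m^2*κ₃)]
  constructor
  · apply div_nonneg § ¶
  · rw [div_le_iff₀ ¶]
    have : 3/2/m^4*m^2 = 3/2 * (1/m^2) := by field_simp
    have h3 : q/m^2 ≤ 1/m^2 := by gcongr
    rw [this]; linarith

lemma F1_eq (G q m : ℝ) : F1 G q m = G^2/m^3 - 1/m^2 + eh q m := by unfold F1 eh; ring

section
variable {G : ℝ}
lemma FF_eq {t r : ℝ} (h : G^2/4 ≤ r) : FF G t r = G^2/r^3 - 1/r^2 + eh (qq t) r := by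
  rw [FF, cl, max_eq_left h, F1_eq]

lemma FF_pos (hG : 0 < G) {t r : ℝ} (h : r < G^2) : 0 < FF G t r := by
  rw [FF, F1_eq]
  have hm := cl_pos hG r
  have h1 : cl G r < G^2 := max_lt h (by nlinarith [sq_pos_of_pos hG])
  have h2 := (eh_bd hm (qq_nonneg t) (qq_le t)).1
  have h3 : G^2/(cl G r)^3 - 1/(cl G r)^2 = (G^2 - cl G r)/(cl G r)^3 := by field_simp
  have : 0 < (G^2 - cl G r)/(cl G r)^3 := div_pos § ¶
  linarith

lemma FF_le {t r : ℝ} (hG : 2 ≤ G) (h : G^2/4 ≤ r) : FF G t r ≤ (G^2 - r + 3/2/r)/r^3 := by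
  rw [FF_eq h]
  have hm : 0 < r := lt_of_lt_of_le ¶ h
  have h2 := (eh_bd hm (qq_nonneg t) (qq_le t)).2
  have h3 : (G^2 - r + 3/2/r)/r^3 = G^2/r^3 - 1/r^2 + 3/2/r^4 := by field_simp
  linarith

lemma FF_neg {t r : ℝ} (hG : 2 ≤ G) (h : G^2 + 1 ≤ r) : FF G t r < 0 := by
  have hr : 4 ≤ r := by nlinarith
  refine (FF_le hG (by nlinarith)).trans_lt (div_neg_of_neg_of_pos ?_ ¶)
  have : 3/2/r ≤ 3/2/4 := by gcongr
  linarith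

def uu (G r : ℝ) : ℝ := G^2/(2*r^2) - 1/r
def hh (G : ℝ) (r y : ℝ → ℝ) (t : ℝ) : ℝ := y t^2/2 + uu G (r t)
def kk (G : ℝ) (r y : ℝ → ℝ) (t : ℝ) : ℝ := hh G r y t + 1/(2*r t^3)

lemma hh_deriv (hG : 0 < G) {r y : ℝ → ℝ} (h : Sol G r y) {t : ℝ} (hr : G^2/4 ≤ r t) :
    HasDerivAt (hh G r y) (y t * eh (qq t) (r t)) t := by
  have hm : 0 < r t := lt_of_lt_of_le ¶ hr
  obtain ⟨h1, h2⟩ := h t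
  have a1 := (h2.pow 2).div_const 2
  have a2 := ((h1.pow 2).inv (pow_ne_zero 2 hm.ne')).const_mul (G^2/2)
  have a3 := h1.inv hm.ne'
  refine ((a1.add (a2.sub a3)).congr_deriv ?_).congr_of_eventuallyEq (Eventually.of_forall fun s => ?_)
  · rw [FF_eq hr]
    push_cast
    simp only [Pi.pow_apply]
    field_simp
    ring
  · simp only [hh, uu, Pi.add_apply, Pi.sub_apply, Pi.pow_apply, Pi.inv_apply]
    ring

lemma kk_deriv (hG : 0 < G) {r y : ℝ → ℝ} (h : Sol G r y) {t : ℝ} (hr : G^2/4 ≤ r t) :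
    HasDerivAt (kk G r y) (y t * (eh (qq t) (r t) - 3/2/r t^4)) t := by
  have hm : 0 < r t := lt_of_lt_of_le ¶ hr
  have a2 := (((h t).1.pow 3).inv (pow_ne_zero 3 hm.ne')).const_mul (1/2)
  refine (((hh_deriv hG h hr).add a2).congr_deriv ?_).congr_of_eventuallyEq (Eventually.of_forall fun s => ?_)
  · push_cast
    simp only [Pi.pow_apply]
    field_simp
    ring
  · simp only [kk, Pi.add_apply, Pi.pow_apply, Pi.inv_apply]
    field_simp

lemma uu_neg {r : ℝ} (hr : 0 < r) (h : uu G r < 0) : G^2/2 < r := by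
  have : uu G r = (G^2 - 2*r)/(2*r^2) := by unfold uu; field_simp
  rw [this, div_neg_iff] at h
  rcases h with ⟨_, h⟩ | ⟨h, _⟩
  · nlinarith [sq_nonneg r]
  · linarith

lemma uu_eq {r : ℝ} (hr : 0 < r) : uu G r = (G^2 - 2*r)/(2*r^2) := by unfold uu; field_simp

lemma safe_fwd (hG : 2 ≤ G) {r y : ℝ → ℝ} (h : Sol G r y) {t₀ : ℝ} (hy : y t₀ = 0) (hr : 2/5*G^2 ≤ r t₀) :
    ∀ t ≥ t₀, 2/5*G^2 ≤ r t := by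
  by_contra! hcon
  obtain ⟨t, ht, hlt⟩ := hcon
  have hG0 : 0 < G := by linarith
  have hGG : 0 < G^2 := by positivity

  obtain ⟨s0, h1, h2, h3, h4⟩ := lz (f := fun s => r s - 2/5*G^2) (by have := h.cr; fun_prop) ht § §
  obtain ⟨t', ht', he⟩ := exists_hasDerivAt_eq_slope r y h2 h.cr.continuousOn (fun s _ => (h s).1)
  have hy' : y t' < 0 := by
    rw [he]; exact div_neg_of_neg_of_pos § §
  have hr' := h4 t' ht'.1 ht'.2.le
  obtain ⟨s, k1, k2, k3, k4⟩ := lz h.cy (h1.trans ht'.1.le) hy.ge hy'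
  have hs : G^2 ≤ r s := by
    by_contra! hc
    obtain ⟨ε, hε, e1, _⟩ := dsign (h s).2 k3 (FF_pos hG0 hc)
    have m1 : s < min (s + ε/2) t' := lt_min § k2
    have := e1 _ m1 (by linarith [min_le_left (s+ε/2) t'])
    linarith [k4 _ m1 (min_le_right _ _)]
  obtain ⟨s1, hs1, hs1'⟩ := intermediate_value_Icc' k2.le h.cr.continuousOn (show 9/20*G^2 ∈ Icc (r t') (r s) from ⟨by linarith, by linarith⟩)
  have hle : ∀ x ∈ Icc s s1, G^2/4 ≤ r x := fun x hx => by
    have : r s1 ≤ r x := anti_of hx.2 (fun z _ => (h z).1) (fun z hz => by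
      rcases (hx.1.trans hz.1).lt_or_eq with e | e
      · exact (k4 z e (hz.2.trans hs1.2)).le
      · rw [← e, k3])
    linarith
  have hlast : hh G r y s1 ≤ hh G r y s := anti_of hs1.1 (fun z hz => hh_deriv hG0 h (hle z hz)) (fun z hz => by
    have hz0 : 0 < r z := lt_of_lt_of_le ¶ (hle z hz)
    refine mul_nonpos_of_nonpos_of_nonneg ?_ (eh_bd hz0 (qq_nonneg z) (qq_le z)).1
    rcases hz.1.lt_or_eq with e | e
    · exact (k4 z e (hz.2.trans hs1.2)).le
    · rw [← e, k3])
  have b1 : hh G r y s < 0 := by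
    rw [hh, k3, uu_eq §]
    have : (G^2 - 2*r s)/(2*r s^2) < 0 := div_neg_of_neg_of_pos § (by have : 0 < r s := §; positivity)
    linarith
  have b2 : 0 < hh G r y s1 := by
    rw [hh, hs1', uu_eq ¶]
    have : 0 < (G^2 - 2*(9/20*G^2))/(2*(9/20*G^2)^2) := div_pos § ¶
    positivity
  linarith

structure SS (G : ℝ) (r y : ℝ → ℝ) : Prop where
  sol : Sol G r y
  lb : ∀ t, 2/5*G^2 ≤ r t

lemma safe (hG : 2 ≤ G) {r y : ℝ → ℝ} (h : Sol G r y) {t₀ : ℝ} (hy : y t₀ = 0) (hr : 2/5*G^2 ≤ r t₀) : SS G r y := by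
  refine ⟨h, fun t => ?_⟩
  rcases le_total t₀ t with ht | ht
  · exact safe_fwd hG h hy hr t ht
  · have := safe_fwd hG h.neg (t₀ := -t₀) (by simp [hy]) (by simpa using hr) (-t) §
    simpa using this

lemma SS.neg {r y : ℝ → ℝ} (h : SS G r y) : SS G (fun t => r (-t)) (fun t => -y (-t)) := ⟨h.sol.neg, fun t => h.lb _⟩

lemma SS.pos {r y : ℝ → ℝ} (hG : 0 < G) (h : SS G r y) (t : ℝ) : 0 < r t := lt_of_lt_of_le ¶ (h.lb t)
lemma SS.lb' {r y : ℝ → ℝ} (h : SS G r y) (t : ℝ) : G^2/4 ≤ r t := le_trans (by nlinarith [sq_nonneg G]) (h.lb t)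

lemma SS.h_up {r y : ℝ → ℝ} (hG : 0 < G) (h : SS G r y) {a b : ℝ} (hab : a ≤ b) (hy : ∀ s ∈ Icc a b, 0 ≤ y s) :
    hh G r y a ≤ hh G r y b ∧ kk G r y b ≤ kk G r y a ∧ r a ≤ r b :=
  ⟨mono_of hab (fun z _ => hh_deriv hG h.sol (h.lb' z)) (fun z hz => mul_nonneg (hy z hz) (eh_bd (h.pos hG z) (qq_nonneg z) (qq_le z)).1),
   anti_of hab (fun z _ => kk_deriv hG h.sol (h.lb' z)) (fun z hz => mul_nonpos_of_nonneg_of_nonpos (hy z hz)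
    (by linarith [(eh_bd (h.pos hG z) (qq_nonneg z) (qq_le z)).2])),
   mono_of hab (fun z _ => (h.sol z).1) hy⟩

lemma hh_neg (r y : ℝ → ℝ) (t : ℝ) : hh G (fun t => r (-t)) (fun t => -y (-t)) t = hh G r y (-t) := by simp [hh]
lemma kk_neg (r y : ℝ → ℝ) (t : ℝ) : kk G (fun t => r (-t)) (fun t => -y (-t)) t = kk G r y (-t) := by simp [kk, hh]

lemma SS.h_dn {r y : ℝ → ℝ} (hG : 0 < G) (h : SS G r y) {a b : ℝ} (hab : a ≤ b) (hy : ∀ s ∈ Icc a b, y s ≤ 0) :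
    hh G r y b ≤ hh G r y a ∧ kk G r y a ≤ kk G r y b ∧ r b ≤ r a := by
  have := h.neg.h_up hG (neg_le_neg hab) (fun s hs => by
    have := hy (-s) ⟨by linarith [hs.2], by linarith [hs.1]⟩; linarith)
  simpa only [hh_neg, kk_neg, neg_neg] using this
end

open Real Filter Set MeasureTheory Topology

section
variable {G : ℝ}

lemma uu_z (hG : 0 < G) {r : ℝ} (hr : 0 < r) : uu G r = ((G^2/r - 1)^2 - 1)/(2*G^2) := by
  unfold uu; field_simp; ring

lemma z_le (hG : 0 < G) {r a : ℝ} (hr : 0 < r) (ha : 0 < a) : a * G^2 ≤ r ↔ G^2/r ≤ 1/a := by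
  rw [div_le_div_iff₀ hr ha]; constructor <;> intro h <;> linarith
lemma z_ge (hG : 0 < G) {r a : ℝ} (hr : 0 < r) (ha : 0 < a) : r ≤ a * G^2 ↔ 1/a ≤ G^2/r := by
  rw [div_le_div_iff₀ ha hr]; constructor <;> intro h <;> linarith

lemma uu_lb (hG : 0 < G) {r : ℝ} (hr : 0 < r) (h : r ≤ 4/5*G^2) : -(15/32)/G^2 ≤ uu G r := by
  rw [uu_z hG hr, div_le_div_iff₀ ¶ ¶]
  rw [z_ge hG hr £] at h
  norm_num at h
  nlinarith [show 0 < G^2 by positivity, show 0 ≤ (G^2/r - 5/4)*(G^2/r - 1 + 1/4) by apply mul_nonneg <;> linarith]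

lemma uu_lb2 (hG : 0 < G) {r : ℝ} (hr : 0 < r) (h : r ≤ 3/4*G^2) : -(4/9)/G^2 ≤ uu G r := by
  rw [uu_z hG hr, div_le_div_iff₀ ¶ ¶]
  rw [z_ge hG hr £] at h
  norm_num at h
  nlinarith [show 0 < G^2 by positivity, show 0 ≤ (G^2/r - 4/3)*(G^2/r - 1 + 1/3) by apply mul_nonneg <;> linarith]

lemma uu_ub (hG : 0 < G) {r : ℝ} (hr : 0 < r) (h : 4/5*G^2 ≤ r) (h' : r ≤ 5/4*G^2) : uu G r ≤ -(15/32)/G^2 := by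
  rw [uu_z hG hr, div_le_div_iff₀ ¶ ¶]
  rw [z_le hG hr £] at h
  rw [z_ge hG hr £] at h'
  norm_num at h h'
  nlinarith [show 0 < G^2 by positivity, show 0 ≤ (5/4 - G^2/r)*(G^2/r - 1 + 1/4) by apply mul_nonneg <;> linarith]

lemma uu_mid (hG : 0 < G) {r : ℝ} (hr : 0 < r) (h : 5/6*G^2 ≤ r) (h' : r ≤ 5/4*G^2) : uu G r ≤ -(12/25)/G^2 := by
  rw [uu_z hG hr, div_le_div_iff₀ ¶ ¶]
  rw [z_le hG hr £] at h
  rw [z_ge hG hr £] at h'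
  norm_num at h h'
  nlinarith [show 0 < G^2 by positivity, show 0 ≤ (6/5 - G^2/r)*(G^2/r - 1 + 1/5) by apply mul_nonneg <;> linarith]

lemma uu_far (hG : 0 < G) {r : ℝ} (hr : 0 < r) (h : -(47/100)/G^2 ≤ uu G r) : r ≤ 5/6*G^2 ∨ 5/4*G^2 ≤ r := by
  by_contra! hc
  have := uu_mid hG hr hc.1.le hc.2.le
  have h2 : -(12/25)/G^2 < -(47/100)/G^2 := by
    rw [div_lt_div_iff_of_pos_right ¶]; norm_num
  linarith

lemma no_bdd (hG : 10 ≤ G) {r y : ℝ → ℝ} (h : SS G r y) {T R : ℝ} (hh1 : ∀ t ≥ T, -(47/100)/G^2 ≤ hh G r y t)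
    (hR : ∀ t ≥ T, r t ≤ R) (hs : (∀ t ≥ T, 0 ≤ y t) ∨ (∀ t ≥ T, y t ≤ 0)) : False := by
  have hG0 : 0 < G := by linarith
  have hGG : 0 < G^2 := by positivity
  have up : ∀ T' ≥ T, ∀ ε > 0, (∀ t ≥ T', ε ≤ y t) → False := by
    intro T' hT ε hε hy
    have := grow hε (fun t _ => (h.sol t).1) hy
    obtain ⟨t, h1, h2⟩ := ((this.eventually_gt_atTop R).and (eventually_ge_atTop T')).exists
    linarith [hR t (hT.trans h2)]
  have dn : ∀ T' ≥ T, ∀ ε > 0, (∀ t ≥ T', y t ≤ -ε) → False := by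
    intro T' hT ε hε hy
    have := grow (f := fun t => - r t) hε (fun t _ => (h.sol t).1.neg) (fun t ht => by linarith [hy t ht])
    obtain ⟨t, h1⟩ := (this.eventually_gt_atTop 0).exists
    linarith [h.pos hG0 t]

  have z1 : ∀ T' ≥ T, (∀ t ≥ T', r t ≤ 5/6*G^2) → False := by
    intro T' hT hz
    have hF : ∀ t ≥ T', (G^2/6)/(G^2)^3 ≤ FF G t (r t) := by
      intro t ht
      have hp := h.pos hG0 t
      rw [FF_eq (h.lb' t)]
      have e := (eh_bd hp (qq_nonneg t) (qq_le t)).1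
      have e2 : G^2/r t^3 - 1/r t^2 = (G^2 - r t)/r t^3 := by field_simp
      have e3 : (G^2/6)/(G^2)^3 ≤ (G^2 - r t)/r t^3 := by
        have := hz t ht
        apply div_le_div₀ § § ¶
        gcongr; linarith
      linarith
    have := grow ¶ (fun t _ => (h.sol t).2) hF
    obtain ⟨T2, h2⟩ := eventually_atTop.1 (this.eventually_ge_atTop 1)
    exact up (max T' T2) (le_max_of_le_left hT) 1 one_pos (fun t ht => h2 t ((le_max_right _ _).trans ht))
  have z3 : ∀ T' ≥ T, (∀ t ≥ T', 9/8*G^2 ≤ r t) → False := by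
    intro T' hT hz
    have hR0 : 0 < R := (h.pos hG0 T).trans_le (hR T le_rfl)
    have hF : ∀ t ≥ T', 1/R^3 ≤ -FF G t (r t) := by
      intro t ht
      have hp := h.pos hG0 t
      have e1 := FF_le (t := t) § (h.lb' t)
      have e0 := hz t ht
      have e2 : 3/2/r t ≤ 1 := by rw [div_le_one hp]; nlinarith
      have e3 : 1/R^3 ≤ -((G^2 - r t + 3/2/r t)/r t^3) := by
        rw [← neg_div]
        have := hR t (hT.trans ht)
        apply div_le_div₀ (by nlinarith) (by nlinarith) ¶
        gcongr
      linarith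
    have := grow (f := fun t => - y t) ¶ (fun t _ => (h.sol t).2.neg) hF
    obtain ⟨T2, h2⟩ := eventually_atTop.1 (this.eventually_ge_atTop 1)
    exact dn (max T' T2) (le_max_of_le_left hT) 1 one_pos (fun t ht => by linarith [h2 t ((le_max_right _ _).trans ht)])
  have z2 : ∀ T' ≥ T, (∀ t ≥ T', 5/6*G^2 ≤ r t ∧ r t ≤ 9/8*G^2) → False := by
    intro T' hT hz
    have hy : ∀ t ≥ T', (1/(10*G))^2 ≤ y t^2 := by
      intro t ht
      have e1 := hh1 t (hT.trans ht)
      have e2 := uu_mid hG0 (h.pos hG0 t) (hz t ht).1 (by linarith [(hz t ht).2])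
      unfold hh at e1
      have e3 : (1/(10*G))^2 = 1/100/G^2 := by field_simp; norm_num
      have e4 : -(47/100)/G^2 - -(12/25)/G^2 = 1/100/G^2 := by ring
      have e5 : 0 < 1/100/G^2 := by positivity
      linarith
    have hε : 0 < 1/(10*G) := by positivity
    rcases hs with hs | hs
    · exact up T' hT _ hε (fun t ht => by
        exact (pow_le_pow_iff_left₀ hε.le (hs t (hT.trans ht)) two_ne_zero).1 (hy t ht))
    · exact dn T' hT _ hε (fun t ht => by
        have := (pow_le_pow_iff_left₀ hε.le (neg_nonneg.2 (hs t (hT.trans ht))) two_ne_zero).1 (by rw [neg_sq]; exact hy t ht)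
        linarith)
  by_cases c1 : ∀ t ≥ T, r t ≤ 5/6*G^2
  · exact z1 T le_rfl c1
  by_cases c3 : ∀ t ≥ T, 9/8*G^2 ≤ r t
  · exact z3 T le_rfl c3
  push Not at c1 c3
  obtain ⟨T1, t1, h1⟩ := c1
  obtain ⟨T3, t3, h3⟩ := c3
  rcases hs with hs | hs
  · have hm : ∀ a b, T ≤ a → a ≤ b → r a ≤ r b := fun a b ha hab => (h.h_up hG0 hab (fun s hs' => hs s (ha.trans hs'.1))).2.2
    by_cases c : ∀ t ≥ T1, r t ≤ 9/8*G^2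
    · exact z2 T1 t1 (fun t ht => ⟨h1.le.trans (hm _ _ t1 ht), c t ht⟩)
    · push Not at c
      obtain ⟨T2, t2, h2⟩ := c
      exact z3 T2 (t1.trans t2) (fun t ht => h2.le.trans (hm _ _ (t1.trans t2) ht))
  · have hm : ∀ a b, T ≤ a → a ≤ b → r b ≤ r a := fun a b ha hab => (h.h_dn hG0 hab (fun s hs' => hs s (ha.trans hs'.1))).2.2
    by_cases c : ∀ t ≥ T3, 5/6*G^2 ≤ r t
    · exact z2 T3 t3 (fun t ht => ⟨c t ht, (hm _ _ t3 ht).trans h3.le⟩)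
    · push Not at c
      obtain ⟨T2, t2, h2⟩ := c
      exact z1 T2 (t3.trans t2) (fun t ht => (hm _ _ (t3.trans t2) ht).trans h2.le)
end

open Real Filter Set MeasureTheory Topology

section
variable {G : ℝ}

lemma zero_pos (hG : 10 ≤ G) {r y : ℝ → ℝ} (h : SS G r y) {c : ℝ} (hy : y c = 0) (hr : r c < G^2) :
    ∃ ε > 0, (∀ s, c < s → s < c + ε → 0 < y s) ∧ (∀ s, c - ε < s → s < c → y s < 0) :=
  dsign (h.sol c).2 hy (FF_pos § hr)

lemma zero_neg (hG : 10 ≤ G) {r y : ℝ → ℝ} (h : SS G r y) {c : ℝ} (hy : y c = 0) (hr : 5/4*G^2 ≤ r c) :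
    ∃ ε > 0, (∀ s, c < s → s < c + ε → y s < 0) ∧ (∀ s, c - ε < s → s < c → 0 < y s) :=
  dsign' (h.sol c).2 hy (FF_neg § (by nlinarith))

lemma hh_zero {r y : ℝ → ℝ} {c : ℝ} (hy : y c = 0) : hh G r y c = uu G (r c) := by simp [hh, hy]

lemma zero_far (hG : 10 ≤ G) {r y : ℝ → ℝ} (h : SS G r y) {c : ℝ} (hy : y c = 0) (hc : -(47/100)/G^2 ≤ hh G r y c) :
    r c ≤ 5/6*G^2 ∨ 5/4*G^2 ≤ r c := by
  rw [hh_zero hy] at hc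
  exact uu_far § (h.pos § c) hc

lemma c47 (hG : 10 ≤ G) : -(47/100)/G^2 ≤ -(15/32)/G^2 := by
  rw [div_le_div_iff_of_pos_right ¶]; norm_num

lemma uu_tendsto {r : ℝ → ℝ} (h : Tendsto r atTop atTop) : Tendsto (fun t => uu G (r t)) atTop (𝓝 0) := by
  have h1 := tendsto_inv_atTop_zero.comp h
  have := ((h1.mul h1).const_mul (G^2/2)).sub h1
  simp only [mul_zero, sub_zero] at this
  refine this.congr fun t => ?_
  simp only [Function.comp, uu]
  by_cases h0 : r t = 0
  · simp [h0]
  · field_simp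

lemma r3_tendsto {r : ℝ → ℝ} (h : Tendsto r atTop atTop) : Tendsto (fun t => 1/(2*r t^3)) atTop (𝓝 0) := by
  have h1 := tendsto_inv_atTop_zero.comp h
  have := ((h1.pow 3).const_mul (1/2))
  rw [zero_pow £, mul_zero] at this
  refine this.congr fun t => ?_
  simp only [Function.comp]
  by_cases h0 : r t = 0
  · simp [h0]
  · field_simp

lemma esc (hG : 10 ≤ G) {r y : ℝ → ℝ} (h : SS G r y) {T : ℝ} (hy : ∀ t ≥ T, 0 ≤ y t) (h0 : -(47/100)/G^2 ≤ hh G r y T) :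
    Tendsto r atTop atTop ∧ ∃ L, 0 ≤ L ∧ Tendsto y atTop (𝓝 (√(2*L))) ∧ ∀ t ≥ T, hh G r y t ≤ L ∧ L ≤ kk G r y t := by
  have hG0 : 0 < G := by linarith
  have up : ∀ a b, T ≤ a → a ≤ b → hh G r y a ≤ hh G r y b ∧ kk G r y b ≤ kk G r y a ∧ r a ≤ r b :=
    fun a b ha hab => h.h_up hG0 hab (fun s hs => hy s (ha.trans hs.1))
  have hr : Tendsto r atTop atTop := by
    refine tendsto_atTop.2 fun R => ?_
    by_contra hcon
    have : ∀ t ≥ T, r t ≤ R := by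
      intro t ht
      by_contra! hR
      exact hcon ((eventually_ge_atTop t).mono fun s hs => hR.le.trans (up t s ht hs).2.2)
    exact no_bdd hG h (fun t ht => h0.trans (up T t le_rfl ht).1) this (Or.inl hy)
  have hk : ∀ t, hh G r y t ≤ kk G r y t := fun t => by
    have := h.pos hG0 t
    have : 0 ≤ 1/(2*r t^3) := by positivity
    unfold kk; linarith
  have hm : Monotone (fun t => hh G r y (max t T)) := fun a b hab => (up _ _ (le_max_right _ _) (max_le_max_right _ hab)).1
  obtain ⟨L, hL⟩ : ∃ L, Tendsto (hh G r y) atTop (𝓝 L) := by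
    rcases tendsto_atTop_of_monotone hm with h1 | ⟨L, h1⟩
    · obtain ⟨t, ht⟩ := (h1.eventually_gt_atTop (kk G r y T)).exists
      have := (hk (max t T)).trans (up T _ le_rfl (le_max_right t T)).2.1
      linarith
    · exact ⟨L, h1.congr' ((eventually_ge_atTop T).mono fun t ht => by simp only [max_eq_left ht])⟩
  have hy2 : Tendsto (fun t => y t^2) atTop (𝓝 (2*L)) := by
    have := (hL.sub (uu_tendsto (G := G) hr)).const_mul 2
    rw [sub_zero] at this
    exact this.congr fun t => by unfold hh; ring
  have hL0 : 0 ≤ L := by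
    have := ge_of_tendsto' hy2 (fun t => sq_nonneg (y t))
    linarith
  refine ⟨hr, L, hL0, ?_, fun t ht => ⟨?_, ?_⟩⟩
  · refine ((Real.continuous_sqrt.tendsto _).comp hy2).congr' ((eventually_ge_atTop T).mono fun t ht => ?_)
    simp only [Function.comp]
    exact Real.sqrt_sq (hy t ht)
  · exact ge_of_tendsto hL ((eventually_ge_atTop t).mono fun s hs => (up t s ht hs).1)
  · exact le_of_tendsto hL ((eventually_ge_atTop t).mono fun s hs => (hk s).trans (up t s ht hs).2.1)

lemma up_pos (hG : 10 ≤ G) {r y : ℝ → ℝ} (h : SS G r y) {t₀ : ℝ} (hr : r t₀ ≤ 4/5*G^2) (hy0 : y t₀ = 0)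
    (hy : ∀ s > t₀, 0 ≤ y s) : ∀ s > t₀, 0 < y s := by
  have hG0 : 0 < G := by linarith
  have hGG : 0 < G^2 := by positivity
  intro s hs
  refine lt_of_le_of_ne (hy s hs) fun h0 => ?_
  have hy' : ∀ s ≥ t₀, 0 ≤ y s := fun s hs => by
    rcases eq_or_lt_of_le hs with h1 | h1
    · rw [← h1, hy0]
    · exact hy s h1
  have h1 := (h.h_up hG0 hs.le (fun z hz => hy' z hz.1)).1
  rw [hh_zero hy0] at h1
  have h2 := uu_lb hG0 (h.pos hG0 _) hr
  rcases zero_far hG h h0.symm (by linarith [c47 hG]) with h3 | h3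
  · obtain ⟨ε, he, _, h4⟩ := zero_pos hG h h0.symm §
    have := h4 (max ((t₀+s)/2) (s - ε/2)) (lt_max_of_lt_right §) (max_lt § §)
    linarith [hy (max ((t₀+s)/2) (s - ε/2)) (lt_max_of_lt_left §)]
  · obtain ⟨ε, he, h4, _⟩ := zero_neg hG h h0.symm h3
    have := h4 (s+ε/2) § §
    linarith [hy (s+ε/2) §]

lemma hyp_pos (hG : 10 ≤ G) {r y : ℝ → ℝ} (h : SS G r y) {t : ℝ} (hr : G^2/2 < r t) (hy0 : 0 < y t)
    (hp : 0 < hh G r y t) : ∀ s ≥ t, 0 < y s := by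
  have hG0 : 0 < G := by linarith
  have hGG : 0 < G^2 := by positivity
  by_contra! hcon
  obtain ⟨s, hs, hs0⟩ := hcon
  obtain ⟨c, h1, h2, h3, h4⟩ := fz h.sol.cy hs hy0 hs0
  have h5 := h.h_up hG0 h1.le (fun z hz => by
    rcases eq_or_lt_of_le hz.2 with e | e
    · rw [e, h3]
    · exact (h4 z hz.1 e).le)
  rw [hh_zero h3, uu_eq (h.pos hG0 c)] at h5
  have h6 : 0 < (G^2 - 2*r c)/(2*r c^2) := by linarith [h5.1]
  have := h.pos hG0 c
  rw [div_pos_iff_of_pos_right ¶] at h6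
  linarith [h5.2.2]

lemma hyp_small (hG : 10 ≤ G) {r y : ℝ → ℝ} (h : SS G r y) {t₀ : ℝ} (hr : r t₀ < G^2/2) (hy0 : y t₀ = 0) :
    0 < hh G r y t₀ ∧ ∀ s > t₀, 0 < y s := by
  have hG0 : 0 < G := by linarith
  have hGG : 0 < G^2 := by positivity
  have hp : 0 < hh G r y t₀ := by
    have := h.pos hG0 t₀
    rw [hh_zero hy0, uu_eq this]
    exact div_pos § ¶
  refine ⟨hp, ?_⟩
  by_contra! hcon
  obtain ⟨s, hs, hs0⟩ := hcon
  obtain ⟨ε, he, hpos, _⟩ := zero_pos hG h hy0 §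
  have ha1 : t₀ < min (t₀+ε/2) s := lt_min § hs
  have ha := hpos (min (t₀+ε/2) s) ha1 ((min_le_left _ _).trans_lt §)
  obtain ⟨c, h1, h2, h3, h4⟩ := fz h.sol.cy (min_le_right (t₀+ε/2) s) ha hs0
  have h7 : ∀ z, t₀ < z → z < c → 0 < y z := fun z h1 h2 => by
    rcases lt_or_ge z (min (t₀+ε/2) s) with e | e
    · exact hpos z h1 (e.trans_le ((min_le_left _ _).trans §))
    · exact h4 z e h2
  have h5 := h.h_up hG0 (ha1.trans h1).le (fun z hz => by
    rcases eq_or_lt_of_le hz.2 with e | e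
    · rw [e, h3]
    · rcases eq_or_lt_of_le hz.1 with e' | e'
      · rw [← e', hy0]
      · exact (h7 z e' e).le)
  have hc := h.pos hG0 c
  rw [hh_zero h3, uu_eq hc] at h5
  have h6 : 0 < (G^2 - 2*r c)/(2*r c^2) := by linarith [h5.1]
  rw [div_pos_iff_of_pos_right ¶] at h6
  obtain ⟨ε', he', _, h8⟩ := zero_pos hG h h3 §
  have := h8 (max ((t₀+c)/2) (c - ε'/2)) (lt_max_of_lt_right §) (max_lt § §)
  linarith [h7 (max ((t₀+c)/2) (c - ε'/2)) (lt_max_of_lt_left §) (max_lt § §)]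

structure NP (G : ℝ) (r y : ℝ → ℝ) (t₀ t₁ : ℝ) : Prop where
  lt : t₀ < t₁
  y1 : y t₁ = 0
  r1 : r t₁ < G^2
  mid : ∀ s, t₀ < s → s < t₁ → y s = 0 → G^2 < r s

lemma NP.uniq {r y : ℝ → ℝ} {t₀ a b : ℝ} (ha : NP G r y t₀ a) (hb : NP G r y t₀ b) : a = b := by
  rcases lt_trichotomy a b with h | h | h
  · linarith [hb.mid a ha.lt h ha.y1, ha.r1]
  · exact h
  · linarith [ha.mid b hb.lt h hb.y1, hb.r1]

lemma ell (hG : 10 ≤ G) {r y : ℝ → ℝ} (h : SS G r y) {t₀ : ℝ} (hr : r t₀ ≤ 4/5*G^2) (hy0 : y t₀ = 0)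
    (hE : ∃ s > t₀, y s < 0) : ∃ ta t₁, t₀ < ta ∧ ta < t₁ ∧ NP G r y t₀ t₁ ∧ (∀ s, ta < s → s < t₁ → y s < 0) ∧ 
      (∀ s, t₀ < s → s < ta → 0 < y s) ∧ G^2/2 < r t₁ ∧
      r t₁ ≤ 5/6*G^2 ∧ uu G (r t₀) - 4/G^6 ≤ uu G (r t₁) := by
  have hG0 : 0 < G := by linarith
  have hGG : 0 < G^2 := by positivity
  obtain ⟨s, hs, hs0⟩ := hE
  obtain ⟨ε, he, hpos, _⟩ := zero_pos hG h hy0 §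
  have ha1 : t₀ < min (t₀+ε/2) s := lt_min § hs
  have ha := hpos (min (t₀+ε/2) s) ha1 ((min_le_left _ _).trans_lt §)
  obtain ⟨c, h1, h2, h3, h4⟩ := fz h.sol.cy (min_le_right (t₀+ε/2) s) ha hs0.le
  have h7 : ∀ z, t₀ < z → z < c → 0 < y z := fun z h1 h2 => by
    rcases lt_or_ge z (min (t₀+ε/2) s) with e | e
    · exact hpos z h1 (e.trans_le ((min_le_left _ _).trans §))
    · exact h4 z e h2
  have hc0 : t₀ < c := ha1.trans h1
  have h5 := h.h_up hG0 hc0.le (fun z hz => by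
    rcases eq_or_lt_of_le hz.2 with e | e
    · rw [e, h3]
    · rcases eq_or_lt_of_le hz.1 with e' | e'
      · rw [← e', hy0]
      · exact (h7 z e' e).le)
  have hlb := uu_lb hG0 (h.pos hG0 _) hr
  have hc54 : 5/4*G^2 ≤ r c := by
    rcases zero_far hG h h3 (by rw [hh_zero hy0] at h5; linarith [c47 hG, h5.1]) with e | e
    · obtain ⟨ε', he', _, h8⟩ := zero_pos hG h h3 §
      have := h8 (max ((t₀+c)/2) (c - ε'/2)) (lt_max_of_lt_right §) (max_lt § §)
      linarith [h7 (max ((t₀+c)/2) (c - ε'/2)) (lt_max_of_lt_left §) (max_lt § §)]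
    · exact e
  have hkc : uu G (r t₀) ≤ kk G r y c := by
    have := h.pos hG0 c
    have : 0 ≤ 1/(2*r c^3) := by positivity
    have e := h5.1
    rw [hh_zero hy0] at e
    unfold kk; linarith
  have hG6 : 10/G^6 ≤ (1/1000)/G^2 := by
    rw [div_le_div_iff₀ ¶ ¶]
    have : G^6 = G^4*G^2 := by ring
    have h4 : (10:ℝ)^4 ≤ G^4 := by gcongr
    rw [this]
    nlinarith
  have hdn : ∀ t ≥ c, (∀ z ∈ Icc c t, y z ≤ 0) → -(47/100)/G^2 ≤ hh G r y t ∧ hh G r y t ≤ hh G r y c ∧ r t ≤ r c ∧ kk G r y c ≤ kk G r y t := by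
    intro t ht hz
    have e := h.h_dn hG0 ht hz
    refine ⟨?_, e.1, e.2.2, e.2.1⟩
    have e1 : 1/(2*r t^3) ≤ 10/G^6 := by
      have h9 : (2/5*G^2)^3 ≤ r t^3 := by
        have := h.lb t
        gcongr
      have := h.pos hG0 t
      rw [div_le_div_iff₀ ¶ ¶]
      have : (2/5*G^2)^3 = 8/125*G^6 := by ring
      have : 0 < G^6 := by positivity
      linarith
    have e2 := e.2.1
    have e3 : kk G r y t = hh G r y t + 1/(2*r t^3) := rfl
    have e4 : -(15/32)/G^2 - (1/1000)/G^2 ≥ -(47/100)/G^2 := by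
      rw [← sub_div, ge_iff_le, div_le_div_iff_of_pos_right ¶]; norm_num
    linarith
  obtain ⟨ε2, he2, h8, _⟩ := zero_neg hG h h3 hc54
  have : ∃ s > c, 0 < y s := by
    by_contra! hcon
    have hcon' : ∀ t ≥ c, y t ≤ 0 := fun t ht => by
      rcases eq_or_lt_of_le ht with e | e
      · rw [← e, h3]
      · exact hcon t e
    exact no_bdd hG h (T := c) (fun t ht => (hdn t ht fun z hz => hcon' z hz.1).1) (R := r c)
      (fun t ht => (hdn t ht fun z hz => hcon' z hz.1).2.2.1) (Or.inr hcon')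
  obtain ⟨s', hs', hs'0⟩ := this
  have hb1 : c < min (c+ε2/2) s' := lt_min § hs'
  have hb := h8 (min (c+ε2/2) s') hb1 ((min_le_left _ _).trans_lt §)
  obtain ⟨d, g1, g2, g3, g4⟩ := fz h.sol.cy.neg (min_le_right (c+ε2/2) s') (by simpa using hb) (by simpa using hs'0.le)
  replace g3 : y d = 0 := by simpa using g3
  have g7 : ∀ z, c < z → z < d → y z < 0 := fun z h1 h2 => by
    rcases lt_or_ge z (min (c+ε2/2) s') with e | e
    · exact h8 z h1 (e.trans_le ((min_le_left _ _).trans §))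
    · simpa using g4 z e h2
  have hcd : c < d := hb1.trans g1
  have g5 := hdn d hcd.le (fun z hz => by
    rcases eq_or_lt_of_le hz.2 with e | e
    · rw [e, g3]
    · rcases eq_or_lt_of_le hz.1 with e' | e'
      · rw [← e', h3]
      · exact (g7 z e' e).le)
  have hd56 : r d ≤ 5/6*G^2 := by
    rcases zero_far hG h g3 g5.1 with e | e
    · exact e
    · obtain ⟨ε', he', _, h8⟩ := zero_neg hG h g3 e
      have := h8 (max ((c+d)/2) (d - ε'/2)) (lt_max_of_lt_right §) (max_lt § §)
      linarith [g7 (max ((c+d)/2) (d - ε'/2)) (lt_max_of_lt_left §) (max_lt § §)]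
  have hrd := h.pos hG0 d
  have hd12 : G^2/2 < r d := by
    apply uu_neg hrd
    have e := g5.2.1
    rw [hh_zero g3, hh_zero h3] at e
    have hrc := h.pos hG0 c
    have : uu G (r c) < 0 := by
      rw [uu_eq hrc]
      exact div_neg_of_neg_of_pos § ¶
    linarith
  refine ⟨c, d, hc0, hcd, ⟨hc0.trans hcd, g3, by linarith, fun z e1 e2 e3 => ?_⟩, g7, h7, hd12, hd56, ?_⟩
  · rcases lt_trichotomy z c with e | e | e
    · linarith [h7 z e1 e]
    · rw [e]; linarith
    · linarith [g7 z e e2]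
  · have e1 : 1/(2*r d^3) ≤ 4/G^6 := by
      have h9 : (G^2/2)^3 ≤ r d^3 := by gcongr
      rw [div_le_div_iff₀ ¶ ¶]
      have : (G^2/2)^3 = G^6/8 := by ring
      linarith
    have e3 : kk G r y d = hh G r y d + 1/(2*r d^3) := rfl
    rw [hh_zero g3] at e3
    linarith [g5.2.2.2]
end

open Real Filter Set MeasureTheory Topology

section
variable {G : ℝ}

lemma tube {U : Set ((ℝ × ℝ) × ℝ)} (hU : IsOpen U) {p : ℝ × ℝ} {a b : ℝ} (h : ∀ s ∈ Icc a b, (p, s) ∈ U) :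
    ∀ᶠ q in 𝓝 p, ∀ s ∈ Icc a b, (q, s) ∈ U := by
  obtain ⟨u, v, hu, hv, h1, h2, h3⟩ := generalized_tube_lemma (s := {p}) (t := Icc a b) isCompact_singleton isCompact_Icc (n := U) hU
    (by rintro ⟨x, s⟩ ⟨hx, hs⟩; rw [show x = p from hx]; exact h s hs)
  filter_upwards [hu.mem_nhds (h1 rfl)] with q hq s hs using h3 ⟨hq, h2 hs⟩

lemma near (hG : 0 < G) {p : ℝ × ℝ} (hr : p.1 < G^2) :
    ∃ ε > 0, ∀ᶠ q in 𝓝 p, ∀ s, q.2 < s → s ≤ p.2 + ε → 0 < YY G q s := by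
  have ho : IsOpen {z : (ℝ × ℝ) × ℝ | RR G z.1 z.2 < G^2} := isOpen_lt (RR_cont hG) continuous_const
  have := ho.mem_nhds (show (p, p.2) ∈ _ by simpa [RR_init hG] using hr)
  obtain ⟨U, hU, V, hV, hUV⟩ := mem_nhds_prod_iff.1 this
  obtain ⟨ε, he, hb⟩ := Metric.mem_nhds_iff.1 hV
  refine ⟨ε/2, by linarith, ?_⟩
  have h2 : ∀ᶠ q : ℝ × ℝ in 𝓝 p, q.2 ∈ Metric.ball p.2 ε := continuous_snd.continuousAt.eventually (Metric.ball_mem_nhds _ he)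
  filter_upwards [hU, h2] with q hq hq2 s h1 h3
  have hm : StrictMonoOn (YY G q) (Icc q.2 s) := by
    refine strictMonoOn_of_deriv_pos (convex_Icc _ _) (RR_sol hG q).cy.continuousOn fun z hz => ?_
    rw [((RR_sol hG q) z).2.deriv]
    rw [interior_Icc] at hz
    rw [Metric.mem_ball, Real.dist_eq, abs_lt] at hq2
    have : (q, z) ∈ {z : (ℝ × ℝ) × ℝ | RR G z.1 z.2 < G^2} := hUV ⟨hq, hb (by
      rw [Metric.mem_ball, Real.dist_eq, abs_lt]; constructor <;> linarith [hz.1, hz.2])⟩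
    exact FF_pos hG this
  have := hm ⟨le_rfl, h1.le⟩ ⟨h1.le, le_rfl⟩ h1
  rwa [YY_init hG] at this

def Ep (G : ℝ) (p : ℝ × ℝ) : Prop := ∃ s > p.2, YY G p s < 0
def Hp (G : ℝ) (p : ℝ × ℝ) : Prop := (∀ s > p.2, 0 < YY G p s) ∧ ∃ t > p.2, 0 < hh G (RR G p) (YY G p) t

lemma Ep_open (hG : 0 < G) {p : ℝ × ℝ} (h : Ep G p) : ∀ᶠ q in 𝓝 p, Ep G q := by
  obtain ⟨s, h1, h2⟩ := h
  have c1 : Continuous fun q : ℝ × ℝ => YY G q s := (YY_cont hG).comp (by fun_prop : Continuous fun q : ℝ × ℝ => (q, s))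
  filter_upwards [(isOpen_lt continuous_snd continuous_const).mem_nhds h1, (isOpen_lt c1 continuous_const).mem_nhds h2] with q a b using ⟨s, a, b⟩

lemma SSp (hG : 10 ≤ G) {p : ℝ × ℝ} (hp : 2/5*G^2 ≤ p.1) : SS G (RR G p) (YY G p) :=
  safe § (RR_sol § p) (YY_init § p) (by rw [RR_init §]; exact hp)

lemma Ep_not_Hp {p : ℝ × ℝ} (h : Ep G p) : ¬ Hp G p := fun h' => by
  obtain ⟨s, h1, h2⟩ := h
  linarith [h'.1 s h1]

lemma up_data (hG : 10 ≤ G) {p : ℝ × ℝ} (hp : 2/5*G^2 ≤ p.1) (hp' : p.1 ≤ 4/5*G^2) (h : ¬ Ep G p) :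
    (∀ s > p.2, 0 < YY G p s) ∧ Tendsto (RR G p) atTop atTop ∧ ∃ L, 0 ≤ L ∧ Tendsto (YY G p) atTop (𝓝 (√(2*L))) ∧ 
      ∀ t ≥ p.2, hh G (RR G p) (YY G p) t ≤ L ∧ L ≤ kk G (RR G p) (YY G p) t := by
  have hG0 : 0 < G := by linarith
  have hS := SSp hG hp
  unfold Ep at h; push Not at h
  have h0 := up_pos hG hS (by rw [RR_init hG0]; exact hp') (YY_init hG0 p) h
  refine ⟨h0, esc hG hS (T := p.2) (fun t ht => ?_) ?_⟩
  · rcases eq_or_lt_of_le ht with e | e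
    · rw [← e, YY_init hG0]
    · exact (h0 t e).le
  · rw [hh_zero (YY_init hG0 p)]
    exact (c47 hG).trans (uu_lb hG0 (hS.pos hG0 _) (by rw [RR_init hG0]; exact hp'))

lemma Hp_open (hG : 10 ≤ G) {p : ℝ × ℝ} (hp : 2/5*G^2 < p.1) (hp' : p.1 ≤ 4/5*G^2) (h : Hp G p) : ∀ᶠ q in 𝓝 p, Hp G q := by
  have hG0 : 0 < G := by linarith
  have hS := SSp hG hp.le
  have hE : ¬ Ep G p := fun h' => Ep_not_Hp h' h
  obtain ⟨h0, t, h1, h2⟩ := h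
  have hr := (up_data hG hp.le hp' hE).2.1
  obtain ⟨T, hT1, hT2⟩ := ((hr.eventually_gt_atTop (G^2/2)).and (eventually_ge_atTop t)).exists
  have hT0 : p.2 < T := lt_of_lt_of_le h1 hT2
  have hT3 : 0 < hh G (RR G p) (YY G p) T := lt_of_lt_of_le h2 (hS.h_up hG0 hT2 fun s hs => (h0 s (lt_of_lt_of_le h1 hs.1)).le).1
  obtain ⟨ε, he, hn⟩ := near hG0 (p := p) (by nlinarith [show 0 < G^2 by positivity])
  have ho : IsOpen {z : (ℝ × ℝ) × ℝ | 0 < YY G z.1 z.2} := isOpen_lt continuous_const (YY_cont hG0)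
  have ht := tube ho (p := p) (a := p.2 + ε) (b := T) (fun s hs => h0 s (by linarith [hs.1]))
  have c1 : Continuous fun q : ℝ × ℝ => YY G q T := (YY_cont hG0).comp (by fun_prop : Continuous fun q : ℝ × ℝ => (q, T))
  have c2 : Continuous fun q : ℝ × ℝ => RR G q T := (RR_cont hG0).comp (by fun_prop : Continuous fun q : ℝ × ℝ => (q, T))
  have hrT := hS.pos hG0 T
  have c3 : ContinuousAt (fun q : ℝ × ℝ => hh G (RR G q) (YY G q) T) p := by
    unfold hh uu
    have := c1.continuousAt (x := p)
    have := c2.continuousAt (x := p)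
    refine ContinuousAt.add (by fun_prop) (ContinuousAt.sub (ContinuousAt.div (by fun_prop) (by fun_prop) ¶) (ContinuousAt.div (by fun_prop) (by fun_prop) ¶))
  filter_upwards [hn, ht, c3.eventually_const_lt hT3, c2.continuousAt.eventually_const_lt hT1, c1.continuousAt.eventually_const_lt (h0 T hT0),
    (isOpen_lt continuous_const continuous_fst).mem_nhds hp, (isOpen_lt continuous_snd continuous_const).mem_nhds hT0] with q a1 a2 a3 a4 a5 a6 a7
  have := hyp_pos hG (SSp hG (le_of_lt a6)) a4 a5 a3
  refine ⟨fun s hs => ?_, T, a7, a3⟩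
  rcases le_or_gt s (p.2+ε) with e | e
  · exact a1 s hs e
  · rcases le_or_gt s T with e' | e'
    · exact a2 s ⟨e.le, e'⟩
    · exact this s e'.le

lemma Hp_small (hG : 10 ≤ G) {p : ℝ × ℝ} (hp : 2/5*G^2 ≤ p.1) (hp' : p.1 < G^2/2) : Hp G p := by
  have hG0 : 0 < G := by linarith
  have hS := SSp hG hp
  obtain ⟨h1, h2⟩ := hyp_small hG hS (t₀ := p.2) (by rwa [RR_init hG0]) (YY_init hG0 p)
  refine ⟨h2, p.2+1, by simp, lt_of_lt_of_le h1 (hS.h_up hG0 (by simp) fun s hs => ?_).1⟩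
  rcases eq_or_lt_of_le hs.1 with e | e
  · rw [← e, YY_init hG0]
  · exact (h2 s e).le

lemma Ep_big (hG : 10 ≤ G) {p : ℝ × ℝ} (hp : 3/5*G^2 ≤ p.1) (hp' : p.1 ≤ 4/5*G^2) : Ep G p := by
  have hG0 : 0 < G := by linarith
  have hGG : 100 ≤ G^2 := by nlinarith
  by_contra hc
  obtain ⟨_, _, L, h1, _, h2⟩ := up_data hG § hp' hc
  have h3 := (h2 p.2 le_rfl).2
  have h4 : 0 < p.1 := by linarith
  have h5 : (60:ℝ)≤ p.1 := by linarith
  rw [kk, hh_zero (YY_init hG0 p), RR_init hG0, uu_eq h4] at h3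
  have : (G^2 - 2*p.1)/(2*p.1^2) + 1/(2*p.1^3) = (G^2*p.1 - 2*p.1^2 + 1)/(2*p.1^3) := by field_simp
  rw [this] at h3
  have : (G^2*p.1 - 2*p.1^2 + 1)/(2*p.1^3) < 0 := div_neg_of_neg_of_pos (by nlinarith) ¶
  linarith

lemma NP_cont (hG : 10 ≤ G) {p : ℝ × ℝ} (hp : p.1 < G^2) {t₁ ε : ℝ} (he : 0 < ε)
    (h : NP G (RR G p) (YY G p) p.2 t₁) :
    ∀ᶠ q in 𝓝 p, ∃ t, |t - t₁| < ε ∧ NP G (RR G q) (YY G q) q.2 t := by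
  have hG0 : 0 < G := by linarith
  obtain ⟨e1, he1, hn⟩ := near hG0 (p := p) hp
  obtain ⟨e2, he2, d1, d2⟩ := dsign (RR_sol hG0 p t₁).2 h.y1 (FF_pos hG0 h.r1)
  obtain ⟨e3, he3, d3⟩ := Metric.mem_nhds_iff.1 (((RR_sol hG0 p).cr.continuousAt (x := t₁)).eventually_lt_const h.r1)
  obtain ⟨e, h0, h1, h2, h3, h4⟩ : ∃ e > 0, e < e2 ∧ e < e3 ∧ e < ε ∧ e < (t₁ - p.2)/2 := by
    have := h.lt
    refine ⟨min (min e2 e3) (min ε ((t₁ - p.2)/2))/2, ?_⟩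
    have : 0 < min (min e2 e3) (min ε ((t₁ - p.2)/2)) := lt_min (lt_min he2 he3) (lt_min he §)
    have m1 := (min_le_left (min e2 e3) (min ε ((t₁ - p.2)/2)))
    have m2 := (min_le_right (min e2 e3) (min ε ((t₁ - p.2)/2)))
    have m3 := min_le_left e2 e3
    have m4 := min_le_right e2 e3
    have m5 := min_le_left ε ((t₁ - p.2)/2)
    have m6 := min_le_right ε ((t₁ - p.2)/2)
    refine ⟨by linarith, by linarith, by linarith, by linarith, by linarith⟩
  have o1 : IsOpen {z : (ℝ × ℝ) × ℝ | RR G z.1 z.2 < G^2} := isOpen_lt (RR_cont hG0) continuous_const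
  have o2 : IsOpen {z : (ℝ × ℝ) × ℝ | YY G z.1 z.2 = 0 ∧ RR G z.1 z.2 ≤ G^2}ᶜ := by
    apply IsClosed.isOpen_compl (self := _)
    exact (isClosed_eq (YY_cont hG0) continuous_const).inter (isClosed_le (RR_cont hG0) continuous_const)
  have T1 := tube o1 (p := p) (a := t₁ - e) (b := t₁ + e) (fun s hs => d3 (by
    rw [Metric.mem_ball, Real.dist_eq, abs_lt]; constructor <;> linarith [hs.1, hs.2]))
  have T2 := tube o2 (p := p) (a := p.2 + e1) (b := t₁ - e) (fun s hs => by
    rintro ⟨a, b⟩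
    exact absurd (h.mid s (by linarith [hs.1]) (by linarith [hs.2]) a) (not_lt.2 b))
  have c1 : ∀ T, Continuous fun q : ℝ × ℝ => YY G q T := fun T => (YY_cont hG0).comp (by fun_prop : Continuous fun q : ℝ × ℝ => (q, T))
  filter_upwards [hn, T1, T2, (c1 (t₁-e)).continuousAt.eventually_lt_const (d2 (t₁-e) § §),
    (c1 (t₁+e)).continuousAt.eventually_const_lt (d1 (t₁+e) § §),
    (isOpen_lt continuous_snd continuous_const).mem_nhds (show p.2 < t₁ - e by linarith)] with q a1 a2 a3 a4 a5 a6
  obtain ⟨c, g1, g2, g3, g4⟩ := fz (f := fun s => -YY G q s) (RR_sol hG0 q).cy.neg (show t₁ - e ≤ t₁ + e by linarith) (by simpa using a4) (by simpa using a5.le)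
  refine ⟨c, by rw [abs_lt]; constructor <;> linarith, ⟨lt_trans a6 g1, by simpa using g3, a2 c ⟨g1.le, g2⟩, fun s k1 k2 k3 => ?_⟩⟩
  rcases le_or_gt s (p.2+e1) with k | k
  · exact absurd k3 (a1 s k1 k).ne'
  · rcases le_or_gt s (t₁ - e) with k' | k'
    · have := a3 s ⟨k.le, k'⟩
      by_contra hc
      exact this ⟨k3, not_lt.1 hc⟩
    · have := g4 s k'.le k2
      simp [k3] at this
end

open Real Filter Set MeasureTheory Topology

section
variable {G : ℝ}

def av (G : ℝ) (r y : ℝ → ℝ) (t : ℝ) : ℝ := r t * y t / G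
def vv (G : ℝ) (r y : ℝ → ℝ) (t : ℝ) : ℝ := Th G (av G r y t)
def kv (G : ℝ) (r y : ℝ → ℝ) (t : ℝ) : ℝ := hh G r y t * r t
def fv (r : ℝ → ℝ) (t : ℝ) : ℝ := r t^2 * eh (qq t) (r t)

lemma kv_id (hG : 0 < G) {r y : ℝ → ℝ} {t : ℝ} (hr : 0 < r t) : r t * (1 + kv G r y t) = G^2*(1 + av G r y t^2)/2 := by
  unfold kv av hh uu; field_simp; ring

lemma kv_ne (hG : 0 < G) {r y : ℝ → ℝ} {t : ℝ} (hr : 0 < r t) : 1 + kv G r y t ≠ 0 := by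
  intro h
  have := kv_id hG hr (y := y)
  rw [h, mul_zero] at this
  have : 0 < G^2*(1 + av G r y t^2)/2 := by positivity
  linarith

lemma av_deriv (hG : 0 < G) {r y : ℝ → ℝ} (h : SS G r y) (t : ℝ) :
    HasDerivAt (av G r y) ((1 + 2*kv G r y t + fv r t)/(G * r t)) t := by
  have hr := h.pos hG t
  have h1 := ((h.sol t).1.mul (h.sol t).2).div_const G
  refine h1.congr_deriv ?_
  rw [FF_eq (h.lb' t)]
  unfold kv fv hh uu
  field_simp
  ring

lemma vv_deriv (hG : 0 < G) {r y : ℝ → ℝ} (h : SS G r y) (t : ℝ) :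
    HasDerivAt (vv G r y) ((1 + kv G r y t)*(1 + 2*kv G r y t + fv r t)) t := by
  have hr := h.pos hG t
  have h1 := av_deriv hG h t
  have h2 := (h1.add ((h1.pow 3).div_const 3)).const_mul (G^3/2)
  refine h2.congr_deriv ?_
  have : 1 + kv G r y t = G^2*(1 + av G r y t^2)/2 / r t := by rw [← kv_id hG hr]; field_simp
  rw [this]
  push_cast
  field_simp

lemma fh_real {q m : ℝ} (hm : 0 < m) (hq : 0 ≤ q) : fh ((q:ℂ) / (m:ℂ)^2) = ((m^2 * eh q m : ℝ) : ℂ) := by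
  rw [eh_eq hm hq, mul_div_cancel₀ _ (pow_ne_zero 2 hm.ne')]
  unfold fh
  have : (1 + (q:ℂ)/(m:ℂ)^2) = ((1 + q/m^2 : ℝ) : ℂ) := by push_cast; ring
  rw [this, ← Complex.ofReal_cpow ¶]
  push_cast; ring

section
variable (hG : 0 < G) {r y : ℝ → ℝ} {t : ℝ} (hr : 0 < r t)
include hG hr

lemma rr_real : rr G ((vv G r y t : ℂ), (kv G r y t : ℂ)) = (r t : ℂ) := by
  unfold rr vv
  simp only
  rw [rG_real hG, ← kv_id hG hr, div_eq_iff]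
  · push_cast; ring
  · exact_mod_cast kv_ne hG hr

lemma ff_real : ff G (qq t) ((vv G r y t : ℂ), (kv G r y t : ℂ)) = (fv r t : ℂ) := by
  unfold ff
  rw [rr_real hG hr, fh_real hr (qq_nonneg t)]; rfl

lemma Phi_real : Phi G (qq t) ((vv G r y t : ℂ), (kv G r y t : ℂ)) = ((y t * eh (qq t) (r t) : ℝ) : ℂ) := by
  unfold Phi
  rw [rr_real hG hr, ff_real hG hr]
  simp only
  rw [show (vv G r y t : ℂ) = (Th G (av G r y t) : ℂ) from rfl, pG_real hG]
  unfold av fv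
  have h1 : (r t : ℂ) ≠ 0 := by exact_mod_cast hr.ne'
  have h2 : (G : ℂ) ≠ 0 := by exact_mod_cast hG.ne'
  push_cast
  field_simp

lemma BB_real : BB G (qq t) ((vv G r y t : ℂ), (kv G r y t : ℂ)) = (((1 + kv G r y t)*(1 + 2*kv G r y t + fv r t) - 1 : ℝ) : ℂ) := by
  unfold BB
  rw [ff_real hG hr]
  push_cast; ring
end

structure Par (G : ℝ) (r y : ℝ → ℝ) (ξ : ℝ) : Prop where
  ss : SS G r y
  bd : ∀ t ≥ ξ, hh G r y t ≤ 0 ∧ 0 ≤ kk G r y t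
  tr : Tendsto r atTop atTop

lemma Par.bds (hG : 10 ≤ G) {r y : ℝ → ℝ} {ξ : ℝ} (h : Par G r y ξ) {t : ℝ} (ht : ξ ≤ t) :
    G^2/2 ≤ r t ∧ -(1/2)/r t^2 ≤ kv G r y t ∧ kv G r y t ≤ 0 ∧ 0 ≤ fv r t ∧ fv r t ≤ 3/2/r t^2 ∧ |y t| ≤ 1 := by
  have hG0 : 0 < G := by linarith
  have hr := h.ss.pos hG0 t
  obtain ⟨h1, h2⟩ := h.bd t ht
  have e := eh_bd hr (qq_nonneg t) (qq_le t)
  have h3 : G^2/2 ≤ r t := by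
    by_contra! hc
    have : 0 < uu G (r t) := by rw [uu_eq hr]; exact div_pos § ¶
    unfold hh at h1; nlinarith [sq_nonneg (y t)]
  refine ⟨h3, ?_, ?_, ?_, ?_, ?_⟩
  · unfold kk at h2
    unfold kv
    have : -(1/2)/r t^2 = (-(1/(2*r t^3)))*r t := by field_simp
    rw [this]
    exact mul_le_mul_of_nonneg_right § hr.le
  · exact mul_nonpos_of_nonpos_of_nonneg h1 hr.le
  · exact mul_nonneg ¶ e.1
  · have : 3/2/r t^2 = r t^2 * (3/2/r t^4) := by field_simp
    rw [this]; exact mul_le_mul_of_nonneg_left e.2 ¶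
  · rw [← sq_le_one_iff_abs_le_one]
    unfold hh uu at h1
    have a1 : 0 ≤ G^2/(2*r t^2) := by positivity
    have a2 : 1/r t ≤ 1/2 := by
      apply one_div_le_one_div_of_le £; nlinarith
    linarith

lemma vprime {k f R : ℝ} (hR : 100 ≤ R) (h1 : -(1/2)/R ≤ k) (h2 : k ≤ 0) (h3 : 0 ≤ f) (h4 : f ≤ 3/2/R) :
    1/2 ≤ (1+k)*(1+2*k+f) ∧ |(1+k)*(1+2*k+f) - 1| ≤ 10/R := by
  have hx : (1:ℝ)/R ≤ 1/100 := one_div_le_one_div_of_le £ hR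
  have hx0 : 0 < 1/R := by positivity
  have e1 : -(1/2)/R = -(1/2)*(1/R) := by ring
  have e2 : 3/2/R = 3/2*(1/R) := by ring
  have e3 : 10/R = 10*(1/R) := by ring
  rw [e1] at h1; rw [e2] at h4; rw [e3]
  generalize 1/R = x at *
  refine ⟨by nlinarith, abs_le.2 ⟨by nlinarith, by nlinarith⟩⟩

lemma Par.vp (hG : 10 ≤ G) {r y : ℝ → ℝ} {ξ : ℝ} (h : Par G r y ξ) {t : ℝ} (ht : ξ ≤ t) :
    1/2 ≤ (1 + kv G r y t)*(1 + 2*kv G r y t + fv r t) ∧ |(1 + kv G r y t)*(1 + 2*kv G r y t + fv r t) - 1| ≤ 10/r t^2 := by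
  obtain ⟨b1, b2, b3, b4, b5, _⟩ := h.bds hG ht
  have h50 : 50 ≤ r t := by nlinarith
  have : 100 ≤ r t^2 := by nlinarith
  exact vprime this b2 b3 b4 b5

lemma vsq (A : ℝ) : (A + A^3/3)^2 ≤ (1 + A^2)^3 := by nlinarith [sq_nonneg A, sq_nonneg (A^2), sq_nonneg (A^3)]

lemma Par.grow2 (hG : Γ₀ ≤ G) {r y : ℝ → ℝ} {ξ : ℝ} (h : Par G r y ξ) (hv : |vv G r y ξ| ≤ 1/2) {τ : ℝ} (hτ : 0 ≤ τ) :
    1/r (ξ+τ)^2 ≤ 1/1000*(1+τ)^κ₇ := by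
  have hG10 : 10 ≤ G := by norm_num at hG; linarith
  have hG0 : 0 < G := by linarith
  have hV : ∀ s ≥ ξ, 1/2 ≤ (1 + kv G r y s)*(1 + 2*kv G r y s + fv r s) := fun s hs => (h.vp hG10 hs).1
  have hV2 : (τ - 1)/2 ≤ vv G r y (ξ+τ) := by
    have := mono_of (f := fun s => vv G r y s - 1/2*(s - ξ)) (f' := fun s => (1 + kv G r y s)*(1 + 2*kv G r y s + fv r s) - 1/2)
      (show ξ ≤ ξ+τ by linarith) (fun s hs => (vv_deriv hG0 h.ss s).sub (by
        simpa using ((hasDerivAt_id s).sub_const ξ).const_mul (1/2:ℝ))) (fun s hs => by linarith [hV s hs.1])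
    have := (abs_le.1 hv).1
    simp only [sub_self, mul_zero, add_sub_cancel_left] at *
    linarith
  obtain ⟨b1, b2, b3, b4, b5, _⟩ := h.bds hG10 (show ξ ≤ ξ+τ by linarith)
  have hr := h.ss.pos hG0 (ξ+τ)
  have k1 := kv_id hG0 hr (y := y)
  generalize hA : av G r y (ξ+τ) = A at *
  have hvA : vv G r y (ξ+τ) = G^3/2*(A + A^3/3) := by rw [vv, hA]; rfl
  have hrA : G^2*(1+A^2)/2 ≤ r (ξ+τ) := by rw [← k1]; nlinarith
  have r3 : vv G r y (ξ+τ)^2/2 ≤ r (ξ+τ)^3 := by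
    calc vv G r y (ξ+τ)^2/2 = G^6/8*(A + A^3/3)^2 := by rw [hvA]; ring
      _ ≤ G^6/8*(1+A^2)^3 := by gcongr; exact vsq A
      _ = (G^2*(1+A^2)/2)^3 := by ring
      _ ≤ _ := by gcongr
  generalize r (ξ+τ) = R at *
  generalize vv G r y (ξ+τ) = V at *
  have hR3 : G^6/8 ≤ R^3 := by
    calc G^6/8 = (G^2/2)^3 := by ring
      _ ≤ _ := by gcongr
  have hG6 : (Γ₀)^6 ≤ G^6 := by gcongr
  have hT : (1+τ)^2 ≤ 17*R^3 := by
    have : (1+τ)^2 ≤ (2*(V+1))^2 := by gcongr; linarith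
    norm_num at hG6
    nlinarith [sq_nonneg (V-1)]
  have hR24 : ((10:ℝ)^3)^12 * (1+τ)^14 ≤ R^24 := by
    have a1 : (1+τ)^14 ≤ 17^7*R^21 := by
      calc (1+τ)^14 = ((1+τ)^2)^7 := by ring
        _ ≤ (17*R^3)^7 := by gcongr
        _ = _ := by ring
    have a2 : ((10:ℝ)^3)^12*17^7 ≤ R^3 := by
      norm_num at hG6 ⊢
      linarith
    calc ((10:ℝ)^3)^12 * (1+τ)^14 ≤ ((10:ℝ)^3)^12 * (17^7*R^21) := by gcongr
      _ = (((10:ℝ)^3)^12*17^7)*R^21 := by ring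
      _ ≤ R^3*R^21 := by gcongr
      _ = _ := by ring
  have hfin : 1000*(1+τ)^((7:ℝ)/6) ≤ R^2 := by
    have hw := w_pos hτ ((7:ℝ)/6)
    refine (pow_le_pow_iff_left₀ ¶ ¶ (show (12:ℕ) ≠ 0 by norm_num)).1 ?_
    have e : ((1+τ)^((7:ℝ)/6))^12 = (1+τ)^14 := by
      rw [← Real.rpow_natCast, ← Real.rpow_mul §]; norm_num
    rw [mul_pow, e, ← pow_mul]
    norm_num at hR24 ⊢
    linarith
  have : (1+τ)^κ₇ = 1/(1+τ)^((7:ℝ)/6) := by rw [neg_div, Real.rpow_neg §, one_div]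
  rw [this]
  have hw := w_pos hτ ((7:ℝ)/6)
  rw [show 1/1000*(1/(1+τ)^((7:ℝ)/6)) = 1/(1000*(1+τ)^((7:ℝ)/6)) by field_simp]
  exact one_div_le_one_div_of_le ¶ hfin
end

open Real Filter Set MeasureTheory Topology

section
variable {G : ℝ}

lemma eh_cont (hG : 0 < G) {r y : ℝ → ℝ} (h : SS G r y) : Continuous fun t => eh (qq t) (r t) := by
  have h1 := h.sol.cr
  have h2 := qq_cont
  unfold eh
  refine Continuous.sub (Continuous.div (by fun_prop) (by fun_prop) fun t => ?_) (h1.mul (Continuous.rpow_const (by fun_prop) fun t => Or.inl ?_))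
  · have := h.pos hG t; positivity
  · have := h.pos hG t; have := qq_nonneg t; positivity

lemma uu_cont (hG : 0 < G) {r y : ℝ → ℝ} (h : SS G r y) : Continuous fun t => uu G (r t) := by
  have h1 := h.sol.cr
  unfold uu
  refine Continuous.sub (Continuous.div (by fun_prop) (by fun_prop) fun t => ?_) (Continuous.div (by fun_prop) (by fun_prop) fun t => ?_)
  · have := h.pos hG t; positivity
  · have := h.pos hG t; positivity

lemma hh_cont (hG : 0 < G) {r y : ℝ → ℝ} (h : SS G r y) : Continuous (hh G r y) := by
  have h1 := h.sol.cy
  have h2 := uu_cont hG h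
  unfold hh
  fun_prop

theorem Par.ES (hG : Γ₀ ≤ G) {r y : ℝ → ℝ} {ξ : ℝ} (h : Par G r y ξ) (hv : |vv G r y ξ| < 1/2) :
    ((hh G r y ξ : ℝ) : ℂ) = ES G ξ ((vv G r y ξ : ℝ) : ℂ) := by
  have hG10 : 10 ≤ G := by norm_num at hG; linarith
  have hG0 : 0 < G := by linarith
  have hh0 := hh_cont hG0 h.ss
  have he0 := eh_cont hG0 h.ss
  have hr0 := h.ss.sol.cr
  have hy0 := h.ss.sol.cy
  have hk0 : Continuous (kv G r y) := hh0.mul hr0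
  have hf0 : Continuous (fv r) := (hr0.pow 2).mul he0
  have hv0 : Continuous (vv G r y) := continuous_iff_continuousAt.2 fun t => (vv_deriv hG0 h.ss t).continuousAt
  set v : ℂ := ((vv G r y ξ : ℝ) : ℂ) with hvdef
  have hvV : v ∈ VV G := by
    refine ⟨by simpa [hvdef] using hv, ?_⟩
    have : (2:ℝ) < aG G := by
      unfold aG
      have : G^1 ≤ G^3 := pow_le_pow_right₀ § £
      linarith
    simp only [hvdef, Complex.ofReal_im, abs_zero]; linarith
  set b : ℝ → ℂ := fun τ => ((vv G r y (ξ+τ) - vv G r y ξ - τ : ℝ) : ℂ) with hb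
  set k : ℝ → ℂ := fun τ => ((kv G r y (ξ+τ) : ℝ) : ℂ) with hk
  have hx : ∀ σ, xx v b k σ = (((vv G r y (ξ+σ) : ℝ) : ℂ), ((kv G r y (ξ+σ) : ℝ) : ℂ)) := fun σ => by
    simp only [xx, hb, hk, hvdef, Prod.mk.injEq, and_true]; push_cast; ring
  have mb : Measurable b := (Complex.continuous_ofReal.comp (by fun_prop)).measurable
  have mk : Measurable k := (Complex.continuous_ofReal.comp (by fun_prop)).measurable
  have w2 := fun {τ : ℝ} (hτ : 0 ≤ τ) => h.grow2 hG hv.le hτ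
  have dV : ∀ σ : ℝ, HasDerivAt (fun σ => vv G r y (ξ+σ) - σ) ((1 + kv G r y (ξ+σ))*(1 + 2*kv G r y (ξ+σ) + fv r (ξ+σ)) - 1) σ := fun σ =>
    ((vv_deriv hG0 h.ss (ξ+σ)).comp_const_add ξ σ).sub (hasDerivAt_id σ)
  have dH : ∀ σ : ℝ, HasDerivAt (fun σ => hh G r y (ξ+σ)) (y (ξ+σ) * eh (qq (ξ+σ)) (r (ξ+σ))) σ := fun σ =>
    (hh_deriv hG0 h.ss.sol (h.ss.lb' (ξ+σ))).comp_const_add ξ σ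
  have hbT : ∀ τ, 0 ≤ τ → b τ = Tb G ξ v b k τ := by
    intro τ hτ
    have e1 : ∀ σ, BB G (qq (ξ+σ)) (xx v b k σ) = (((1 + kv G r y (ξ+σ))*(1 + 2*kv G r y (ξ+σ) + fv r (ξ+σ)) - 1 : ℝ) : ℂ) := fun σ => by
      rw [hx, BB_real hG0 (h.ss.pos hG0 _)]
    unfold Tb
    simp only [e1]
    have e2 := intervalIntegral.integral_eq_sub_of_hasDerivAt (a := 0) (b := τ) (fun σ _ => dV σ)
      (Continuous.intervalIntegrable (by fun_prop) _ _)
    rw [intervalIntegral.integral_of_le hτ] at e2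
    rw [integral_complex_ofReal, e2]
    simp only [hb, add_zero, sub_zero]
    push_cast; ring
  have hkb : ∀ τ, 0 ≤ τ → ‖k τ‖ ≤ 1/100 * (1+τ)^κ₇ := by
    intro τ hτ
    obtain ⟨b1, b2, b3, _⟩ := h.bds hG10 (show ξ ≤ ξ+τ by linarith)
    simp only [hk, Complex.norm_real, Real.norm_eq_abs]
    rw [abs_of_nonpos b3]
    have e : -(1/2)/r (ξ+τ)^2 = -(1/2)*(1/r (ξ+τ)^2) := by ring
    have := w2 hτ
    have := w_pos hτ κ₇
    linarith
  have hbb : ∀ τ, 0 ≤ τ → ‖b τ‖ ≤ 1/2 := by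
    intro τ hτ
    rw [hbT τ hτ]
    unfold Tb
    have i1 : IntegrableOn (fun σ : ℝ => 1/100*(1+σ)^κ₇) (Ioi 0) := (tail_int £ le_rfl).1.const_mul _
    have e1 : ‖∫ σ in Ioc 0 τ, BB G (qq (ξ+σ)) (xx v b k σ)‖ ≤ ∫ σ in Ioc 0 τ, 1/100*(1+σ)^κ₇ := by
      apply norm_integral_le_of_norm_le (i1.mono_set Ioc_subset_Ioi_self)
      refine (ae_restrict_iff' measurableSet_Ioc).2 (Eventually.of_forall fun σ hσ => ?_)
      rw [hx, BB_real hG0 (h.ss.pos hG0 _), Complex.norm_real, Real.norm_eq_abs]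
      have e1 := (h.vp hG10 (show ξ ≤ ξ+σ by linarith [hσ.1])).2
      have e2 := w2 hσ.1.le
      have e3 : 10/r (ξ+σ)^2 = 10*(1/r (ξ+σ)^2) := by ring
      linarith
    have e2 : ∫ σ in Ioc 0 τ, 1/100*(1+σ)^κ₇ ≤ ∫ σ in Ioi 0, 1/100*(1+σ)^κ₇ := by
      apply setIntegral_mono_set i1 _ (Eventually.of_forall (Ioc_subset_Ioi_self))
      refine (ae_restrict_iff' measurableSet_Ioi).2 (Eventually.of_forall fun σ (hσ : 0 < σ) => ?_)
      have := w_pos hσ.le κ₇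
      simp only [Pi.zero_apply]; positivity
    rw [integral_const_mul (1/100) (fun σ : ℝ => (1+σ)^κ₇) (μ := volume.restrict (Ioi 0)), tail7] at e2
    linarith
  have hh1 : Tendsto (fun σ => hh G r y (ξ+σ)) atTop (𝓝 0) := by
    have t1 : Tendsto (hh G r y) atTop (𝓝 0) := by
      have := (r3_tendsto h.tr).neg
      rw [neg_zero] at this
      refine tendsto_of_tendsto_of_tendsto_of_le_of_le' this tendsto_const_nhds ?_ ?_
      · filter_upwards [eventually_ge_atTop ξ] with t ht
        have := (h.bd t ht).2
        unfold kk at this; linarith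
      · filter_upwards [eventually_ge_atTop ξ] with t ht using (h.bd t ht).1
    exact t1.comp (tendsto_atTop_add_const_left _ ξ tendsto_id)
  have hkT : ∀ τ, 0 ≤ τ → k τ = Tk G ξ v b k τ := by
    intro τ hτ
    have e1 : ∀ σ, Phi G (qq (ξ+σ)) (xx v b k σ) = ((y (ξ+σ) * eh (qq (ξ+σ)) (r (ξ+σ)) : ℝ) : ℂ) := fun σ => by
      rw [hx, Phi_real hG0 (h.ss.pos hG0 _)]
    rw [Tk, if_pos hτ, hx, rr_real hG0 (h.ss.pos hG0 _)]
    simp only [e1]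
    have i1 : IntegrableOn (fun σ => y (ξ+σ) * eh (qq (ξ+σ)) (r (ξ+σ))) (Ioi τ) := by
      refine Integrable.mono' (tail_int (a := -(7:ℝ)/6) £ hτ).1 ?_ ?_
      · exact ((hy0.comp (by fun_prop)).mul (he0.comp (by fun_prop : Continuous fun σ => ξ + σ))).aestronglyMeasurable
      · refine (ae_restrict_iff' measurableSet_Ioi).2 (Eventually.of_forall fun σ (hσ : τ < σ) => ?_)
        have hs : 0 ≤ σ := by linarith
        obtain ⟨b1, _, _, _, _, b6⟩ := h.bds hG10 (show ξ ≤ ξ+σ by linarith)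
        have hr := h.ss.pos hG0 (ξ+σ)
        have hE := eh_bd hr (qq_nonneg (ξ+σ)) (qq_le (ξ+σ))
        rw [Real.norm_eq_abs, abs_mul, abs_of_nonneg hE.1]
        have h2 : 2 ≤ r (ξ+σ)^2 := by
          have : 2 ≤ r (ξ+σ) := by nlinarith
          nlinarith
        have e3 : 3/2/r (ξ+σ)^4 ≤ 1/r (ξ+σ)^2 := by
          rw [div_le_div_iff₀ ¶ ¶]
          have : r (ξ+σ)^4 = r (ξ+σ)^2*r (ξ+σ)^2 := by ring
          nlinarith
        have := w2 hs
        have := w_pos hs κ₇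
        calc |y (ξ+σ)| * eh (qq (ξ+σ)) (r (ξ+σ)) ≤ 1 * eh (qq (ξ+σ)) (r (ξ+σ)) := by gcongr; exact hE.1
          _ ≤ _ := by linarith [hE.2]
    rw [integral_complex_ofReal, integral_Ioi_of_hasDerivAt_of_tendsto' (fun σ _ => dH σ) i1 hh1]
    simp only [hk, kv]
    push_cast; ring
  have hA : Adm b k := ⟨mb, mk, hbb, hkb⟩
  have h1 := (S_uniq hG hvV hA hbT hkT le_rfl).2
  have h2 := ES_k hG hvV (ξ := ξ)
  have hr := h.ss.pos hG0 ξ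
  have h3 : rG G v = ((r ξ * (1 + kv G r y ξ) : ℝ) : ℂ) := by
    rw [kv_id hG0 hr, ← rG_real hG0]; rfl
  rw [← h1, h3] at h2
  simp only [hk, add_zero] at h2
  have n1 : ((r ξ : ℝ) : ℂ) ≠ 0 := by exact_mod_cast hr.ne'
  have n2 : ((1 + kv G r y ξ : ℝ) : ℂ) ≠ 0 := by exact_mod_cast kv_ne hG0 hr
  have h4 : ((kv G r y ξ : ℝ) : ℂ) = hh G r y ξ * r ξ := by unfold kv; push_cast; ring
  have h5 : ((r ξ : ℝ) : ℂ) * ((1 + kv G r y ξ : ℝ) : ℂ) * (hh G r y ξ : ℂ) = ((r ξ : ℝ) : ℂ) * ((1 + kv G r y ξ : ℝ) : ℂ) * _root_.ES G ξ v := by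
    calc ((r ξ : ℝ) : ℂ) * ((1 + kv G r y ξ : ℝ) : ℂ) * (hh G r y ξ : ℂ) = (kv G r y ξ : ℂ) * (1 + (kv G r y ξ : ℂ)) := by
          push_cast; rw [h4]; ring
      _ = _ := by rw [h2]; push_cast; ring
  exact mul_left_cancel₀ (mul_ne_zero n1 n2) h5
end

open Real Filter Set MeasureTheory Topology

section
variable {G : ℝ}

lemma ten (hG : Γ₀ ≤ G) : 10 ≤ G := by norm_num at hG; linarith

lemma par_of (hG : 10 ≤ G) {p : ℝ × ℝ} (hp : 2/5*G^2 ≤ p.1) (hp' : p.1 ≤ 4/5*G^2) (h : ¬ Ep G p) (h' : ¬ Hp G p) :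
    Par G (RR G p) (YY G p) p.2 ∧ Tendsto (YY G p) atTop (𝓝 0) := by
  have hG0 : 0 < G := by linarith
  obtain ⟨h1, h2, L, h3, h4, h5⟩ := up_data hG hp hp' h
  have hS := SSp hG hp
  have h6 : ∀ t > p.2, hh G (RR G p) (YY G p) t ≤ 0 := by
    by_contra! hc
    exact h' ⟨h1, hc⟩
  have h7 : ∀ t ≥ p.2, hh G (RR G p) (YY G p) t ≤ 0 := fun t ht => by
    refine le_trans (hS.h_up hG0 (show t ≤ t+1 by linarith) fun s hs => ?_).1 (h6 (t+1) §)
    rcases eq_or_lt_of_le (ht.trans hs.1) with e | e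
    · rw [← e, YY_init hG0]
    · exact (h1 s e).le
  refine ⟨⟨hS, fun t ht => ⟨h7 t ht, h3.trans (h5 t ht).2⟩, h2⟩, ?_⟩
  have : L ≤ 0 := by
    refine ge_of_tendsto (r3_tendsto h2) ?_
    filter_upwards [eventually_ge_atTop p.2] with t ht
    have a := (h5 t ht).2
    have b := h7 t ht
    unfold kk at a; linarith
  rw [le_antisymm this h3] at h4
  simpa using h4

lemma hyp_of (hG : 10 ≤ G) {p : ℝ × ℝ} (hp : 2/5*G^2 ≤ p.1) (hp' : p.1 ≤ 4/5*G^2) (h : Hp G p) :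
    Tendsto (RR G p) atTop atTop ∧ ∃ c > 0, Tendsto (YY G p) atTop (𝓝 c) := by
  obtain ⟨h1, h2, L, h3, h4, h5⟩ := up_data hG hp hp' (fun h' => Ep_not_Hp h' h)
  obtain ⟨_, t, ht, ht2⟩ := h
  refine ⟨h2, _, ?_, h4⟩
  have := (h5 t ht.le).1
  exact Real.sqrt_pos.2 §

def PP (G a t : ℝ) : Prop := 2/5*G^2 < a ∧ a < 4/5*G^2 ∧ ¬ Ep G (a, t) ∧ ¬ Hp G (a, t)

lemma uu_inj (hG : 0 < G) {a b : ℝ} (ha : 0 < a) (hb : 0 < b) (ha' : a < G^2) (hb' : b < G^2) (h : uu G a = uu G b) : a = b := by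
  rw [uu_z hG ha, uu_z hG hb, div_left_inj' ¶] at h
  have h1 : 1 < G^2/a := by rwa [one_lt_div ha]
  have h2 : 1 < G^2/b := by rwa [one_lt_div hb]
  have h3 : (G^2/a - G^2/b)*(G^2/a + G^2/b - 2) = 0 := by linarith
  have h4 : G^2/a = G^2/b := by
    rcases mul_eq_zero.1 h3 with e | e <;> linarith
  field_simp at h4
  exact h4.symm

lemma PP_uniq (hG : Γ₀ ≤ G) {a b t : ℝ} (ha : PP G a t) (hb : PP G b t) : a = b := by
  have hG1 := ten hG
  have hG0 : 0 < G := by linarith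
  have hGG : 0 < G^2 := by positivity
  have key : ∀ c, PP G c t → ((uu G c : ℝ) : ℂ) = ES G t 0 := fun c hc => by
    have h1 := (par_of hG1 (p := (c,t)) hc.1.le hc.2.1.le hc.2.2.1 hc.2.2.2).1
    have hv : vv G (RR G (c,t)) (YY G (c,t)) t = 0 := by
      rw [vv, av, show YY G (c,t) t = 0 from YY_init hG0 (c,t)]; simp [Th]
    have h2 := h1.ES hG (by simp only [hv]; norm_num)
    simp only [hv] at h2
    rw [hh_zero (YY_init hG0 (c,t)), RR_init hG0] at h2
    simpa using h2
  have : uu G a = uu G b := by exact_mod_cast (key a ha).trans (key b hb).symm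
  exact uu_inj hG0 (by linarith [ha.1]) (by linarith [hb.1]) (by linarith [ha.2.1]) (by linarith [hb.2.1]) this

lemma conn_aux (hG : 10 ≤ G) {t a b : ℝ} (ha : 2/5*G^2 ≤ a) (hb : b ≤ 4/5*G^2) (h : ∀ c ∈ Ioo a b, ¬ PP G c t) :
    (∀ c ∈ Ioo a b, Hp G (c, t)) ∨ (∀ c ∈ Ioo a b, Ep G (c, t)) := by
  have hG0 : 0 < G := by linarith
  have cc : Continuous fun c : ℝ => (c, t) := by fun_prop
  have o1 : IsOpen {c : ℝ | (2/5*G^2 < c ∧ c < 4/5*G^2) ∧ Hp G (c, t)} := by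
    rw [isOpen_iff_mem_nhds]
    rintro c ⟨⟨h1, h2⟩, h3⟩
    filter_upwards [cc.continuousAt.eventually (Hp_open hG (p := (c,t)) h1 h2.le h3), Ioo_mem_nhds h1 h2] with d h4 h5 using ⟨h5, h4⟩
  have o2 : IsOpen {c : ℝ | Ep G (c, t)} := by
    rw [isOpen_iff_mem_nhds]
    intro c h3
    exact cc.continuousAt.eventually (Ep_open hG0 (p := (c,t)) h3)
  have := isPreconnected_Ioo.subset_or_subset (s := Ioo a b) o1 o2 (by
      rw [Set.disjoint_left]; rintro c ⟨_, h1⟩ h2; exact Ep_not_Hp h2 h1) (by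
      intro c hc
      by_cases e : Ep G (c,t)
      · exact Or.inr e
      · left
        have h1 : 2/5*G^2 < c := lt_of_le_of_lt ha hc.1
        have h2 : c < 4/5*G^2 := lt_of_lt_of_le hc.2 hb
        refine ⟨⟨h1, h2⟩, ?_⟩
        by_contra hH
        exact h c hc ⟨h1, h2, e, hH⟩)
  rcases this with h | h
  · exact Or.inl fun c hc => (h hc).2
  · exact Or.inr fun c hc => h hc

def gg (G t : ℝ) : ℝ := Classical.epsilon (fun a => PP G a t)

lemma gg_PP (hG : 10 ≤ G) (t : ℝ) : PP G (gg G t) t := by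
  apply Classical.epsilon_spec (p := fun a => PP G a t)
  have hGG : 0 < G^2 := by positivity
  by_contra! hc
  rcases conn_aux hG (t := t) (a := 2/5*G^2) (b := 4/5*G^2) le_rfl le_rfl (fun c _ => hc c) with h | h
  · exact Ep_not_Hp (Ep_big hG (p := (7/10*G^2,t)) (by simp only; linarith) (by simp only; linarith)) (h (7/10*G^2) ⟨by linarith, by linarith⟩)
  · exact Ep_not_Hp (h (9/20*G^2) ⟨by linarith, by linarith⟩) (Hp_small hG (p := (9/20*G^2,t)) (by simp only; linarith) (by simp only; linarith))

lemma gg_lb (hG : 10 ≤ G) (t : ℝ) : 1/2*G^2 ≤ gg G t := by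
  by_contra! hc
  have h := gg_PP hG t
  exact h.2.2.2 (Hp_small hG (p := (gg G t, t)) h.1.le (by simp only; linarith))

lemma gg_ub (hG : 10 ≤ G) (t : ℝ) : gg G t < 3/5*G^2 := by
  by_contra! hc
  have h := gg_PP hG t
  exact h.2.2.1 (Ep_big hG (p := (gg G t, t)) hc h.2.1.le)

lemma lt_gg (hG : Γ₀ ≤ G) {a t : ℝ} (ha : 2/5*G^2 ≤ a) (h : a < gg G t) : Hp G (a, t) := by
  have hG1 := ten hG
  have hGG : 0 < G^2 := by positivity
  have h1 := gg_lb hG1 t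
  have h2 := gg_ub hG1 t
  rcases lt_or_ge a (G^2/2) with e | e
  · exact Hp_small hG1 ha e
  rcases conn_aux hG1 (t := t) (a := 2/5*G^2) (b := gg G t) le_rfl § (fun c hc hP => (hc.2.ne (PP_uniq hG hP (gg_PP hG1 t)))) with h | h
  · exact h a ⟨by linarith, by assumption⟩
  · exact absurd (Hp_small hG1 (p := (9/20*G^2,t)) (by simp only; linarith) (by simp only; linarith)) (Ep_not_Hp (h (9/20*G^2) ⟨by linarith, by linarith⟩))

lemma gg_lt (hG : Γ₀ ≤ G) {a t : ℝ} (ha : a ≤ 4/5*G^2) (h : gg G t < a) : Ep G (a, t) := by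
  have hG1 := ten hG
  have hGG : 0 < G^2 := by positivity
  have h1 := gg_lb hG1 t
  have h2 := gg_ub hG1 t
  rcases lt_or_ge (3/5*G^2) a with e | e
  · exact Ep_big hG1 e.le ha
  rcases conn_aux hG1 (t := t) (a := gg G t) (b := 4/5*G^2) § le_rfl (fun c hc hP => (hc.1.ne' (PP_uniq hG hP (gg_PP hG1 t)))) with h | h
  · exact absurd (h (7/10*G^2) ⟨by linarith, by linarith⟩) (Ep_not_Hp (Ep_big hG1 (p := (7/10*G^2,t)) (by simp only; linarith) (by simp only; linarith)))
  · exact h a ⟨by assumption, by linarith⟩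

lemma gg_cont (hG : Γ₀ ≤ G) : Continuous (gg G) := by
  have hG1 := ten hG
  have hGG : 0 < G^2 := by positivity
  rw [continuous_iff_continuousAt]
  intro t
  refine tendsto_order.2 ⟨fun a ha => ?_, fun a ha => ?_⟩
  · have h1 := gg_lb hG1 t
    have h2 := gg_ub hG1 t
    have hm : max a (9/20*G^2) < gg G t := max_lt ha §
    have hm1 := le_max_right a (9/20*G^2)
    have cc : Continuous fun s : ℝ => (max a (9/20*G^2), s) := by fun_prop
    filter_upwards [cc.continuousAt.eventually (Hp_open hG1 (p := (max a (9/20*G^2), t)) (by simp only; linarith) (by simp only; linarith) (lt_gg hG § hm))] with s hs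
    by_contra! hc
    have : gg G s ≤ max a (9/20*G^2) := hc.trans (le_max_left _ _)
    rcases eq_or_lt_of_le this with e | e
    · rw [← e] at hs; exact (gg_PP hG1 s).2.2.2 hs
    · exact Ep_not_Hp (gg_lt hG § e) hs
  · have h1 := gg_lb hG1 t
    have h2 := gg_ub hG1 t
    have hm : gg G t < min a (7/10*G^2) := lt_min ha §
    have hm1 := min_le_right a (7/10*G^2)
    have cc : Continuous fun s : ℝ => (min a (7/10*G^2), s) := by fun_prop
    filter_upwards [cc.continuousAt.eventually (Ep_open § (p := (min a (7/10*G^2), t)) (gg_lt hG § hm))] with s hs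
    by_contra! hc
    have : min a (7/10*G^2) ≤ gg G s := (min_le_left _ _).trans hc
    rcases eq_or_lt_of_le this with e | e
    · rw [e] at hs; exact (gg_PP hG1 s).2.2.1 hs
    · exact Ep_not_Hp hs (lt_gg hG § e)

lemma Ep_shift (hG : 0 < G) (a t : ℝ) (n : ℤ) (h : Ep G (a, t)) : Ep G (a, t + n*(2*π)) := by
  obtain ⟨s, h1, h2⟩ := h
  refine ⟨s + n*(2*π), by simpa using h1, ?_⟩
  rwa [(RR_shift hG a t n s).2]

lemma Hp_shift (hG : 0 < G) (a t : ℝ) (n : ℤ) (h : Hp G (a, t)) : Hp G (a, t + n*(2*π)) := by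
  obtain ⟨h0, s, h1, h2⟩ := h
  refine ⟨fun s hs => ?_, s + n*(2*π), by simpa using h1, ?_⟩
  · have := (RR_shift hG a t n (s - n*(2*π))).2
    rw [sub_add_cancel] at this
    rw [this]
    simp only at hs
    exact h0 _ (by simp only; linarith)
  · unfold hh at *
    rwa [(RR_shift hG a t n s).2, (RR_shift hG a t n s).1]

lemma gg_per (hG : Γ₀ ≤ G) (t : ℝ) (n : ℤ) : gg G (t + n*(2*π)) = gg G t := by
  have hG1 := ten hG
  have hG0 : 0 < G := by linarith
  obtain ⟨h1, h2, h3, h4⟩ := gg_PP hG1 t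
  refine PP_uniq hG (gg_PP hG1 _) ⟨h1, h2, fun h => h3 ?_, fun h => h4 ?_⟩
  · have := Ep_shift hG0 _ _ (-n) h
    push_cast at this; simpa using this
  · have := Hp_shift hG0 _ _ (-n) h
    push_cast at this; simpa using this

lemma gg_not_even (hG : Γ₀ ≤ G) (hES : ∃ ξ v : ℝ, 0 < v ∧ v < 1/2 ∧ ES G ξ v ≠ ES G (-ξ) (-v)) :
    ∃ t, gg G (-t) ≠ gg G t := by
  have hG1 := ten hG
  have hG0 : 0 < G := by linarith
  have hGG : 0 < G^2 := by positivity
  by_contra! hev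
  obtain ⟨ξ, v, hv0, hv1, hne⟩ := hES
  set r := fun t₀ => RR G (gg G t₀, t₀) with hr
  set y := fun t₀ => YY G (gg G t₀, t₀) with hy
  have hP : ∀ t₀, Par G (r t₀) (y t₀) t₀ := fun t₀ => by
    obtain ⟨h1, h2, h3, h4⟩ := gg_PP hG1 t₀
    exact (par_of hG1 (p := (gg G t₀, t₀)) h1.le h2.le h3 h4).1
  have hrev : ∀ t₀ t, r (-t₀) t = r t₀ (-t) ∧ y (-t₀) t = -y t₀ (-t) := fun t₀ t => by
    simp only [hr, hy, hev]; exact RR_neg hG0 _ _ _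
  have hbd : ∀ t₀ t, hh G (r t₀) (y t₀) t ≤ 0 ∧ 0 ≤ kk G (r t₀) (y t₀) t := fun t₀ t => by
    rcases le_total t₀ t with h | h
    · exact (hP t₀).bd t h
    · have := (hP (-t₀)).bd (-t) §
      unfold kk hh at *
      rw [(hrev t₀ (-t)).1, (hrev t₀ (-t)).2] at this
      simpa using this
  have hP' : ∀ t₀ ξ, Par G (r t₀) (y t₀) ξ := fun t₀ ξ => ⟨(hP t₀).ss, fun t _ => hbd t₀ t, (hP t₀).tr⟩
  have hV0 : vv G (r ξ) (y ξ) ξ = 0 := by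
    rw [vv, av, show y ξ ξ = 0 from YY_init hG0 _]; simp [Th]
  have hV1 : 1/2 ≤ vv G (r (ξ-1)) (y (ξ-1)) ξ := by
    have h0 : vv G (r (ξ-1)) (y (ξ-1)) (ξ-1) = 0 := by
      rw [vv, av, show y (ξ-1) (ξ-1) = 0 from YY_init hG0 _]; simp [Th]
    have := mono_of (f := fun s => vv G (r (ξ-1)) (y (ξ-1)) s - 1/2*(s - (ξ-1)))
      (f' := fun s => (1 + kv G (r (ξ-1)) (y (ξ-1)) s)*(1 + 2*kv G (r (ξ-1)) (y (ξ-1)) s + fv (r (ξ-1)) s) - 1/2)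
      (show ξ-1 ≤ ξ by linarith) (fun s hs => (vv_deriv hG0 (hP _).ss s).sub (by
        simpa using ((hasDerivAt_id s).sub_const (ξ-1)).const_mul (1/2:ℝ))) (fun s hs => by linarith [((hP (ξ-1)).vp hG1 hs.1).1])
    simp only [h0] at this
    linarith
  have hc : Continuous fun t₀ => vv G (r t₀) (y t₀) ξ := by
    have g0 := gg_cont hG
    have c0 : Continuous fun t₀ : ℝ => ((gg G t₀, t₀), ξ) := by fun_prop
    have c1 : Continuous fun t₀ => r t₀ ξ := (RR_cont hG0).comp c0
    have c2 : Continuous fun t₀ => y t₀ ξ := (YY_cont hG0).comp c0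
    unfold vv Th av
    fun_prop
  obtain ⟨t₀, _, ht₀⟩ := intermediate_value_Icc' (show ξ - 1 ≤ ξ by linarith) hc.continuousOn
    (show v ∈ Icc (vv G (r ξ) (y ξ) ξ) (vv G (r (ξ-1)) (y (ξ-1)) ξ) from ⟨by rw [hV0]; exact hv0.le, by linarith⟩)
  simp only at ht₀
  have e1 := (hP' t₀ ξ).ES hG (by rw [ht₀, abs_of_pos hv0]; exact hv1)
  have hvn : vv G (r (-t₀)) (y (-t₀)) (-ξ) = -v := by
    rw [← ht₀]
    unfold vv Th av
    rw [(hrev t₀ (-ξ)).1, (hrev t₀ (-ξ)).2, neg_neg]; ring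
  have e2 := (hP' (-t₀) (-ξ)).ES hG (by rw [hvn, abs_neg, abs_of_pos hv0]; exact hv1)
  have e3 : hh G (r (-t₀)) (y (-t₀)) (-ξ) = hh G (r t₀) (y t₀) ξ := by
    unfold hh
    rw [(hrev t₀ (-ξ)).1, (hrev t₀ (-ξ)).2, neg_neg]; ring
  rw [hvn, e3] at e2
  rw [ht₀] at e1
  apply hne
  rw [← e1, e2]; push_cast; rfl
end

open Real Filter Set MeasureTheory Topology

section
variable {G : ℝ}

def T1 (G : ℝ) (p : ℝ × ℝ) : ℝ := Classical.epsilon fun t => NP G (RR G p) (YY G p) p.2 t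

lemma T1_np {p : ℝ × ℝ} {t : ℝ} (h : NP G (RR G p) (YY G p) p.2 t) : NP G (RR G p) (YY G p) p.2 (T1 G p) :=
  Classical.epsilon_spec (p := fun t => NP G (RR G p) (YY G p) p.2 t) ⟨t, h⟩

lemma T1_eq {p : ℝ × ℝ} {t : ℝ} (h : NP G (RR G p) (YY G p) p.2 t) : T1 G p = t := (T1_np h).uniq h

lemma T1_cont (hG : 10 ≤ G) {p : ℝ × ℝ} (hp : p.1 < G^2) {t : ℝ} (h : NP G (RR G p) (YY G p) p.2 t) :
    ContinuousAt (T1 G) p := by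
  rw [Metric.continuousAt_iff']
  intro ε he
  filter_upwards [NP_cont hG hp he (T1_np h)] with q hq
  obtain ⟨s, h1, h2⟩ := hq
  rw [T1_eq h2, Real.dist_eq]
  exact h1

lemma uu_ret (hG : 10 ≤ G) {a b : ℝ} (ha : 0 < a) (ha' : a ≤ 7/10*G^2) (hb : b ≤ 5/6*G^2) (hb0 : 0 < b)
    (h : uu G a - 4/G^6 ≤ uu G b) : b ≤ 3/4*G^2 := by
  have hG0 : 0 < G := by linarith
  have hGG : 100 ≤ G^2 := by nlinarith
  by_contra! hc
  rw [uu_z hG0 ha, uu_z hG0 hb0] at h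
  have h1 : 10/7 ≤ G^2/a := by rw [le_div_iff₀ ha]; linarith
  have h2 : G^2/b ≤ 4/3 := by rw [div_le_iff₀ hb0]; linarith
  have h3 : 6/5 ≤ G^2/b := by rw [le_div_iff₀ hb0]; linarith
  have h4 : 4/G^6 ≤ (4/100)/(2*G^2) := by
    rw [div_le_div_iff₀ ¶ ¶]
    have : 100*100 ≤ G^2*G^2 := mul_le_mul hGG hGG £ §
    nlinarith
  have h5 : ((G^2/a - 1)^2 - 1)/(2*G^2) - (4/100)/(2*G^2) ≤ ((G^2/b-1)^2-1)/(2*G^2) := by linarith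
  rw [← sub_div, div_le_div_iff_of_pos_right ¶] at h5
  nlinarith

lemma ret (hG : 10 ≤ G) {p : ℝ × ℝ} (hp : 2/5*G^2 ≤ p.1) (hp' : p.1 ≤ 4/5*G^2) (hE : Ep G p) :
    NP G (RR G p) (YY G p) p.2 (T1 G p) ∧ G^2/2 < RR G p (T1 G p) ∧
    (p.1 ≤ 7/10*G^2 → RR G p (T1 G p) ≤ 3/4*G^2) ∧
    NP G (RR G (RR G p (T1 G p), -T1 G p)) (YY G (RR G p (T1 G p), -T1 G p)) (-T1 G p) (-p.2) ∧
    Ep G (RR G p (T1 G p), -T1 G p) := by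
  have hG0 : 0 < G := by linarith
  have hGG : 0 < G^2 := by positivity
  have hi := RR_init hG0 p
  obtain ⟨ta, t₁, h1, h2, h3, h4, h5, h6, h7, h8⟩ := ell hG (SSp hG hp) (t₀ := p.2) (by rwa [hi]) (YY_init hG0 p) hE
  rw [T1_eq h3]
  rw [hi] at h8
  obtain ⟨e1, e2⟩ := RR_re hG0 p h3.y1
  have rv : ∀ s, RR G (RR G p t₁, -t₁) s = RR G p (-s) ∧ YY G (RR G p t₁, -t₁) s = - YY G p (-s) := fun s => by
    have := RR_neg hG0 (RR G p t₁) t₁ s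
    rwa [e1, e2] at this
  refine ⟨h3, h6, fun h => uu_ret hG § h h7 § h8, ⟨by linarith [h3.lt], ?_, ?_, fun s hs hs' hy => ?_⟩, ?_⟩
  · rw [(rv _).2, neg_neg, YY_init hG0, neg_zero]
  · rw [(rv _).1, neg_neg, hi]; linarith
  · rw [(rv _).1]
    rw [(rv _).2] at hy
    exact h3.mid _ § § §
  · refine ⟨-((p.2+ta)/2), by simp only; linarith, ?_⟩
    rw [(rv _).2, neg_neg]
    linarith [h5 ((p.2+ta)/2) § §]

lemma Ep_gt (hG : Γ₀ ≤ G) {a t : ℝ} (ha : 2/5*G^2 ≤ a) (h : Ep G (a, t)) : gg G t < a := by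
  by_contra! hc
  rcases eq_or_lt_of_le hc with e | e
  · exact (gg_PP (ten hG) t).2.2.1 (e ▸ h)
  · exact Ep_not_Hp h (lt_gg hG ha e)

lemma NP_shift (hG : 0 < G) {a b t : ℝ} (n : ℤ) (h : NP G (RR G (a,b)) (YY G (a,b)) b t) :
    NP G (RR G (a,b+n*(2*π))) (YY G (a,b+n*(2*π))) (b+n*(2*π)) (t+n*(2*π)) := by
  refine ⟨by linarith [h.lt], ?_, ?_, fun s h1 h2 h3 => ?_⟩
  · rw [(RR_shift hG a b n t).2, h.y1]
  · rw [(RR_shift hG a b n t).1]; exact h.r1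
  · have e := RR_shift hG a b n (s - n*(2*π))
    rw [sub_add_cancel] at e
    rw [e.1]; rw [e.2] at h3
    exact h.mid _ § § h3

lemma red (t : ℝ) : ∃ n : ℤ, t + n*(2*π) ∈ Icc 0 (2*π) := by
  have hp : 0 < 2*π := by positivity
  refine ⟨-⌊t/(2*π)⌋, ?_⟩
  have h1 := Int.floor_le (t/(2*π))
  have h2 := (Int.lt_floor_add_one (t/(2*π))).le
  rw [le_div_iff₀ hp] at h1
  rw [div_le_iff₀ hp] at h2
  push_cast
  constructor <;> linarith

lemma unif {P : ℝ × ℝ → Prop} {K : Set ℝ} (hK : IsCompact K) (h : ∀ t ∈ K, ∀ᶠ q in 𝓝 (t, (0:ℝ)), P q) :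
    ∃ η > 0, ∀ t ∈ K, ∀ e, |e| < η → P (t, e) := by
  obtain ⟨u, v, hu, hv, h1, h2, h3⟩ := generalized_tube_lemma (s := K) (t := {(0:ℝ)}) hK isCompact_singleton
    (n := {q | ∀ᶠ q' in 𝓝 q, P q'}) isOpen_setOfPred_eventually_nhds
    (by rintro ⟨x, s⟩ ⟨hx, hs⟩; rw [show s = 0 from hs]; exact h x hx)
  obtain ⟨η, h4, h5⟩ := Metric.mem_nhds_iff.1 (hv.mem_nhds (h2 rfl))
  refine ⟨η, h4, fun t ht e he => ?_⟩
  have : (t, e) ∈ {q | ∀ᶠ q' in 𝓝 q, P q'} := h3 ⟨h1 ht, h5 (by simpa [Real.dist_eq] using he)⟩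
  exact this.self_of_nhds

def Lg (G T : ℝ) (q : ℝ × ℝ) : Prop := ∀ t, NP G (RR G q) (YY G q) q.2 t → q.2 + T < t ∧ ∃ s, q.2 < s ∧ s < t ∧ T < RR G q s

lemma Lg_near (hG : 10 ≤ G) (T t : ℝ) : ∀ᶠ q in 𝓝 (gg G t, t), Lg G T q := by
  have hG0 : 0 < G := by linarith
  have hGG : 0 < G^2 := by positivity
  obtain ⟨g1, g2, g3, g4⟩ := gg_PP hG t
  set p : ℝ × ℝ := (gg G t, t) with hp
  obtain ⟨u1, u2, -⟩ := up_data hG (p := p) g1.le g2.le g3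
  obtain ⟨T', h1, h2, h3⟩ := ((u2.eventually_gt_atTop T).and ((eventually_ge_atTop (t+T+1)).and (eventually_ge_atTop (t+1)))).exists
  obtain ⟨ε, he, hn⟩ := near hG0 (p := p) (by simp only [hp]; linarith)
  have h4 := tube (isOpen_lt continuous_const (YY_cont hG0) : IsOpen {z : (ℝ × ℝ) × ℝ | 0 < YY G z.1 z.2}) (p := p) (a := t + ε) (b := T')
    (fun s hs => u1 s (by simp only [hp]; linarith [hs.1]))
  have c1 : Continuous fun q : ℝ × ℝ => RR G q T' := (RR_cont hG0).comp (by fun_prop : Continuous fun q : ℝ × ℝ => (q, T'))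
  filter_upwards [hn, h4, (isOpen_lt continuous_const c1).mem_nhds h1,
    (isOpen_lt continuous_snd continuous_const).mem_nhds (show p.2 < t + 1 by simp [hp])] with q a b c d s hs
  have d' : q.2 < t + 1 := d
  have k : T' < s := by
    by_contra! hc
    have := hs.y1
    have h6 : 0 < YY G q s := by
      rcases le_total s (t+ε) with h | h
      · exact a s hs.lt h
      · exact b s ⟨h, hc⟩
    linarith
  exact ⟨by linarith, T', by linarith, k, c⟩

lemma Lg_unif (hG : Γ₀ ≤ G) (T : ℝ) : ∃ η > 0, ∀ a t, |a - gg G t| < η → Lg G T (a, t) := by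
  have hG1 := ten hG
  have hG0 : 0 < G := by linarith
  have c := gg_cont hG
  obtain ⟨η, h1, h2⟩ := unif (P := fun z => Lg G T (gg G z.1 + z.2, z.1)) (K := Icc 0 (2*π)) isCompact_Icc (fun t _ => by
    have c1 : ContinuousAt (fun z : ℝ × ℝ => (gg G z.1 + z.2, z.1)) (t, 0) := by
      have : Continuous (fun z : ℝ × ℝ => (gg G z.1 + z.2, z.1)) := by fun_prop
      exact this.continuousAt
    have := Lg_near hG1 T t
    apply c1.eventually
    simpa using this)
  refine ⟨η, h1, fun a t h s hs => ?_⟩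
  obtain ⟨n, hn⟩ := red t
  have h3 := h2 _ hn (a - gg G t) h
  simp only [gg_per hG, add_sub_cancel] at h3
  obtain ⟨h4, u, h5, h6, h7⟩ := h3 _ (NP_shift hG0 n hs)
  simp only at h4 h5 ⊢
  have e := RR_shift hG0 a t n (u - n*(2*π))
  rw [sub_add_cancel] at e
  rw [e.1] at h7
  exact ⟨by linarith, _, by linarith, by linarith, h7⟩

lemma T1_bdd (hG : Γ₀ ≤ G) {η : ℝ} (he : 0 < η) :
    ∃ T, ∀ a t, gg G t + η ≤ a → a ≤ 4/5*G^2 → T1 G (a,t) ≤ t + T := by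
  have hG1 := ten hG
  have hG0 : 0 < G := by linarith
  have hGG : 0 < G^2 := by positivity
  have c := gg_cont hG
  set K := {p : ℝ × ℝ | gg G p.2 + η ≤ p.1 ∧ p.1 ≤ 4/5*G^2 ∧ p.2 ∈ Icc 0 (2*π)} with hKd
  have hK : IsCompact K := by
    refine (isCompact_Icc.prod isCompact_Icc : IsCompact (Icc (1/2*G^2) (4/5*G^2) ×ˢ Icc 0 (2*π))).of_isClosed_subset ?_ ?_
    · have e1 : IsClosed {p : ℝ × ℝ | gg G p.2 + η ≤ p.1} := isClosed_le (by fun_prop) (by fun_prop)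
      have e2 : IsClosed {p : ℝ × ℝ | p.1 ≤ 4/5*G^2} := isClosed_le (by fun_prop) (by fun_prop)
      exact e1.inter (e2.inter (isClosed_Icc.preimage continuous_snd))
    · rintro ⟨a, t⟩ ⟨h1, h2, h3⟩
      simp only at h1 h2 h3
      exact ⟨⟨by linarith [gg_lb hG1 t], h2⟩, h3⟩
  have np : ∀ a t, gg G t + η ≤ a → a ≤ 4/5*G^2 → NP G (RR G (a,t)) (YY G (a,t)) t (T1 G (a,t)) := fun a t h1 h2 =>
    (ret hG1 (p := (a,t)) (by simp only; linarith [gg_lb hG1 t]) h2 (gg_lt hG h2 §)).1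
  have hc : ContinuousOn (fun p => T1 G p - p.2) K := by
    rintro ⟨a, t⟩ ⟨h1, h2, h3⟩
    simp only at h1 h2 h3
    have := T1_cont hG1 (p := (a,t)) (by simp only; linarith) (np a t h1 h2)
    exact (this.sub continuous_snd.continuousAt).continuousWithinAt
  obtain ⟨T, hT⟩ := hK.bddAbove_image hc
  refine ⟨T, fun a t h1 h2 => ?_⟩
  obtain ⟨n, hn⟩ := red t
  have h3 := hT (mem_image_of_mem _ (show (a, t + n*(2*π)) ∈ K from ⟨by simp only [gg_per hG]; exact h1, h2, hn⟩))
  simp only at h3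
  rw [T1_eq (NP_shift hG0 n (np a t h1 h2))] at h3
  linarith

lemma ret_near (hG : Γ₀ ≤ G) {η : ℝ} (he : 0 < η) :
    ∃ T, ∀ p : ℝ × ℝ, gg G p.2 < p.1 → p.1 ≤ 7/10*G^2 → p.2 + T < T1 G p →
      gg G (-T1 G p) < RR G p (T1 G p) ∧ RR G p (T1 G p) < gg G (-T1 G p) + η := by
  have hG1 := ten hG
  have hG0 : 0 < G := by linarith
  have hGG : 0 < G^2 := by positivity
  obtain ⟨T, hT⟩ := T1_bdd hG he
  refine ⟨T, fun p h1 h2 h3 => ?_⟩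
  obtain ⟨r1, r2, r3, r4, r5⟩ := ret hG1 (p := p) (by linarith [gg_lb hG1 p.2]) § (gg_lt hG § h1)
  refine ⟨Ep_gt hG § r5, ?_⟩
  by_contra! hc
  have := hT _ _ hc (by linarith [r3 h2])
  rw [T1_eq r4] at this
  linarith
end

open Real Filter Set MeasureTheory Topology

lemma lastge {f : ℝ → ℝ} {a b β : ℝ} (hab : a ≤ b) (hf : ContinuousOn f (Icc a b)) (h : β ≤ f a) :
    ∃ c ∈ Icc a b, β ≤ f c ∧ ∀ s ∈ Ioc c b, f s < β := by
  have hK : IsCompact (Icc a b ∩ f ⁻¹' Ici β) :=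
    isCompact_Icc.of_isClosed_subset (hf.preimage_isClosed_of_isClosed isClosed_Icc isClosed_Ici) inter_subset_left
  obtain ⟨c, hc, hm⟩ := hK.exists_isGreatest ⟨a, ⟨left_mem_Icc.2 hab, h⟩⟩
  refine ⟨c, hc.1, hc.2, fun s hs => ?_⟩
  by_contra! h'
  have := hm ⟨⟨hc.1.1.trans hs.1.le, hs.2⟩, h'⟩
  linarith [hs.1]

lemma lastge_eq {f : ℝ → ℝ} {a b β : ℝ} (hab : a ≤ b) (hf : ContinuousOn f (Icc a b)) (h : β ≤ f a) (h' : f b ≤ β) :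
    ∃ c ∈ Icc a b, f c = β ∧ ∀ s ∈ Icc c b, f s ≤ β := by
  obtain ⟨c, hc, h1, h2⟩ := lastge hab hf h
  have e : f c = β := by
    obtain ⟨d, hd, hd'⟩ := intermediate_value_Icc' hc.2 (hf.mono (Icc_subset_Icc hc.1 le_rfl)) (show β ∈ Icc (f b) (f c) from ⟨h', h1⟩)
    rcases eq_or_lt_of_le hd.1 with e | e
    · rw [e]; exact hd'
    · exact absurd (h2 d ⟨e, hd.2⟩) §
  refine ⟨c, hc, e, fun s hs => ?_⟩
  rcases eq_or_lt_of_le hs.1 with e' | e'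
  · rw [← e', e]
  · exact (h2 s ⟨e', hs.2⟩).le

lemma cross {f : ℝ → ℝ} {a b α β : ℝ} (hab : a ≤ b) (hf : ContinuousOn f (Icc a b)) (h1 : β ≤ f a) (h2 : f b ≤ α) (hαβ : α ≤ β) :
    ∃ c d, a ≤ c ∧ c ≤ d ∧ d ≤ b ∧ f c = β ∧ f d = α ∧ ∀ s ∈ Icc c d, f s ∈ Icc α β := by
  obtain ⟨c, hc, e1, e2⟩ := lastge_eq hab hf h1 (h2.trans hαβ)
  have hf' : ContinuousOn (fun s => - f (-s)) (Icc (-b) (-c)) :=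
    (hf.comp continuousOn_neg (fun s hs => ⟨by linarith [hs.2, hc.1], by linarith [hs.1]⟩)).neg
  obtain ⟨d, hd, e3, e4⟩ := lastge_eq (β := -α) (by linarith [hc.2]) hf' (by simpa using h2) (by simp [e1, hαβ])
  simp only [neg_inj, neg_le_neg_iff] at e3 e4
  refine ⟨c, -d, hc.1, by linarith [hd.2], by linarith [hd.1], e1, e3, fun s hs => ⟨?_, e2 s ⟨hs.1, by linarith [hs.2, hd.1]⟩⟩⟩
  have := e4 (-s) ⟨by linarith [hs.2], by linarith [hs.1]⟩
  rwa [neg_neg] at this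

section
variable {G : ℝ}

structure Win (G ta tb δ : ℝ) : Prop where
  lt : ta < tb
  le : tb ≤ ta + 2*π
  pos : 0 < δ
  sm : δ ≤ G^2/100
  ha : gg G (-ta) + 2*δ ≤ gg G ta
  hb : gg G tb + 2*δ ≤ gg G (-tb)

lemma win_exists (hG : Γ₀ ≤ G) (hES : ∃ ξ v : ℝ, 0 < v ∧ v < 1/2 ∧ ES G ξ v ≠ ES G (-ξ) (-v)) :
    ∃ ta tb δ, Win G ta tb δ := by
  have hG0 : 0 < G := by linarith [ten hG]
  obtain ⟨ta, h⟩ : ∃ t, gg G (-t) < gg G t := by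
    obtain ⟨t, ht⟩ := gg_not_even hG hES
    rcases lt_or_gt_of_ne ht with h | h
    · exact ⟨t, h⟩
    · exact ⟨-t, by rwa [neg_neg]⟩
  have hp : 0 < 2*π := by positivity
  set m := ⌊2*ta/(2*π)⌋ + 1 with hm
  have h1 := Int.floor_le (2*ta/(2*π))
  have h2 := Int.lt_floor_add_one (2*ta/(2*π))
  rw [le_div_iff₀ hp] at h1
  rw [div_lt_iff₀ hp] at h2
  have e : (m:ℝ) = ⌊2*ta/(2*π)⌋ + 1 := by rw [hm]; push_cast; ring
  have e1 : gg G (-ta + m*(2*π)) = gg G (-ta) := gg_per hG _ m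
  have e2 : gg G (-(-ta + m*(2*π))) = gg G ta := by
    rw [← gg_per hG (-(-ta + m*(2*π))) m]; congr 1; ring
  refine ⟨ta, -ta + m*(2*π), min ((gg G ta - gg G (-ta))/2) (G^2/100), ?_, ?_, ?_, min_le_right _ _, ?_, ?_⟩
  · rw [e]; linarith
  · rw [e]; linarith
  · exact lt_min § ¶
  · linarith [min_le_left ((gg G ta - gg G (-ta))/2) (G^2/100)]
  · rw [e1, e2]
    linarith [min_le_left ((gg G ta - gg G (-ta))/2) (G^2/100)]

def Cv (G ta tb δ : ℝ) (M : ℤ) (Q : (ℝ → ℝ) → (ℝ → ℝ) → Prop) : Prop :=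
  ∃ P : ℝ → ℝ × ℝ, ContinuousOn P (Icc 0 1) ∧
    (∀ s ∈ Icc (0:ℝ) 1, (P s).2 ∈ Icc (ta + M*(2*π)) (tb + M*(2*π)) ∧ (P s).1 ∈ Icc (2/5*G^2) (3/4*G^2) ∧ Q (RR G (P s)) (YY G (P s))) ∧
    (P 0).1 + 3/2*δ ≤ gg G (P 0).2 ∧ gg G (P 1).2 + 3/2*δ ≤ (P 1).1

def Cnn (G ta tb : ℝ) (M M' : ℤ) (B : ℝ) (r y : ℝ → ℝ) : Prop :=
  (∃ t ∈ Icc (ta + M*(2*π)) (tb + M*(2*π)), y t = 0 ∧ r t ∈ Icc (2/5*G^2) (3/4*G^2)) ∧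
  ∃ t ∈ Icc (ta + M*(2*π)) (tb + M'*(2*π)), B ≤ r t

lemma Cv_init (hG : Γ₀ ≤ G) {ta tb δ : ℝ} (w : Win G ta tb δ) {S : ℝ} (hS : 0 ≤ S) (hS' : S ≤ δ/2) (M : ℤ) :
    Cv G ta tb δ M (fun r y => ∃ t ∈ Icc (ta + M*(2*π)) (tb + M*(2*π)), r = RR G (gg G (-t) - S, t) ∧ y = YY G (gg G (-t) - S, t)) := by
  have hG1 := ten hG
  have hGG : 0 < G^2 := by positivity
  have c := gg_cont hG
  have h1 := w.lt
  have h2 := w.sm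
  have h3 := w.pos
  have n1 : ∀ t, gg G (-(t + M*(2*π))) = gg G (-t) := fun t => by
    rw [← gg_per hG _ M]; congr 1; ring
  have mem : ∀ s ∈ Icc (0:ℝ) 1, ta + M*(2*π) + s*(tb-ta) ∈ Icc (ta + M*(2*π)) (tb + M*(2*π)) := fun s hs =>
    ⟨by nlinarith [hs.1], by nlinarith [hs.2]⟩
  refine ⟨fun s => (gg G (-(ta + M*(2*π) + s*(tb-ta))) - S, ta + M*(2*π) + s*(tb-ta)), by fun_prop, fun s hs => ⟨mem s hs, ?_, _, mem s hs, rfl, rfl⟩, ?_, ?_⟩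
  · have a := gg_lb hG1 (-(ta + M*(2*π) + s*(tb-ta)))
    have b := gg_ub hG1 (-(ta + M*(2*π) + s*(tb-ta)))
    constructor <;> simp only <;> linarith
  · simp only [zero_mul, add_zero, n1, gg_per hG]
    linarith [w.ha]
  · have : ta + M*(2*π) + 1*(tb-ta) = tb + M*(2*π) := by ring
    simp only [this, n1, gg_per hG]
    linarith [w.hb]

lemma step (hG : Γ₀ ≤ G) {ta tb δ : ℝ} (w : Win G ta tb δ) (B : ℝ) :
    ∃ N : ℤ, 1 ≤ N ∧ ∀ M Q, Cv G ta tb δ M Q → Cv G ta tb δ (M+N) (fun r y => Q r y ∧ Cnn G ta tb M (M+N) B r y) := by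
  have hG1 := ten hG
  have hG0 : 0 < G := by linarith
  have hGG : 0 < G^2 := by positivity
  have c := gg_cont hG
  have w1 := w.lt
  have w2 := w.sm
  have w3 := w.pos
  have w4 := w.le
  have hp : 0 < 2*π := by positivity
  obtain ⟨Ta, hTa⟩ := ret_near hG (show 0 < δ/2 by linarith)
  obtain ⟨Tb, hTb⟩ := T1_bdd hG w3
  obtain ⟨η, he, hη⟩ := Lg_unif hG B
  obtain ⟨Tc, hTc⟩ := T1_bdd hG he
  obtain ⟨N, hN⟩ := exists_int_gt (max 1 ((max Ta (max Tb Tc))/(2*π) + 1))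
  have hN1 : (1:ℝ) < N := lt_of_le_of_lt (le_max_left _ _) hN
  have hN2 : max Ta (max Tb Tc) < (N-1)*(2*π) := by
    rw [← div_lt_iff₀ hp]
    linarith [lt_of_le_of_lt (le_max_right 1 ((max Ta (max Tb Tc))/(2*π) + 1)) hN]
  have na : Ta < (N-1)*(2*π) := lt_of_le_of_lt (le_max_left _ _) hN2
  have nb : Tb < (N-1)*(2*π) := lt_of_le_of_lt ((le_max_left _ _).trans (le_max_right _ _)) hN2
  have nc : Tc < (N-1)*(2*π) := lt_of_le_of_lt ((le_max_right _ _).trans (le_max_right _ _)) hN2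
  refine ⟨N, by exact_mod_cast hN1.le, fun M Q h => ?_⟩
  obtain ⟨P, pc, pm, p0, p1⟩ := h
  set α := ta + (M+N:ℤ)*(2*π) with hα
  set β := tb + (M+N:ℤ)*(2*π) with hβ
  push_cast at hα hβ
  have pc1 : ContinuousOn (fun s => (P s).1) (Icc 0 1) := continuous_fst.comp_continuousOn pc
  have pc2 : ContinuousOn (fun s => (P s).2) (Icc 0 1) := continuous_snd.comp_continuousOn pc
  have dc : ContinuousOn (fun s => gg G (P s).2 - (P s).1) (Icc 0 1) := (c.comp_continuousOn pc2).sub pc1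

  obtain ⟨sa, hsa, a1, a2⟩ := lastge (β := 0) zero_le_one dc §
  have dp : ∀ s ∈ Ioc sa 1, gg G (P s).2 < (P s).1 := fun s hs => by linarith [a2 s hs]

  obtain ⟨η', he', hη'⟩ := Lg_unif hG ((N+1)*(2*π))
  set ε := min (η'/2) (3/2*δ) with hε
  have he1 : 0 < ε := lt_min § §
  obtain ⟨s1, hs1, b1⟩ := intermediate_value_Icc' hsa.2 (dc.mono (Icc_subset_Icc hsa.1 le_rfl)) (show -ε ∈ Icc _ _ from
    ⟨by linarith [min_le_right (η'/2) (3/2*δ)], by linarith⟩)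
  simp only at b1
  have hs1' : sa < s1 := lt_of_le_of_ne hs1.1 (by rintro rfl; linarith)
  have hs0 : 0 ≤ s1 := hsa.1.trans hs1.1
  have np : ∀ s ∈ Ioc sa 1, _ := fun s hs =>
    ret hG1 (p := P s) (pm s ⟨by linarith [hsa.1, hs.1], hs.2⟩).2.1.1 (by linarith [(pm s ⟨by linarith [hsa.1, hs.1], hs.2⟩).2.1.2])
      (gg_lt hG (by linarith [(pm s ⟨by linarith [hsa.1, hs.1], hs.2⟩).2.1.2]) (dp s hs))
  have sub : ∀ s ∈ Icc s1 1, s ∈ Ioc sa 1 := fun s hs => ⟨lt_of_lt_of_le hs1' hs.1, hs.2⟩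
  have Tc' : ContinuousOn (fun s => T1 G (P s)) (Icc s1 1) := fun s hs => by
    have := T1_cont hG1 (p := P s) (by linarith [(pm s ⟨by linarith [hs.1], hs.2⟩).2.1.2]) (np s (sub s hs)).1
    exact ContinuousAt.comp_continuousWithinAt (g := T1 G) (f := P) this ((pc s ⟨by linarith [hs.1], hs.2⟩).mono (Icc_subset_Icc hs0 le_rfl))
  have q1 : β ≤ T1 G (P s1) := by
    have := hη' (P s1).1 (P s1).2 (by
      rw [show (P s1).1 - gg G (P s1).2 = ε by linarith, abs_of_pos he1]
      linarith [min_le_left (η'/2) (3/2*δ)]) _ (np s1 ⟨hs1', hs1.2⟩).1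
    have h3 := (pm s1 ⟨hs0, hs1.2⟩).1.1
    have := this.1
    simp only at this
    rw [hβ]; nlinarith
  have q2 : T1 G (P 1) ≤ α := by
    have h3 := (pm 1 ⟨zero_le_one, le_rfl⟩)
    have := hTb (P 1).1 (P 1).2 § (by linarith [h3.2.1.2])
    have h4 := h3.1.2
    rw [hα]; linarith
  obtain ⟨sc, sd, r1, r2, r3, r4, r5, r6⟩ := cross hs1.2 Tc' q1 q2 (by linarith : α ≤ β)

  have F : ∀ s ∈ Icc sc sd, (P s).1 ≤ gg G (P s).2 + δ ∧ gg G (-T1 G (P s)) < RR G (P s) (T1 G (P s)) ∧ RR G (P s) (T1 G (P s)) < gg G (-T1 G (P s)) + δ/2 ∧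
      ∃ u ∈ Icc (ta + M*(2*π)) β, B ≤ RR G (P s) u := fun s hs => by
    have hs' : s ∈ Icc s1 1 := ⟨r1.trans hs.1, hs.2.trans r3⟩
    have h3 := pm s ⟨hs0.trans hs'.1, hs'.2⟩
    have h4 := (r6 s hs).1
    have h5 := h3.1.2
    have h6 : (P s).2 + (N-1)*(2*π) ≤ T1 G (P s) := by linarith
    have k1 : (P s).1 ≤ gg G (P s).2 + δ := by
      by_contra! hc
      have := hTb (P s).1 (P s).2 hc.le (by linarith [h3.2.1.2])
      linarith
    have k2 : (P s).1 < gg G (P s).2 + η := by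
      by_contra! hc
      have := hTc (P s).1 (P s).2 hc (by linarith [h3.2.1.2])
      linarith
    have k3 := dp s (sub s hs')
    obtain ⟨k4, k5⟩ := hTa (P s) k3 (by linarith [gg_ub hG1 (P s).2]) §
    obtain ⟨-, u, u1, u2, u3⟩ := hη (P s).1 (P s).2 (by rw [abs_of_pos] <;> linarith) _ (np s (sub s hs')).1
    simp only at u1 u2
    exact ⟨k1, k4, k5, u, ⟨by linarith [h3.1.1], by linarith [(r6 s hs).2]⟩, u3.le⟩
  have σm : ∀ s ∈ Icc (0:ℝ) 1, sd + s*(sc-sd) ∈ Icc sc sd := fun s hs => ⟨by nlinarith [hs.2], by nlinarith [hs.1]⟩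
  have n1 : ∀ t, gg G (-(t + (M+N:ℤ)*(2*π))) = gg G (-t) := fun t => by
    rw [← gg_per hG _ (M+N)]; congr 1; ring
  have Pc : ContinuousOn (fun s => P (sd + s*(sc-sd))) (Icc 0 1) :=
    pc.comp (by fun_prop) fun s hs => ⟨by linarith [(σm s hs).1], by linarith [(σm s hs).2]⟩
  have Tc2 : ContinuousOn (fun s => T1 G (P (sd + s*(sc-sd)))) (Icc 0 1) :=
    Tc'.comp (by fun_prop) fun s hs => ⟨by linarith [(σm s hs).1], by linarith [(σm s hs).2]⟩
  refine ⟨fun s => (RR G (P (sd + s*(sc-sd))) (T1 G (P (sd + s*(sc-sd)))), T1 G (P (sd + s*(sc-sd)))), ?_, fun s hs => ?_, ?_, ?_⟩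
  · exact ((RR_cont hG0).comp_continuousOn (Pc.prodMk Tc2)).prodMk Tc2
  · set z := sd + s*(sc-sd)
    have hz := σm s hs
    have hz' : z ∈ Icc s1 1 := ⟨r1.trans hz.1, hz.2.trans r3⟩
    have hz0 : z ∈ Icc (0:ℝ) 1 := ⟨hs0.trans hz'.1, hz'.2⟩
    obtain ⟨k1, k2, k3, k4⟩ := F z hz
    obtain ⟨m1, m2, m3, -⟩ := np z (sub z hz')
    obtain ⟨e1, e2⟩ := RR_re hG0 (P z) m1.y1
    simp only
    rw [e1, e2]
    refine ⟨r6 z hz, ⟨by linarith, m3 (by linarith [gg_ub hG1 (P z).2])⟩, (pm z hz0).2.2, ⟨(P z).2, (pm z hz0).1, YY_init hG0 _, ?_⟩, k4⟩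
    rw [RR_init hG0]; exact (pm z hz0).2.1
  · have := F sd ⟨r2, le_rfl⟩
    simp only [zero_mul, add_zero, r5] at this ⊢
    rw [hα] at this ⊢
    have e := w.ha
    have e3 := n1 ta
    have e4 := gg_per hG ta (M+N)
    push_cast at e3 e4
    linarith [this.2.2.1]
  · have := F sc ⟨le_rfl, r2⟩
    simp only [one_mul, add_sub_cancel, r4] at this ⊢
    rw [hβ] at this ⊢
    have e := w.hb
    have e3 := n1 tb
    have e4 := gg_per hG tb (M+N)
    push_cast at e3 e4
    linarith [this.2.1]
end

open Real Filter Set MeasureTheory Topology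

section
variable {G : ℝ}

lemma Cv.mono {ta tb δ : ℝ} {M : ℤ} {Q Q' : (ℝ → ℝ) → (ℝ → ℝ) → Prop} (h : Cv G ta tb δ M Q) (hQ : ∀ r y, Q r y → Q' r y) :
    Cv G ta tb δ M Q' := by
  obtain ⟨P, h1, h2, h3⟩ := h
  exact ⟨P, h1, fun s hs => ⟨(h2 s hs).1, (h2 s hs).2.1, hQ _ _ (h2 s hs).2.2⟩, h3⟩

lemma chain {ta tb δ : ℝ} {M : ℤ → ℤ} {B : ℤ → ℝ}
    (hM : ∀ i Q, Cv G ta tb δ (M i) Q → Cv G ta tb δ (M (i+1)) (fun r y => Q r y ∧ Cnn G ta tb (M i) (M (i+1)) (B i) r y))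
    {a : ℤ} {Q : (ℝ → ℝ) → (ℝ → ℝ) → Prop} (h : Cv G ta tb δ (M a) Q) (k : ℕ) :
    Cv G ta tb δ (M (a+k)) (fun r y => Q r y ∧ ∀ i, a ≤ i → i < a+k → Cnn G ta tb (M i) (M (i+1)) (B i) r y) := by
  induction k with
  | zero =>
    simp only [Nat.cast_zero, add_zero]
    exact h.mono fun r y hq => ⟨hq, fun i h1 h2 => by omega⟩
  | succ k ih =>
    have := hM _ _ ih
    rw [show a + (k:ℤ) + 1 = a + ((k+1:ℕ):ℤ) by push_cast; ring] at this
    refine this.mono fun r y ⟨⟨h1, h2⟩, h3⟩ => ⟨h1, fun i h4 h5 => ?_⟩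
    by_cases h6 : i < a + k
    · exact h2 i h4 h6
    · have : i = a + k := by push_cast at h5; omega
      subst this
      rw [show a + (k:ℤ) + 1 = a + ((k+1:ℕ):ℤ) by push_cast; ring]
      exact h3

lemma closed_ex {C : Set ((ℝ × ℝ) × ℝ)} (hC : IsClosed C) (a b : ℝ) : IsClosed {p : ℝ × ℝ | ∃ t ∈ Icc a b, (p, t) ∈ C} := by
  rw [← isOpen_compl_iff, isOpen_iff_mem_nhds]
  intro p hp
  filter_upwards [tube hC.isOpen_compl (p := p) (a := a) (b := b) fun s hs hm => hp ⟨s, hs, hm⟩] with q hq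
  rintro ⟨t, h1, h2⟩
  exact hq t h1 h2

lemma Cnn_closed (hG : 0 < G) (ta tb : ℝ) (M M' : ℤ) (B : ℝ) : IsClosed {p : ℝ × ℝ | Cnn G ta tb M M' B (RR G p) (YY G p)} := by
  have cr := RR_cont hG
  have cy := YY_cont hG
  have e1 : IsClosed {z : (ℝ × ℝ) × ℝ | YY G z.1 z.2 = 0} := isClosed_eq cy continuous_const
  have e2 : IsClosed {z : (ℝ × ℝ) × ℝ | RR G z.1 z.2 ∈ Icc (2/5*G^2) (3/4*G^2)} := isClosed_Icc.preimage cr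
  have e3 : IsClosed {z : (ℝ × ℝ) × ℝ | B ≤ RR G z.1 z.2} := isClosed_le continuous_const cr
  exact (closed_ex (e1.inter e2) _ _).inter (closed_ex e3 _ _)

lemma exists_M (ν : ℤ → ℤ) : ∃ M : ℤ → ℤ, M 0 = 0 ∧ ∀ i, M (i+1) = M i + ν i := by
  refine ⟨fun i => match i with
    | Int.ofNat n => ∑ j ∈ Finset.range n, ν j
    | Int.negSucc n => - ∑ j ∈ Finset.range (n+1), ν (Int.negSucc j), by rfl, fun i => ?_⟩
  match i with
  | Int.ofNat n =>
    show ∑ j ∈ Finset.range (n+1), ν j = _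
    rw [Finset.sum_range_succ]; rfl
  | Int.negSucc 0 =>
    show (0:ℤ) = - ∑ j ∈ Finset.range (0+1), ν (Int.negSucc j) + _
    simp
  | Int.negSucc (n+1) =>
    show - ∑ j ∈ Finset.range (n+1), ν (Int.negSucc j) = - ∑ j ∈ Finset.range (n+1+1), ν (Int.negSucc j) + _
    rw [Finset.sum_range_succ _ (n+1)]; ring

lemma sol_c2 (hG : 0 < G) {r : ℝ → ℝ} (cr : Continuous r) : Continuous fun t => FF G t (r t) := by
  have h := FF_cont hG
  have := h.comp (continuous_id.prodMk cr)
  exact this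
lemma sol_cd {r y f : ℝ → ℝ} (h1 : ∀ t, HasDerivAt r (y t) t) (h2 : ∀ t, HasDerivAt y (f t) t) (hf : Continuous f) : ContDiff ℝ 2 r := by
  have d1 : deriv r = y := funext fun t => (h1 t).deriv
  have d2 : deriv y = f := funext fun t => (h2 t).deriv
  have cy : ContDiff ℝ 1 y := contDiff_one_iff_deriv.2 ⟨fun t => (h2 t).differentiableAt, by rw [d2]; exact hf⟩
  have := (contDiff_succ_iff_deriv (n := 1) (f := r) (𝕜 := ℝ)).2 ⟨fun t => (h1 t).differentiableAt, fun e => absurd e (by simp), by rw [d1]; exact cy⟩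
  rwa [one_add_one_eq_two] at this
lemma FF_val {t a : ℝ} (h : G^2/4 ≤ a) : FF G t a = G ^ 2 / a ^ 3 - a * (a ^ 2 + primRho t ^ 2 / 4) ^ (-(3 : ℝ) / 2) := by
  rw [FF, cl, max_eq_left h, F1, qq]
lemma SS.isSol (hG : 0 < G) {r y : ℝ → ℝ} (h : SS G r y) : IsSolutionOn G r Set.univ := by
  have d1 : deriv r = y := funext fun t => (h.sol t).1.deriv
  have hGG : 0 < G^2 := by positivity
  intro t _
  refine ⟨h.pos hG t, (sol_cd (fun t => (h.sol t).1) (fun t => (h.sol t).2) (sol_c2 hG h.sol.cr)).contDiffAt, ?_⟩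
  rw [d1, (h.sol t).2.deriv]
  exact FF_val (by linarith [h.lb t])

lemma hfm_refl {l l' : Filter ℝ} (h : Tendsto (fun t : ℝ => -t) l l') (h' : Tendsto (fun t : ℝ => -t) l' l) {r : ℝ → ℝ} {X : FinalMotion}
    (hr : HasFinalMotion l (fun t => r (-t)) X) : HasFinalMotion l' r X := by
  have e1 : ∀ t, deriv (fun t => r (-t)) t = - deriv r (-t) := fun t => deriv_comp_neg r t
  cases X with
  | hyperbolic =>
    obtain ⟨h1, c, h2, h3⟩ := hr
    refine ⟨by simpa [Function.comp_def] using h1.comp h', c, h2, ?_⟩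
    simpa [Function.comp_def, e1] using h3.comp h'
  | parabolic =>
    obtain ⟨h1, h3⟩ := hr
    refine ⟨by simpa [Function.comp_def] using h1.comp h', ?_⟩
    have := (h3.comp h').neg
    simpa [Function.comp_def, e1] using this
  | bounded =>
    obtain ⟨M, h1⟩ := hr
    refine ⟨M, ?_⟩
    simpa using h'.eventually h1
  | oscillatory =>
    obtain ⟨h1, M, h2⟩ := hr
    exact ⟨fun M => h.frequently (h1 M), M, h.frequently h2⟩

lemma top_hyp (hG : 10 ≤ G) {p : ℝ × ℝ} (hp : 2/5*G^2 ≤ p.1) (hp' : p.1 ≤ 4/5*G^2) (h : Hp G p) :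
    HasFinalMotion atTop (RR G p) .hyperbolic := by
  obtain ⟨h1, c, h2, h3⟩ := hyp_of hG hp hp' h
  have d1 : deriv (RR G p) = YY G p := funext fun t => (RR_sol § p t).1.deriv
  refine ⟨h1, c, h2, ?_⟩
  rw [d1]
  have := h3.abs
  rwa [abs_of_pos h2] at this

lemma top_par (hG : 10 ≤ G) (t : ℝ) : HasFinalMotion atTop (RR G (gg G t, t)) .parabolic := by
  obtain ⟨g1, g2, g3, g4⟩ := gg_PP hG t
  obtain ⟨h1, h2⟩ := par_of hG (p := (gg G t, t)) g1.le g2.le g3 g4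
  have d1 : deriv (RR G (gg G t, t)) = YY G (gg G t, t) := funext fun s => (RR_sol § _ s).1.deriv
  refine ⟨h1.tr, ?_⟩
  rw [d1]; exact h2

lemma r_near {C D : ℝ} (hC : ∀ t r, |FF G t r| ≤ C) {r y : ℝ → ℝ} (h : Sol G r y) {t t₀ : ℝ} (hy : y t₀ = 0) (hd : |t - t₀| ≤ D) :
    r t ≤ r t₀ + C*D*D := by
  have hC0 : 0 ≤ C := (abs_nonneg _).trans (hC 0 0)
  have hD0 : 0 ≤ D := (abs_nonneg _).trans hd
  have h1 : ∀ s ∈ Icc (t₀ - D) (t₀ + D), ‖y s‖ ≤ C*D := fun s hs => by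
    have := Convex.norm_image_sub_le_of_norm_hasDerivWithin_le (f := y) (f' := fun t => FF G t (r t)) (C := C) (s := univ) (x := t₀) (y := s)
      (fun x _ => (h x).2.hasDerivWithinAt) (fun x _ => hC _ _) convex_univ trivial trivial
    rw [hy, sub_zero] at this
    refine this.trans (mul_le_mul_of_nonneg_left ?_ hC0)
    rw [Real.norm_eq_abs, abs_le]; constructor <;> linarith [hs.1, hs.2]
  have := Convex.norm_image_sub_le_of_norm_hasDerivWithin_le (f := r) (f' := y) (C := C*D) (s := Icc (t₀ - D) (t₀ + D)) (x := t₀) (y := t)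
      (fun x _ => (h x).1.hasDerivWithinAt) h1 (convex_Icc _ _) ⟨by linarith, by linarith⟩
      ⟨by linarith [(abs_le.1 hd).1], by linarith [(abs_le.1 hd).2]⟩
  have h2 : C*D*‖t - t₀‖ ≤ C*D*D := mul_le_mul_of_nonneg_left hd ¶
  have := (le_abs_self _).trans (this.trans h2)
  linarith
end

open Real Filter Set MeasureTheory Topology

section
variable {G : ℝ}

lemma M_bd {M : ℤ → ℤ} (h0 : M 0 = 0) (h : ∀ i, M i + 1 ≤ M (i+1)) (n : ℕ) : (n:ℤ) ≤ M n ∧ M (-n) ≤ -n := by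
  induction n with
  | zero => simp [h0]
  | succ n ih =>
    have h1 := h n
    have h2 := h (-(n+1:ℤ))
    rw [show -(n+1:ℤ) + 1 = -n by ring] at h2
    push_cast
    constructor <;> linarith [ih.1, ih.2]

lemma M_lin {M : ℤ → ℤ} (h0 : M 0 = 0) {N : ℤ} (n : ℕ) :
    ((∀ i ≥ 0, M (i+1) = M i + N) → M n = N*n) ∧ ((∀ i < 0, M (i+1) = M i + N) → M (-n) = -(N*n)) := by
  induction n with
  | zero => simp [h0]
  | succ n ih =>
    refine ⟨fun h => ?_, fun h => ?_⟩
    · have h1 := h n ¶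
      push_cast; rw [h1, ih.1 h]; ring
    · have h2 := h (-(n+1:ℤ)) §
      rw [show -(n+1:ℤ) + 1 = -n by ring, ih.2 h] at h2
      push_cast; linarith

def BO (G ta tb : ℝ) (Nf : ℝ → ℤ) (X : FinalMotion) (b : ℤ → ℝ) : Prop :=
  ∀ (B : ℤ → ℝ) (M : ℤ → ℤ), M 0 = 0 → (∀ i, M (i+1) = M i + Nf (B i)) → ∀ r y, Sol G r y →
    ((∀ i ≥ 0, B i = b i) → (∀ i ≥ 0, Cnn G ta tb (M i) (M (i+1)) (B i) r y) → HasFinalMotion atTop r X) ∧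
    ((∀ i < 0, B i = b i) → (∀ i < 0, Cnn G ta tb (M i) (M (i+1)) (B i) r y) → HasFinalMotion atBot r X)

lemma BO_bdd (hG : 0 < G) {ta tb : ℝ} (hw : tb ≤ ta + 2*π) {Nf : ℝ → ℤ} (hN : ∀ B, 1 ≤ Nf B) : BO G ta tb Nf .bounded (fun _ => 0) := by
  intro B M h0 hM r y hs
  obtain ⟨C, -, hC⟩ := FF_bd hG
  have hp : 0 < 2*π := by positivity
  set N := Nf 0 with hNd
  have hN1 : (1:ℝ) ≤ N := by exact_mod_cast hN 0
  have hNp : 0 < N*(2*π) := by positivity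
  have key : ∀ t, (M ⌊(t-ta)/(N*(2*π))⌋ = N*⌊(t-ta)/(N*(2*π))⌋) → Cnn G ta tb (M ⌊(t-ta)/(N*(2*π))⌋) (M (⌊(t-ta)/(N*(2*π))⌋+1)) (B ⌊(t-ta)/(N*(2*π))⌋) r y →
      r t ≤ 3/4*G^2 + C*(N*(2*π)+2*π)*(N*(2*π)+2*π) := by
    intro t h1 h2
    have f1 := Int.floor_le ((t-ta)/(N*(2*π)))
    have f2 := (Int.lt_floor_add_one ((t-ta)/(N*(2*π)))).le
    rw [le_div_iff₀ hNp] at f1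
    rw [div_le_iff₀ hNp] at f2
    obtain ⟨⟨s, ⟨s1, s2⟩, s3, s4⟩, -⟩ := h2
    rw [h1] at s1 s2
    push_cast at s1 s2
    have := r_near hC hs (t := t) (D := N*(2*π)+2*π) s3 (by rw [abs_le]; constructor <;> linarith)
    linarith [s4.2]
  refine ⟨fun hb hc => ⟨3/4*G^2 + C*(N*(2*π)+2*π)*(N*(2*π)+2*π), ?_⟩, fun hb hc => ⟨3/4*G^2 + C*(N*(2*π)+2*π)*(N*(2*π)+2*π), ?_⟩⟩
  · filter_upwards [eventually_ge_atTop ta] with t ht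
    have h1 : 0 ≤ ⌊(t-ta)/(N*(2*π))⌋ := Int.floor_nonneg.2 (div_nonneg § hNp.le)
    refine key t ?_ (hc _ h1)
    obtain ⟨n, hn⟩ := Int.eq_ofNat_of_zero_le h1
    rw [hn]
    exact (M_lin h0 n).1 fun i hi => by rw [hM, hb i hi]
  · filter_upwards [eventually_lt_atBot ta] with t ht
    have h1 : ⌊(t-ta)/(N*(2*π))⌋ < 0 := Int.floor_lt.2 (by push_cast; exact div_neg_of_neg_of_pos § hNp)
    refine key t ?_ (hc _ h1)
    obtain ⟨n, hn⟩ := Int.eq_ofNat_of_zero_le (show 0 ≤ -⌊(t-ta)/(N*(2*π))⌋ by omega)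
    have e : ⌊(t-ta)/(N*(2*π))⌋ = -(n:ℤ) := by omega
    rw [e, (M_lin (N := N) h0 n).2 fun i hi => by rw [hM, hb i hi]]
    ring

lemma BO_osc (hG : 0 < G) {ta tb : ℝ} {Nf : ℝ → ℤ} (hN : ∀ B, 1 ≤ Nf B) : BO G ta tb Nf .oscillatory (fun i => |(i:ℝ)|) := by
  intro B M h0 hM r y hs
  have hp : 1 ≤ 2*π := by linarith [Real.pi_gt_three]
  have hGG : 0 < G^2 := by positivity
  have bd := M_bd h0 (fun i => by rw [hM]; linarith [hN (B i)])
  refine ⟨fun hb hc => ⟨fun R => frequently_atTop.2 fun a => ?_, G^2, frequently_atTop.2 fun a => ?_⟩,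
    fun hb hc => ⟨fun R => frequently_atBot.2 fun a => ?_, G^2, frequently_atBot.2 fun a => ?_⟩⟩
  · obtain ⟨n, hn⟩ := exists_nat_gt (max R (a - ta))
    obtain ⟨-, s, ⟨s1, s2⟩, s3⟩ := hc n ¶
    rw [hb n ¶] at s3
    have h1 : (n:ℝ) ≤ M n := by exact_mod_cast (bd n).1
    have h2 := lt_of_le_of_lt (le_max_left _ _) hn
    have h3 := lt_of_le_of_lt (le_max_right _ _) hn
    have h4 : (0:ℝ) ≤ n := by positivity
    refine ⟨s, by nlinarith, ?_⟩
    simp only [Int.cast_natCast, abs_of_nonneg h4] at s3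
    linarith
  · obtain ⟨n, hn⟩ := exists_nat_gt (a - ta)
    obtain ⟨⟨s, ⟨s1, s2⟩, -, s3⟩, -⟩ := hc n ¶
    have h1 : (n:ℝ) ≤ M n := by exact_mod_cast (bd n).1
    have h4 : (0:ℝ) ≤ n := by positivity
    exact ⟨s, by nlinarith, by linarith [s3.2]⟩
  · obtain ⟨n, hn⟩ := exists_nat_gt (max R (tb - a))
    have hn0 : -((n+1:ℕ):ℤ) < 0 := by push_cast; omega
    obtain ⟨-, s, ⟨s1, s2⟩, s3⟩ := hc (-((n+1:ℕ):ℤ)) hn0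
    rw [hb _ hn0] at s3
    rw [show -((n+1:ℕ):ℤ) + 1 = -n by push_cast; ring] at s2
    have h1 : (M (-n) : ℝ) ≤ -n := by exact_mod_cast (bd n).2
    have h2 := lt_of_le_of_lt (le_max_left _ _) hn
    have h3 := lt_of_le_of_lt (le_max_right _ _) hn
    have h4 : (0:ℝ) ≤ n := by positivity
    refine ⟨s, by nlinarith, ?_⟩
    push_cast at s3
    rw [abs_neg, abs_of_nonneg §] at s3
    linarith
  · obtain ⟨n, hn⟩ := exists_nat_gt (tb - a)
    have hn0 : -((n+1:ℕ):ℤ) < 0 := by push_cast; omega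
    obtain ⟨⟨s, ⟨s1, s2⟩, -, s3⟩, -⟩ := hc (-((n+1:ℕ):ℤ)) hn0
    have h1 : (M (-((n+1:ℕ):ℤ)) : ℝ) ≤ -((n+1:ℕ):ℝ) := by exact_mod_cast (bd (n+1)).2
    have h4 : (0:ℝ) ≤ n := by positivity
    push_cast at h1 s2
    exact ⟨s, by nlinarith, by linarith [s3.2]⟩

def HPm (G : ℝ) (X : FinalMotion) (S : ℝ) : Prop := ∀ t, HasFinalMotion atTop (RR G (gg G t - S, t)) X

def Ex (G : ℝ) (X Y : FinalMotion) : Prop :=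
  ∃ p : ℝ × ℝ, 2/5*G^2 ≤ p.1 ∧ HasFinalMotion atTop (RR G p) X ∧ HasFinalMotion atBot (RR G p) Y

lemma RR_negf (hG : 0 < G) (a b : ℝ) : RR G (a, -b) = fun t => RR G (a,b) (-t) := funext fun t => (RR_neg hG a b t).1

lemma bot_of (hG : 0 < G) {a b : ℝ} {X : FinalMotion} (h : HasFinalMotion atTop (RR G (a, -b)) X) : HasFinalMotion atBot (RR G (a, b)) X := by
  rw [RR_negf hG] at h
  exact hfm_refl tendsto_neg_atTop_atBot tendsto_neg_atBot_atTop h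

lemma Ex.symm (hG : 0 < G) {X Y : FinalMotion} (h : Ex G X Y) : Ex G Y X := by
  obtain ⟨⟨a, b⟩, h1, h2, h3⟩ := h
  refine ⟨(a, -b), h1, ?_, bot_of hG (by rwa [neg_neg])⟩
  have := RR_negf hG a (-b)
  rw [neg_neg] at this
  rw [this] at h3
  exact hfm_refl tendsto_neg_atBot_atTop tendsto_neg_atTop_atBot h3

lemma ex_hh (hG : Γ₀ ≤ G) {ta tb δ : ℝ} (w : Win G ta tb δ) {X Y : FinalMotion} {S S' : ℝ} (hS : 0 ≤ S) (hS' : S ≤ δ/2)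
    (hT : 0 ≤ S') (hT' : S' ≤ δ/2) (hX : HPm G X S) (hY : HPm G Y S') : Ex G X Y := by
  have hG0 : 0 < G := by linarith [ten hG]
  have c := gg_cont hG
  have w1 := w.ha
  have w2 := w.hb
  have w3 := w.pos
  have cc : ContinuousOn (fun t => gg G (-t) - gg G t) (Icc ta tb) := by fun_prop
  obtain ⟨t, -, ht⟩ := intermediate_value_Icc w.lt.le cc (show S' - S ∈ Icc _ _ from ⟨by linarith, by linarith⟩)
  simp only at ht
  refine ⟨(gg G t - S, t), ?_, hX t, bot_of hG0 ?_⟩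
  · simp only; nlinarith [gg_lb (ten hG) t, w.sm]
  · rw [show gg G t - S = gg G (-t) - S' by linarith]
    exact hY (-t)

lemma ex_bh (hG : Γ₀ ≤ G) {ta tb δ : ℝ} (w : Win G ta tb δ) {Nf : ℝ → ℤ} 
    (hN : ∀ B M Q, Cv G ta tb δ M Q → Cv G ta tb δ (M+Nf B) (fun r y => Q r y ∧ Cnn G ta tb M (M+Nf B) B r y))
    {X Y : FinalMotion} {b : ℤ → ℝ} {S : ℝ} (hS : 0 ≤ S) (hS' : S ≤ δ/2)
    (hX : BO G ta tb Nf X b) (hY : HPm G Y S) : Ex G X Y := by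
  have hG0 : 0 < G := by linarith [ten hG]
  have c := gg_cont hG
  obtain ⟨M, h0, hM⟩ := exists_M (fun i => Nf (b i))
  have hM' : ∀ i Q, Cv G ta tb δ (M i) Q → Cv G ta tb δ (M (i+1)) (fun r y => Q r y ∧ Cnn G ta tb (M i) (M (i+1)) (b i) r y) := fun i Q h => by
    rw [hM]; exact hN _ _ _ h
  have ch := chain hM' (a := 0) (Cv_init hG w hS hS' (M 0))
  set f : ℝ → ℝ × ℝ := fun t => (gg G (-t) - S, t) with hf
  have cf : Continuous f := by fun_prop
  set K : ℕ → Set ℝ := fun n => {t | t ∈ Icc ta tb ∧ ∀ i : ℤ, 0 ≤ i → i < n → Cnn G ta tb (M i) (M (i+1)) (b i) (RR G (f t)) (YY G (f t))} with hK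
  have kc : ∀ n, IsClosed (K n) := fun n => by
    have : {t : ℝ | ∀ i : ℤ, 0 ≤ i → i < n → Cnn G ta tb (M i) (M (i+1)) (b i) (RR G (f t)) (YY G (f t))} =
      ⋂ (i : ℤ) (_ : 0 ≤ i) (_ : i < n), f ⁻¹' {p | Cnn G ta tb (M i) (M (i+1)) (b i) (RR G p) (YY G p)} := by ext; simp
    refine isClosed_Icc.inter (this ▸ ?_ : IsClosed {t : ℝ | ∀ i : ℤ, 0 ≤ i → i < n → Cnn G ta tb (M i) (M (i+1)) (b i) (RR G (f t)) (YY G (f t))})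
    exact isClosed_iInter fun i => isClosed_iInter fun _ => isClosed_iInter fun _ => (Cnn_closed hG0 _ _ _ _ _).preimage cf
  obtain ⟨t, ht⟩ := IsCompact.nonempty_iInter_of_sequence_nonempty_isCompact_isClosed K
    (fun n t ht => ⟨ht.1, fun i h1 h2 => ht.2 i h1 (by push_cast; omega)⟩)
    (fun n => by
      obtain ⟨P, -, h2, -⟩ := ch n
      obtain ⟨-, -, ⟨t, h3, h4, h5⟩, h6⟩ := h2 0 ⟨le_rfl, zero_le_one⟩
      refine ⟨t, by simpa [h0] using h3, fun i i1 i2 => ?_⟩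
      have := h6 i i1 (by simpa using i2)
      rwa [h4, h5] at this)
    (isCompact_Icc.of_isClosed_subset (kc 0) fun t ht => ht.1) kc
  rw [mem_iInter] at ht
  refine ⟨f t, ?_, ?_, ?_⟩
  · simp only [hf]; nlinarith [gg_lb (ten hG) (-t), w.sm]
  · refine (hX b M h0 hM _ _ (RR_sol hG0 (f t))).1 (fun _ _ => rfl) fun i hi => ?_
    exact (ht (i.toNat+1)).2 i hi (by push_cast; omega)
  · exact bot_of hG0 (hY (-t))

lemma ex_bb (hG : Γ₀ ≤ G) {ta tb δ : ℝ} (w : Win G ta tb δ) {Nf : ℝ → ℤ} 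
    (hN : ∀ B M Q, Cv G ta tb δ M Q → Cv G ta tb δ (M+Nf B) (fun r y => Q r y ∧ Cnn G ta tb M (M+Nf B) B r y))
    {X Y : FinalMotion} {b b' : ℤ → ℝ} (hX : BO G ta tb Nf X b) (hY : BO G ta tb Nf Y b') : Ex G X Y := by
  have hG0 : 0 < G := by linarith [ten hG]
  set B : ℤ → ℝ := fun i => if 0 ≤ i then b i else b' i with hB
  obtain ⟨M, h0, hM⟩ := exists_M (fun i => Nf (B i))
  have hM' : ∀ i Q, Cv G ta tb δ (M i) Q → Cv G ta tb δ (M (i+1)) (fun r y => Q r y ∧ Cnn G ta tb (M i) (M (i+1)) (B i) r y) := fun i Q h => by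
    rw [hM]; exact hN _ _ _ h
  set K : ℕ → Set (ℝ × ℝ) := fun n => {p | p ∈ Icc (2/5*G^2) (3/4*G^2) ×ˢ Icc ta tb ∧ ∀ i : ℤ, -n ≤ i → i < n+1 → Cnn G ta tb (M i) (M (i+1)) (B i) (RR G p) (YY G p)} with hK
  have kc : ∀ n, IsClosed (K n) := fun n => by
    have : {p : ℝ × ℝ | ∀ i : ℤ, -n ≤ i → i < n+1 → Cnn G ta tb (M i) (M (i+1)) (B i) (RR G p) (YY G p)} =
      ⋂ (i : ℤ) (_ : -n ≤ i) (_ : i < n+1), {p | Cnn G ta tb (M i) (M (i+1)) (B i) (RR G p) (YY G p)} := by ext; simp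
    refine (isClosed_Icc.prod isClosed_Icc).inter (this ▸ ?_ : IsClosed {p : ℝ × ℝ | ∀ i : ℤ, -n ≤ i → i < n+1 → Cnn G ta tb (M i) (M (i+1)) (B i) (RR G p) (YY G p)})
    exact isClosed_iInter fun i => isClosed_iInter fun _ => isClosed_iInter fun _ => Cnn_closed hG0 _ _ _ _ _
  obtain ⟨p, hp⟩ := IsCompact.nonempty_iInter_of_sequence_nonempty_isCompact_isClosed K
    (fun n t ht => ⟨ht.1, fun i h1 h2 => ht.2 i (by push_cast; omega) (by push_cast; omega)⟩)
    (fun n => by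
      obtain ⟨P, -, h2, -⟩ := chain hM' (a := -n) (Cv_init hG w le_rfl (by linarith [w.pos]) (M (-n))) (2*n+1)
      obtain ⟨-, -, -, h6⟩ := h2 0 ⟨le_rfl, zero_le_one⟩
      obtain ⟨⟨t, t1, t2, t3⟩, -⟩ := h6 0 (by omega) (by push_cast; omega)
      obtain ⟨e1, e2⟩ := RR_re hG0 (P 0) t2
      refine ⟨(RR G (P 0) t, t), ⟨t3, by simpa [h0] using t1⟩, fun i i1 i2 => ?_⟩
      rw [e1, e2]
      exact h6 i i1 (by push_cast; omega))
    ((isCompact_Icc.prod isCompact_Icc).of_isClosed_subset (kc 0) fun t ht => ht.1) kc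
  rw [mem_iInter] at hp
  have hc : ∀ i, Cnn G ta tb (M i) (M (i+1)) (B i) (RR G p) (YY G p) := fun i =>
    (hp i.natAbs).2 i (by omega) (by omega)
  refine ⟨p, (hp 0).1.1.1, ?_, ?_⟩
  · exact (hX B M h0 hM _ _ (RR_sol hG0 p)).1 (fun i hi => by simp [hB, hi]) fun i _ => hc i
  · exact (hY B M h0 hM _ _ (RR_sol hG0 p)).2 (fun i hi => by simp [hB, hi]) fun i _ => hc i

lemma ex_all (hG : Γ₀ ≤ G) (hES : ∃ ξ v : ℝ, 0 < v ∧ v < 1/2 ∧ ES G ξ v ≠ ES G (-ξ) (-v)) (X Y : FinalMotion) : Ex G X Y := by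
  have hG1 := ten hG
  have hG0 : 0 < G := by linarith
  have hGG : 0 < G^2 := by positivity
  obtain ⟨ta, tb, δ, w⟩ := win_exists hG hES
  choose Nf hN1 hN using step hG w
  have w3 := w.pos
  have w4 := w.sm
  have cls : ∀ X, (∃ S, 0 ≤ S ∧ S ≤ δ/2 ∧ HPm G X S) ∨ ∃ b, BO G ta tb Nf X b := fun X => by
    cases X with
    | hyperbolic =>
      refine .inl ⟨δ/2, by linarith, le_rfl, fun t => ?_⟩
      have h1 := gg_lb hG1 t
      have h2 := gg_ub hG1 t
      exact top_hyp hG1 (by simp only; linarith) (by simp only; linarith) (lt_gg hG § §)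
    | parabolic => exact .inl ⟨0, le_rfl, by linarith, fun t => by rw [sub_zero]; exact top_par hG1 t⟩
    | bounded => exact .inr ⟨_, BO_bdd hG0 w.le hN1⟩
    | oscillatory => exact .inr ⟨_, BO_osc hG0 hN1⟩
  rcases cls X with ⟨S, s1, s2, s3⟩ | ⟨b, hb⟩ <;> rcases cls Y with ⟨S', s1', s2', s3'⟩ | ⟨b', hb'⟩
  · exact ex_hh hG w s1 s2 s1' s2' s3 s3'
  · exact (ex_bh hG w hN s1 s2 hb' s3).symm hG0
  · exact ex_bh hG w hN s1' s2' hb s3'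
  · exact ex_bb hG w hN hb hb'
end

end

theorem rei3bp_final_motions :
    ∃ Gstar : ℝ, 0 < Gstar ∧ ∀ G : ℝ, Gstar < G →
      (∀ X Y : FinalMotion, ∃ r : ℝ → ℝ,
        IsSolutionOn G r Set.univ ∧
        HasFinalMotion Filter.atTop r X ∧ HasFinalMotion Filter.atBot r Y) ∧
      (∃ r : ℝ → ℝ, IsSolutionOn G r Set.univ ∧
        HasFinalMotion Filter.atTop r .oscillatory ∧
        HasFinalMotion Filter.atBot r .oscillatory) := by
  obtain ⟨G1, h1, h2⟩ := ES_asym_real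
  have hp : (0:ℝ) < 10^40 := by positivity
  refine ⟨G1, lt_of_lt_of_le hp h1, fun G hG => ?_⟩
  have hG1 : (10:ℝ)^40 ≤ G := h1.trans hG.le
  have key : ∀ X Y : FinalMotion, ∃ r : ℝ → ℝ, IsSolutionOn G r Set.univ ∧
      HasFinalMotion Filter.atTop r X ∧ HasFinalMotion Filter.atBot r Y := fun X Y => by
    obtain ⟨p, h3, h4, h5⟩ := ex_all hG1 (h2 G hG.le) X Y
    exact ⟨RR G p, (SSp (ten hG1) h3).isSol (lt_of_lt_of_le hp hG1), h4, h5⟩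
  exact ⟨key, key _ _⟩
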